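/- arXiv:1305.1109 — 4 statements merged into one kernel-verified Lean document; each statement's English description precedes it below -/
import Mathlib

section
/- Let w : [T₀,T₁] → ℝ^ℤ be a C¹ solution of the cooperative linear system such that w(t) has sub-exponential growth for every t ∈ [T₀,T₁], and let m < n be integers such that w_m(t) ≠ 0 and w_n(t) ≠ 0 for all t ∈ [T₀,T₁]. If for some t₀ ∈ (T₀,T₁) the configuration w(t₀) has a singular zero at some position j with m < j < n, then for all s, t ∈ [T₀,T₁] with s < t₀ < t one has z_{m,n}(w(t)) < z_{m,n}(w(s)). -/
open Set Filter Topology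

/-- `w` has a zero at position `j`: the graph of `i ↦ w i` crosses `0` in `[j, j+1)`. -/
def zeroAt (w : ℤ → ℝ) (j : ℤ) : Prop :=
  ∃ x : ℝ, 0 ≤ x ∧ x < 1 ∧ w j + (w (j + 1) - w j) * x = 0

/-- The zero of `w` at `j` is singular. -/
def singZeroAt (w : ℤ → ℝ) (j : ℤ) : Prop :=
  w j = 0 ∧ (w (j + 1) = 0 ∨ w (j - 1) = 0 ∨ w (j - 1) * w (j + 1) > 0)

/-- The number of positions `j` with `m ≤ j ≤ n - 1` at which `w` has a zero. -/
noncomputable def zCount (w : ℤ → ℝ) (m n : ℤ) : ℕ :=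
  Set.ncard {j : ℤ | m ≤ j ∧ j < n ∧ zeroAt w j}

/-- A configuration `w : ℤ → ℝ` has sub-exponential growth:
`limsup_{|j| → ∞} (log |w j|)/|j| ≤ 0`. -/
def SubExp (w : ℤ → ℝ) : Prop :=
  ∀ ε : ℝ, 0 < ε → ∀ᶠ j in (Filter.cofinite : Filter ℤ), Real.log |w j| ≤ ε * |(j : ℝ)|

open Asymptotics

theorem zeroAt_iff (w : ℤ → ℝ) (j : ℤ) : zeroAt w j ↔ w j = 0 ∨ w j * w (j + 1) < 0 := by
  constructor
  · rintro ⟨x, hx0, hx1, hx⟩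
    by_cases h : w j = 0
    · exact Or.inl h
    · right
      have hx' : 0 < x := by
        rcases hx0.eq_or_lt with h0 | h0
        · subst h0
          simp at hx
          exact absurd hx h
        · exact h0
      have h2 : 0 < w j * w j := mul_self_pos.mpr h
      have h3 : x * (w j * w (j + 1)) = -((1 - x) * (w j * w j)) := by linear_combination w j * hx
      have h4 : 0 < (1 - x) * (w j * w j) := mul_pos (by linarith) h2
      by_contra hcon
      have := mul_nonneg hx'.le (not_lt.mp hcon)
      linarith
  · rintro (h | h)
    · exact ⟨0, le_rfl, one_pos, by simp [h]⟩
    · have hj : w j ≠ 0 := by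
        rintro h0
        simp [h0] at h
      have h2 : 0 < w j * w j := mul_self_pos.mpr hj
      have hne : w j - w (j + 1) ≠ 0 := by
        intro h0
        have : w (j + 1) = w j := by linarith
        rw [this] at h
        linarith
      have hden : 0 < w j * w j - w j * w (j + 1) := by linarith
      have heq : w j / (w j - w (j + 1)) = (w j * w j) / (w j * w j - w j * w (j + 1)) := by
        rw [← mul_sub, mul_div_mul_left _ _ hj]
      refine ⟨w j / (w j - w (j + 1)), ?_, ?_, ?_⟩
      · rw [heq]; positivity
      · rw [heq, div_lt_one hden]; linarith
      · field_simp
        ring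

/-- Up to sign, `v j` is `τ ^ d` times a positive combination of `u (j - d)` and `u (j + d)`
whenever `u` vanishes at distance less than `d` from `j`. -/
def SignExpansion (u v : ℤ → ℝ) (τ : ℝ) (m n : ℤ) : Prop :=
  ∀ j, m ≤ j → j ≤ n → ∀ d : ℕ, (d : ℤ) ≤ n - m → (∀ x : ℤ, |x - j| < d → u x = 0) →
    ∀ y : ℝ, 0 ≤ y * u (j - d) → 0 ≤ y * u (j + d) →
      (0 < y * u (j - d) ∨ 0 < y * u (j + d)) → 0 < y * v j * τ ^ d

namespace SignExpansion

variable {u v : ℤ → ℝ} {τ : ℝ} {m n : ℤ}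

theorem mul_pos_of_ne (h : SignExpansion u v τ m n) {j : ℤ} (hmn : m < n) (hm : m ≤ j)
    (hn : j ≤ n) (hj : u j ≠ 0) : 0 < u j * v j := by
  have h2 : 0 < u j * u j := mul_self_pos.mpr hj
  have := h j hm hn 0 (by simp; omega)
    (fun x hx => by have := abs_nonneg (x - j); simp at hx; omega) (u j)
    (by simp [h2.le]) (by simp [h2.le]) (by simp [h2])
  simpa using this

theorem mul_pos_of_neighbor (h : SignExpansion u v τ m n) (hτ : 0 < τ) {j : ℤ} (hm : m < j)
    (hn : j ≤ n) (hj : u j = 0) {y : ℝ} (h1 : 0 ≤ y * u (j - 1)) (h2 : 0 ≤ y * u (j + 1))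
    (h3 : 0 < y * u (j - 1) ∨ 0 < y * u (j + 1)) : 0 < y * v j := by
  have := h j hm.le hn 1 (by push_cast; omega)
    (fun x hx => by
      have : x = j := by
        rw [abs_lt] at hx
        push_cast at hx
        omega
      rw [this, hj]) y (by simpa using h1) (by simpa using h2) (by simpa using h3)
  rw [pow_one] at this
  exact pos_of_mul_pos_left this hτ.le

/-- Where forward in time a zero of `v` lies over a nonzero value without sign change of `u`, the
next position is a zero of `u`, and it is not a zero of `v`. -/
theorem forward_shift (h : SignExpansion u v τ m n) (hτ : 0 < τ) {j : ℤ} (hm : m ≤ j)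
    (hn : j < n) (hun : u n ≠ 0) (hv : zeroAt v j) (hu : ¬ zeroAt u j) :
    j + 1 < n ∧ u j ≠ 0 ∧ u (j + 1) = 0 ∧ ¬ zeroAt v (j + 1) := by
  have hmn : m < n := by omega
  rw [zeroAt_iff] at hu hv
  push Not at hu
  obtain ⟨huj, hujj⟩ := hu
  have h0 : 0 < u j * v j := h.mul_pos_of_ne hmn hm hn.le huj
  have hvj : v j ≠ 0 := right_ne_zero_of_mul h0.ne'
  replace hv : v j * v (j + 1) < 0 := hv.resolve_left hvj
  have hu1 : u (j + 1) = 0 := by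
    by_contra hne
    have h1 := h.mul_pos_of_ne hmn (by omega) hn hne
    have h2 : 0 < u j * u (j + 1) := lt_of_le_of_ne hujj (mul_ne_zero huj hne).symm
    have h3 := mul_pos h0 h1
    have h4 : u j * v j * (u (j + 1) * v (j + 1)) = (u j * u (j + 1)) * (v j * v (j + 1)) := by
      ring
    have := mul_neg_of_pos_of_neg h2 hv
    linarith
  have hjn : j + 1 < n := lt_of_le_of_ne hn (fun he => hun (he ▸ hu1))
  refine ⟨hjn, huj, hu1, ?_⟩
  have huv : u j * v (j + 1) < 0 := by
    by_contra hcon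
    have h3 := mul_nonneg h0.le (not_lt.mp hcon)
    have h4 := mul_neg_of_pos_of_neg (mul_self_pos.mpr huj) hv
    have : u j * v j * (u j * v (j + 1)) = u j * u j * (v j * v (j + 1)) := by ring
    linarith
  have hu2 : u j * u (j + 2) < 0 := by
    by_contra hcon
    have := h.mul_pos_of_neighbor hτ (j := j + 1) (y := u j) (by omega) hn hu1
      (by simpa using mul_self_nonneg (u j))
      (by rw [show j + 1 + 1 = j + 2 by ring]; exact not_lt.mp hcon)
      (Or.inl (by simpa using mul_self_pos.mpr huj))
    linarith
  have hu2ne : u (j + 2) ≠ 0 := right_ne_zero_of_mul hu2.ne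
  have h2 := h.mul_pos_of_ne hmn (by omega) (by omega) hu2ne
  rw [zeroAt_iff, show j + 1 + 1 = j + 2 by ring]
  rintro (h5 | h5)
  · simp [h5] at huv
  · have h6 := mul_pos (mul_pos_of_neg_of_neg huv hu2) h2
    have h7 := mul_nonneg (mul_self_nonneg (u j * u (j + 2))) (neg_pos.mpr h5).le
    have : u j * v (j + 1) * (u j * u (j + 2)) * (u (j + 2) * v (j + 2)) =
      -((u j * u (j + 2)) * (u j * u (j + 2)) * -(v (j + 1) * v (j + 2))) := by ring
    linarith

end SignExpansion

theorem finite_setOf_zeroAt (w : ℤ → ℝ) (m n : ℤ) :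
    {j : ℤ | m ≤ j ∧ j < n ∧ zeroAt w j}.Finite :=
  (Set.finite_Ico m n).subset fun _ hj => ⟨hj.1, hj.2.1⟩

namespace SignExpansion

variable {u v : ℤ → ℝ} {τ : ℝ} {m n : ℤ}

/-- Forward in time, the zeros of `v` inject into those of `u`. -/
theorem exists_injOn_forward (h : SignExpansion u v τ m n) (hτ : 0 < τ) (hun : u n ≠ 0) :
    ∃ f : ℤ → ℤ, (∀ j, f j = j ∨ (f j = j + 1 ∧ ¬ zeroAt u j)) ∧
      Set.MapsTo f {j : ℤ | m ≤ j ∧ j < n ∧ zeroAt v j} {j : ℤ | m ≤ j ∧ j < n ∧ zeroAt u j} ∧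
      Set.InjOn f {j : ℤ | m ≤ j ∧ j < n ∧ zeroAt v j} := by
  classical
  refine ⟨fun j => if zeroAt u j then j else j + 1, fun j => ?_, ?_, ?_⟩
  · by_cases hj : zeroAt u j <;> simp [hj]
  · rintro j ⟨h1, h2, h3⟩
    by_cases hj : zeroAt u j
    · simp [hj, h1, h2]
    · obtain ⟨h4, -, h5, -⟩ := h.forward_shift hτ h1 h2 hun h3 hj
      simp only [hj, if_false]
      exact ⟨by omega, h4, (zeroAt_iff _ _).2 (Or.inl h5)⟩
  · rintro i ⟨hi1, hi2, hi3⟩ j ⟨hj1, hj2, hj3⟩ hij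
    by_cases hi : zeroAt u i <;> by_cases hj : zeroAt u j <;> simp only [hi, hj, if_true,
      if_false] at hij
    · exact hij
    · subst hij
      exact absurd hi3 (h.forward_shift hτ hj1 hj2 hun hj3 hj).2.2.2
    · subst hij
      exact absurd hj3 (h.forward_shift hτ hi1 hi2 hun hi3 hi).2.2.2
    · omega

theorem zCount_le_forward (h : SignExpansion u v τ m n) (hτ : 0 < τ) (hun : u n ≠ 0) :
    zCount v m n ≤ zCount u m n := by
  obtain ⟨f, -, hf, hinj⟩ := h.exists_injOn_forward hτ hun
  exact Set.ncard_le_ncard_of_injOn f hf hinj (finite_setOf_zeroAt u m n)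

/-- A singular zero may be moved to the right end of its block of zeros. -/
theorem _root_.exists_singZeroAt_ne_zero_succ {u : ℤ → ℝ} {j n : ℤ} (hj : singZeroAt u j)
    (hjn : j < n) (hun : u n ≠ 0) :
    ∃ i, j ≤ i ∧ i < n ∧ singZeroAt u i ∧ u (i + 1) ≠ 0 := by
  obtain ⟨k, hk⟩ : ∃ k : ℕ, n - j = k + 1 := ⟨(n - j - 1).toNat, by omega⟩
  induction k generalizing j with
  | zero =>
    have : j + 1 = n := by push_cast at hk; omega
    exact ⟨j, le_rfl, hjn, hj, this ▸ hun⟩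
  | succ k ih =>
    by_cases h1 : u (j + 1) = 0
    · obtain ⟨i, hi, hi'⟩ := ih (j := j + 1) ⟨h1, Or.inr (Or.inl (by simpa using hj.1))⟩
        (by push_cast at hk; omega) (by push_cast at hk; omega)
      exact ⟨i, by omega, hi'⟩
    · exact ⟨j, le_rfl, hjn, hj, h1⟩

theorem zCount_lt_forward (h : SignExpansion u v τ m n) (hτ : 0 < τ) (hun : u n ≠ 0) {j : ℤ}
    (hmj : m < j) (hjn : j < n) (hj : singZeroAt u j) : zCount v m n < zCount u m n := by
  obtain ⟨i, hji, hin, ⟨hi0, hi⟩, hi1⟩ := exists_singZeroAt_ne_zero_succ hj hjn hun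
  obtain ⟨f, hf, hmaps, hinj⟩ := h.exists_injOn_forward hτ hun
  have hmn : m < n := by omega
  have hi1sq := mul_self_pos.mpr hi1
  have hiprev : 0 ≤ u (i + 1) * u (i - 1) := by
    rcases hi with hi | hi | hi
    · exact absurd hi hi1
    · simp [hi]
    · linarith
  have hvi : 0 < u (i + 1) * v i :=
    h.mul_pos_of_neighbor hτ (by omega) hin.le hi0 hiprev hi1sq.le (Or.inr hi1sq)
  have hvi1 : 0 < u (i + 1) * v (i + 1) := h.mul_pos_of_ne hmn (by omega) (by omega) hi1
  have hnot : ¬ zeroAt v i := by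
    rw [zeroAt_iff]
    rintro (h0 | h0)
    · simp [h0] at hvi
    · have h3 := mul_pos hvi hvi1
      have h4 := mul_neg_of_pos_of_neg hi1sq h0
      have : u (i + 1) * v i * (u (i + 1) * v (i + 1)) =
        u (i + 1) * u (i + 1) * (v i * v (i + 1)) := by ring
      linarith
  have himg : i ∉ f '' {j : ℤ | m ≤ j ∧ j < n ∧ zeroAt v j} := by
    rintro ⟨x, ⟨hx1, hx2, hx3⟩, hxi⟩
    rcases hf x with hx | ⟨hx, hux⟩
    · exact hnot (by rwa [← hxi, hx])
    · have hxe : x = i - 1 := by omega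
      subst hxe
      have hpos : u (i - 1) ≠ 0 := fun h0 => hux ((zeroAt_iff _ _).2 (Or.inl h0))
      have h2 := h.mul_pos_of_ne hmn hx1 hx2.le hpos
      rcases (zeroAt_iff _ _).1 hx3 with h0 | h0
      · simp [h0] at h2
      · rw [sub_add_cancel] at h0
        have h5 : 0 < u (i + 1) * u (i - 1) := lt_of_le_of_ne hiprev (mul_ne_zero hi1 hpos).symm
        have h6 := mul_pos (mul_pos h2 hvi) h5
        have h7 := mul_nonneg (mul_self_nonneg (u (i + 1) * u (i - 1))) (neg_pos.mpr h0).le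
        have : u (i - 1) * v (i - 1) * (u (i + 1) * v i) * (u (i + 1) * u (i - 1)) =
          -(u (i + 1) * u (i - 1) * (u (i + 1) * u (i - 1)) * -(v (i - 1) * v i)) := by ring
        linarith
  have hmem : i ∈ {j : ℤ | m ≤ j ∧ j < n ∧ zeroAt u j} :=
    ⟨by omega, hin, (zeroAt_iff _ _).2 (Or.inl hi0)⟩
  calc zCount v m n = (f '' {j : ℤ | m ≤ j ∧ j < n ∧ zeroAt v j}).ncard :=
        hinj.ncard_image.symm
    _ < zCount u m n := by
        refine Set.ncard_lt_ncard ⟨hmaps.image_subset, fun hsub => himg (hsub hmem)⟩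
          (finite_setOf_zeroAt u m n)

/-- Signs near a zero of `u`, backward in time. -/
theorem mul_pow_pos (h : SignExpansion u v τ m n) (hτ : τ < 0) {j : ℤ} (hm : m ≤ j) (hn : j ≤ n)
    {d : ℕ} (hd : (d : ℤ) ≤ n - m) (hz : ∀ x : ℤ, |x - j| < d → u x = 0) {y : ℝ}
    (h1 : 0 ≤ y * u (j - d)) (h2 : 0 ≤ y * u (j + d))
    (h3 : 0 < y * u (j - d) ∨ 0 < y * u (j + d)) : 0 < y * v j * (-1) ^ d := by
  have h4 := h j hm hn d hd hz y h1 h2 h3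
  have h5 : 0 < (-τ) ^ d := pow_pos (neg_pos.mpr hτ) d
  have : y * v j * τ ^ d = y * v j * (-1) ^ d * (-τ) ^ d := by
    rw [mul_assoc _ ((-1 : ℝ) ^ d), ← mul_pow]
    simp
  rw [this] at h4
  exact pos_of_mul_pos_left h4 h5.le

theorem _root_.mul_neg_of_alternating {y p q : ℝ} {d : ℕ} (hp : 0 < y * p * (-1) ^ (d + 1))
    (hq : 0 < y * q * (-1) ^ d) : p * q < 0 := by
  have h1 := mul_pos hp hq
  have h2 : ((-1 : ℝ) ^ d) * (-1) ^ d = 1 := by rw [← mul_pow]; simp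
  have h3 : y * p * (-1) ^ (d + 1) * (y * q * (-1) ^ d) = -(p * q) * (y * y) := by
    rw [pow_succ]
    linear_combination -(y * p * y * q) * h2
  rw [h3] at h1
  have := pos_of_mul_pos_left h1 (mul_self_nonneg y)
  linarith

/-- Backward in time, a zero of `u` at `j` produces a zero of `v` at `j` or `j - 1`, the side being
that of the nearest nonzero value of `u`. -/
theorem exists_zeroAt_backward (h : SignExpansion u v τ m n) (hτ : τ < 0) (hum : u m ≠ 0)
    (hun : u n ≠ 0) {j : ℤ} (hm : m ≤ j) (hn : j < n) (hj : zeroAt u j) :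
    ∃ d : ℕ, (∀ x : ℤ, |x - j| < d → u x = 0) ∧
      ((zeroAt v j ∧ u (j + d) ≠ 0) ∨ (1 ≤ d ∧ zeroAt v (j - 1) ∧ u (j - d) ≠ 0)) := by
  classical
  by_cases hj0 : u j ≠ 0
  · refine ⟨0, fun x hx => ?_, Or.inl ⟨?_, by simpa using hj0⟩⟩
    · have := abs_nonneg (x - j)
      simp at hx
      omega
    · have hmn : m < n := by omega
      have h1 := ((zeroAt_iff _ _).1 hj).resolve_left hj0
      have h2 := h.mul_pos_of_ne hmn hm hn.le hj0
      have h3 := h.mul_pos_of_ne hmn (by omega) hn (right_ne_zero_of_mul h1.ne)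
      rw [zeroAt_iff]
      right
      have h4 := mul_pos h2 h3
      have h5 : u j * v j * (u (j + 1) * v (j + 1)) = u j * u (j + 1) * (v j * v (j + 1)) := by
        ring
      rw [h5] at h4
      exact neg_of_mul_pos_right h4 h1.le
  rw [not_not] at hj0
  have hmj : m < j := lt_of_le_of_ne hm (fun he => hum (he ▸ hj0))
  have hex : ∃ d : ℕ, u (j - d) ≠ 0 ∨ u (j + d) ≠ 0 :=
    ⟨(j - m).toNat, Or.inl (by rwa [show j - ((j - m).toNat : ℤ) = m by omega])⟩
  obtain ⟨d, hd, hmin⟩ : ∃ d : ℕ, (u (j - d) ≠ 0 ∨ u (j + d) ≠ 0) ∧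
      ∀ e : ℕ, e < d → u (j - e) = 0 ∧ u (j + e) = 0 :=
    ⟨Nat.find hex, Nat.find_spec hex, fun e he => by simpa using Nat.find_min hex he⟩
  have hz : ∀ x : ℤ, |x - j| < d → u x = 0 := by
    intro x hx
    have := hmin (x - j).natAbs (by rw [abs_lt] at hx; omega)
    rcases le_total j x with hjx | hjx
    · rw [show x = j + ((x - j).natAbs : ℤ) by omega]; exact this.2
    · rw [show x = j - ((x - j).natAbs : ℤ) by omega]; exact this.1
  have hdm : (d : ℤ) ≤ j - m := by
    by_contra hlt
    exact hum (hz m (by rw [abs_lt]; omega))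
  have hdn : (d : ℤ) ≤ n - j := by
    by_contra hlt
    exact hun (hz n (by rw [abs_lt]; omega))
  obtain ⟨e, rfl⟩ : ∃ e, d = e + 1 := by
    refine ⟨d - 1, ?_⟩
    have : d ≠ 0 := by
      rintro rfl
      simp [hj0] at hd
    omega
  have hleft : u (j - (e + 1 : ℕ)) ≠ 0 → 0 < u (j - (e + 1 : ℕ)) * v (j - 1) * (-1) ^ e := by
    intro hl
    have hsq := mul_self_pos.mpr hl
    have e1 : j - 1 - (e : ℤ) = j - (e + 1 : ℕ) := by push_cast; ring
    refine h.mul_pow_pos hτ (by omega) (by omega) (by omega)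
      (fun x hx => hz x (by push_cast at *; rw [abs_lt] at *; omega)) ?_ ?_ (Or.inl ?_)
    · rw [e1]; exact hsq.le
    · rcases Nat.eq_zero_or_pos e with rfl | he
      · simpa using mul_self_nonneg (u (j - 1))
      · rw [hz (j - 1 + e) (by push_cast; rw [abs_lt]; omega), mul_zero]
    · rw [e1]; exact hsq
  have hright : u (j + (e + 1 : ℕ)) ≠ 0 → 0 < u (j + (e + 1 : ℕ)) * v (j + 1) * (-1) ^ e := by
    intro hr
    have hsq := mul_self_pos.mpr hr
    have e1 : j + 1 + (e : ℤ) = j + (e + 1 : ℕ) := by push_cast; ring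
    refine h.mul_pow_pos hτ (by omega) (by omega) (by omega)
      (fun x hx => hz x (by push_cast at *; rw [abs_lt] at *; omega)) ?_ ?_ (Or.inr ?_)
    · rcases Nat.eq_zero_or_pos e with rfl | he
      · simpa using mul_self_nonneg (u (j + 1))
      · rw [hz (j + 1 - e) (by push_cast; rw [abs_lt]; omega), mul_zero]
    · rw [e1]; exact hsq.le
    · rw [e1]; exact hsq
  have hself := fun y => h.mul_pow_pos (y := y) hτ hm hn.le (by omega) hz
  refine ⟨e + 1, hz, ?_⟩
  generalize hp : u (j - (e + 1 : ℕ)) = p at *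
  generalize hq : u (j + (e + 1 : ℕ)) = q at *
  by_cases hpq : 0 ≤ q * p
  · by_cases hq0 : q = 0
    · have hp0 : p ≠ 0 := hd.resolve_right (not_not.mpr hq0)
      have h1 := hself p (mul_self_nonneg p) (by simp [hq0]) (Or.inl (mul_self_pos.mpr hp0))
      refine Or.inr ⟨by omega, (zeroAt_iff _ _).2 (Or.inr ?_), hp0⟩
      rw [sub_add_cancel, mul_comm]
      exact mul_neg_of_alternating h1 (hleft hp0)
    · have h1 := hself q hpq (mul_self_nonneg q) (Or.inr (mul_self_pos.mpr hq0))
      exact Or.inl ⟨(zeroAt_iff _ _).2 (Or.inr (mul_neg_of_alternating h1 (hright hq0))), hq0⟩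
  · rw [not_le] at hpq
    have hq0 : q ≠ 0 := left_ne_zero_of_mul hpq.ne
    have hp0 : p ≠ 0 := right_ne_zero_of_mul hpq.ne
    have hv : v (j - 1) * v (j + 1) < 0 := by
      have h1 := mul_pos (hleft hp0) (hright hq0)
      have h2 : ((-1 : ℝ) ^ e) * (-1) ^ e = 1 := by rw [← mul_pow]; simp
      have h3 : p * v (j - 1) * (-1) ^ e * (q * v (j + 1) * (-1) ^ e) =
          q * p * (v (j - 1) * v (j + 1)) := by
        linear_combination (p * v (j - 1) * q * v (j + 1)) * h2
      rw [h3] at h1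
      exact neg_of_mul_pos_right h1 hpq.le
    by_cases hvj : zeroAt v j
    · exact Or.inl ⟨hvj, hq0⟩
    · refine Or.inr ⟨by omega, (zeroAt_iff _ _).2 (Or.inr ?_), hp0⟩
      rw [zeroAt_iff] at hvj
      push Not at hvj
      rw [sub_add_cancel]
      by_contra hcon
      have h1 := mul_nonneg (not_lt.mp hcon) hvj.2
      have h2 := mul_neg_of_pos_of_neg (mul_self_pos.mpr hvj.1) hv
      have : v (j - 1) * v j * (v j * v (j + 1)) = v j * v j * (v (j - 1) * v (j + 1)) := by ring
      linarith

theorem zCount_le_backward (h : SignExpansion u v τ m n) (hτ : τ < 0) (hum : u m ≠ 0)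
    (hun : u n ≠ 0) : zCount u m n ≤ zCount v m n := by
  have key : ∀ j ∈ {j : ℤ | m ≤ j ∧ j < n ∧ zeroAt u j}, ∃ i, zeroAt v i ∧ ∃ d : ℕ,
      (∀ x : ℤ, |x - j| < d → u x = 0) ∧
        ((i = j ∧ u (j + d) ≠ 0) ∨ (1 ≤ d ∧ i = j - 1 ∧ u (j - d) ≠ 0)) := by
    rintro j ⟨h1, h2, h3⟩
    obtain ⟨d, hd, ⟨h4, h5⟩ | ⟨h4, h5, h6⟩⟩ := h.exists_zeroAt_backward hτ hum hun h1 h2 h3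
    · exact ⟨j, h4, d, hd, Or.inl ⟨rfl, h5⟩⟩
    · exact ⟨j - 1, h5, d, hd, Or.inr ⟨h4, rfl, h6⟩⟩
  have excl : ∀ j : ℤ, ∀ d e : ℕ, zeroAt u j → (∀ x : ℤ, |x - j| < d → u x = 0) →
      u (j + d) ≠ 0 → (∀ x : ℤ, |x - (j + 1)| < e → u x = 0) → 1 ≤ e → u (j + 1 - e) ≠ 0 →
      False := by
    intro j d e h0 h1 h2 h3 he h4
    rcases Nat.eq_zero_or_pos d with rfl | hd
    · have h5 : u (j + 1) = 0 := h3 _ (by simp; omega)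
      rcases (zeroAt_iff _ _).1 h0 with h6 | h6
      · simp [h6] at h2
      · simp [h5] at h6
    · have h5 : e < d := by
        by_contra hcon
        exact h2 (h3 _ (by rw [abs_lt]; omega))
      exact h4 (h1 _ (by rw [abs_lt]; omega))
  choose! f hf hfd using key
  refine Set.ncard_le_ncard_of_injOn f ?_ ?_ (finite_setOf_zeroAt v m n)
  · intro j hj
    obtain ⟨d, hd, ⟨h1, -⟩ | ⟨h1, h2, -⟩⟩ := hfd j hj
    · exact ⟨h1.symm ▸ hj.1, h1.symm ▸ hj.2.1, hf j hj⟩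
    · have : j ≠ m := by
        rintro rfl
        exact hum (hd _ (by simp; omega))
      have h3 := hj.1
      have h4 := hj.2.1
      exact ⟨by omega, by omega, hf j hj⟩
  · intro i hi j hj hij
    obtain ⟨d, hd, hd'⟩ := hfd i hi
    obtain ⟨e, he, he'⟩ := hfd j hj
    rcases hd' with ⟨h1, h2⟩ | ⟨h1, h2, h3⟩ <;> rcases he' with ⟨h4, h5⟩ | ⟨h4, h5, h6⟩
    · omega
    · obtain rfl : j = i + 1 := by omega
      exact (excl i d e hi.2.2 hd h2 he h4 h6).elim
    · obtain rfl : i = j + 1 := by omega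
      exact (excl j e d hj.2.2 he h5 hd h1 h3).elim
    · omega

end SignExpansion

section Expansion

/-- Integrating the leading-order expansion of a derivative. -/
theorem isLittleO_sub_mul_pow_succ {I : Set ℝ} (hI : Convex ℝ I) {f g : ℝ → ℝ} {t₀ L : ℝ}
    (ht₀ : t₀ ∈ I) (d : ℕ) (hf0 : f t₀ = 0) (hf : ∀ t ∈ I, HasDerivWithinAt f (g t) I t)
    (hg : (fun t => g t - L * (t - t₀) ^ d) =o[𝓝[I] t₀] fun t => (t - t₀) ^ d) :
    (fun t => f t - L / (d + 1) * (t - t₀) ^ (d + 1)) =o[𝓝[I] t₀] fun t => (t - t₀) ^ (d + 1) := by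
  rw [isLittleO_iff]
  intro ε hε
  have h1 := (isLittleO_iff.1 hg) hε
  obtain ⟨r, hr, hball⟩ := Metric.mem_nhdsWithin_iff.1 h1
  filter_upwards [inter_mem_nhdsWithin I (Metric.ball_mem_nhds t₀ hr)] with t ht
  have hconv : Convex ℝ (segment ℝ t₀ t) := convex_segment t₀ t
  have hsub : segment ℝ t₀ t ⊆ I := hI.segment_subset ht₀ ht.1
  have hdist : ∀ x ∈ segment ℝ t₀ t, |x - t₀| ≤ |t - t₀| := by
    intro x hx
    rw [segment_eq_uIcc] at hx
    exact Set.abs_sub_left_of_mem_uIcc hx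
  have hd1 : ((d : ℝ) + 1) ≠ 0 := by positivity
  have hder : ∀ x ∈ segment ℝ t₀ t, HasDerivWithinAt
      (fun t => f t - L / (d + 1) * (t - t₀) ^ (d + 1)) (g x - L * (x - t₀) ^ d)
      (segment ℝ t₀ t) x := by
    intro x hx
    have h2 : HasDerivAt (fun t : ℝ => L / (d + 1) * (t - t₀) ^ (d + 1)) (L * (x - t₀) ^ d) x := by
      have := (((hasDerivAt_id x).sub_const t₀).pow (d + 1)).const_mul (L / (d + 1))
      refine this.congr_deriv ?_
      simp only [id, Nat.add_sub_cancel, Nat.cast_add, Nat.cast_one, mul_one]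
      field_simp
    exact ((hf x (hsub hx)).mono hsub).sub h2.hasDerivWithinAt
  have hbd : ∀ x ∈ segment ℝ t₀ t, ‖g x - L * (x - t₀) ^ d‖ ≤ ε * |t - t₀| ^ d := by
    intro x hx
    have h3 : x ∈ Metric.ball t₀ r := by
      rw [Metric.mem_ball, Real.dist_eq]
      have := ht.2
      rw [Metric.mem_ball, Real.dist_eq] at this
      exact (hdist x hx).trans_lt this
    have h4 := hball ⟨h3, hsub hx⟩
    simp only [Set.mem_ofPred_eq, norm_pow, Real.norm_eq_abs] at h4 ⊢
    exact h4.trans (mul_le_mul_of_nonneg_left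
      (pow_le_pow_left₀ (abs_nonneg _) (hdist x hx) d) hε.le)
  have := hconv.norm_image_sub_le_of_norm_hasDerivWithin_le hder hbd
    (left_mem_segment ℝ t₀ t) (right_mem_segment ℝ t₀ t)
  simp only [hf0, sub_self, ne_eq, Nat.succ_ne_zero, not_false_eq_true, zero_pow, mul_zero,
    sub_zero] at this
  rw [norm_pow, pow_succ ‖t - t₀‖, ← mul_assoc]
  simpa [Real.norm_eq_abs] using this

theorem isLittleO_mul_sub_mul {l : Filter ℝ} {a f p : ℝ → ℝ} {a₀ L : ℝ} (ha : Tendsto a l (𝓝 a₀))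
    (hf : (fun t => f t - L * p t) =o[l] p) : (fun t => a t * f t - a₀ * L * p t) =o[l] p := by
  have h1 : (fun t => a t * (f t - L * p t)) =o[l] p := by
    simpa using (ha.isBigO_one ℝ).mul_isLittleO hf
  have h2 : (fun t => (a t - a₀) * (L * p t)) =o[l] p := by
    have h3 : (fun t => a t - a₀) =o[l] fun _ => (1 : ℝ) := by
      rw [isLittleO_one_iff]
      simpa using ha.sub_const a₀
    simpa using h3.mul_isBigO (isBigO_const_mul_self L p l)
  refine (h1.add h2).congr_left fun t => by ring

variable {I : Set ℝ} {a b c : ℤ → ℝ → ℝ} {w : ℝ → ℤ → ℝ}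

/-- Leading-order behaviour of a coordinate near a time at which it is surrounded by zeros. -/
theorem exists_leading_coeff (hI : Convex ℝ I)
    (ha : ∀ j, ContinuousOn (a j) I) (hb : ∀ j, ContinuousOn (b j) I)
    (hc : ∀ j, ContinuousOn (c j) I) (hpos : ∀ j, ∀ t ∈ I, 0 < a j t ∧ 0 < b j t)
    (hsol : ∀ j, ∀ t ∈ I, HasDerivWithinAt (fun s => w s j)
      (a j t * w t (j - 1) + b j t * w t (j + 1) + c j t * w t j) I t)
    {t₀ : ℝ} (ht₀ : t₀ ∈ I) (d : ℕ) (j : ℤ) (hz : ∀ x : ℤ, |x - j| < d → w t₀ x = 0) :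
    ∃ α β : ℝ, 0 < α ∧ 0 < β ∧
      (fun t => w t j - (α * w t₀ (j - d) + β * w t₀ (j + d)) * (t - t₀) ^ d)
        =o[𝓝[I] t₀] fun t => (t - t₀) ^ d := by
  induction d generalizing j with
  | zero =>
    refine ⟨1 / 2, 1 / 2, by norm_num, by norm_num, ?_⟩
    simp only [pow_zero, isLittleO_one_iff]
    have := ((hsol j t₀ ht₀).continuousWithinAt.tendsto).sub_const (w t₀ j)
    simp only [sub_self] at this
    refine this.congr fun t => ?_
    simp
    ring
  | succ d ih =>
    obtain ⟨α₁, β₁, hα₁, hβ₁, h₁⟩ := ih (j - 1) fun x hx => hz x (by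
      push_cast; rw [abs_lt] at *; omega)
    obtain ⟨α₂, β₂, hα₂, hβ₂, h₂⟩ := ih (j + 1) fun x hx => hz x (by
      push_cast; rw [abs_lt] at *; omega)
    obtain ⟨α₃, β₃, -, -, h₃⟩ := ih j fun x hx => hz x (by
      push_cast; rw [abs_lt] at *; omega)
    have e1 : ∃ α : ℝ, 0 < α ∧ α₁ * w t₀ (j - 1 - d) + β₁ * w t₀ (j - 1 + d) =
        α * w t₀ (j - (d + 1 : ℕ)) := by
      have e : j - 1 - (d : ℤ) = j - (d + 1 : ℕ) := by push_cast; ring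
      rcases Nat.eq_zero_or_pos d with rfl | hd
      · exact ⟨α₁ + β₁, by positivity, by simp; ring⟩
      · exact ⟨α₁, hα₁, by rw [e, hz (j - 1 + d) (by push_cast; rw [abs_lt]; omega)]; ring⟩
    have e2 : ∃ β : ℝ, 0 < β ∧ α₂ * w t₀ (j + 1 - d) + β₂ * w t₀ (j + 1 + d) =
        β * w t₀ (j + (d + 1 : ℕ)) := by
      have e : j + 1 + (d : ℤ) = j + (d + 1 : ℕ) := by push_cast; ring
      rcases Nat.eq_zero_or_pos d with rfl | hd
      · exact ⟨α₂ + β₂, by positivity, by simp; ring⟩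
      · exact ⟨β₂, hβ₂, by rw [e, hz (j + 1 - d) (by push_cast; rw [abs_lt]; omega)]; ring⟩
    obtain ⟨α, hα, e1⟩ := e1
    obtain ⟨β, hβ, e2⟩ := e2
    rw [e1] at h₁
    rw [e2] at h₂
    rw [hz (j - d) (by push_cast; rw [abs_lt]; omega),
      hz (j + d) (by push_cast; rw [abs_lt]; omega)] at h₃
    have g₁ := isLittleO_mul_sub_mul ((ha j t₀ ht₀).tendsto) h₁
    have g₂ := isLittleO_mul_sub_mul ((hb j t₀ ht₀).tendsto) h₂
    have g₃ := isLittleO_mul_sub_mul ((hc j t₀ ht₀).tendsto) h₃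
    have hg : (fun t => (a j t * w t (j - 1) + b j t * w t (j + 1) + c j t * w t j) -
        (a j t₀ * (α * w t₀ (j - (d + 1 : ℕ))) + b j t₀ * (β * w t₀ (j + (d + 1 : ℕ)))) *
          (t - t₀) ^ d) =o[𝓝[I] t₀] fun t => (t - t₀) ^ d :=
      ((g₁.add g₂).add g₃).congr_left fun t => by ring
    have h0 : w t₀ j = 0 := hz j (by simp)
    have hfin := isLittleO_sub_mul_pow_succ hI ht₀ d h0 (hsol j) hg
    obtain ⟨hap, hbp⟩ := hpos j t₀ ht₀
    refine ⟨a j t₀ * α / (d + 1), b j t₀ * β / (d + 1), by positivity, by positivity, ?_⟩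
    exact hfin.congr_left fun t => by ring

theorem eventually_pos_mul_pow {l : Filter ℝ} {f p : ℝ → ℝ} {L : ℝ} (hL : L ≠ 0)
    (hf : (fun t => f t - L * p t) =o[l] p) : ∀ᶠ t in l, p t ≠ 0 → 0 < f t * L * p t := by
  filter_upwards [(isLittleO_iff.1 hf) (half_pos (abs_pos.mpr hL))] with t ht hp
  rw [Real.norm_eq_abs, Real.norm_eq_abs] at ht
  have h1 : 0 < |L| * |p t| := mul_pos (abs_pos.mpr hL) (abs_pos.mpr hp)
  have h2 : |f t - L * p t| * |L * p t| ≤ |L| / 2 * |p t| * |L * p t| :=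
    mul_le_mul_of_nonneg_right ht (abs_nonneg _)
  have h3 : -(|f t - L * p t| * |L * p t|) ≤ (f t - L * p t) * (L * p t) := by
    rw [← abs_mul]
    exact neg_abs_le _
  have h4 : |L * p t| * |L * p t| = (L * p t) * (L * p t) := abs_mul_abs_self _
  have h5 : 0 < |L * p t| * |L * p t| := by
    rw [abs_mul]
    positivity
  rw [show |L| / 2 * |p t| = |L * p t| / 2 by rw [abs_mul]; ring] at h2
  nlinarith

theorem eventually_signExpansion (hI : Convex ℝ I)
    (ha : ∀ j, ContinuousOn (a j) I) (hb : ∀ j, ContinuousOn (b j) I)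
    (hc : ∀ j, ContinuousOn (c j) I) (hpos : ∀ j, ∀ t ∈ I, 0 < a j t ∧ 0 < b j t)
    (hsol : ∀ j, ∀ t ∈ I, HasDerivWithinAt (fun s => w s j)
      (a j t * w t (j - 1) + b j t * w t (j + 1) + c j t * w t j) I t)
    {t₀ : ℝ} (ht₀ : t₀ ∈ I) (m n : ℤ) :
    ∀ᶠ t in 𝓝[I] t₀, t ≠ t₀ → SignExpansion (w t₀) (w t) (t - t₀) m n := by
  have key : ∀ j : ℤ, ∀ d : ℕ, ∀ᶠ t in 𝓝[I] t₀, t ≠ t₀ → (∀ x : ℤ, |x - j| < d → w t₀ x = 0) →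
      ∀ y : ℝ, 0 ≤ y * w t₀ (j - d) → 0 ≤ y * w t₀ (j + d) →
      (0 < y * w t₀ (j - d) ∨ 0 < y * w t₀ (j + d)) → 0 < y * w t j * (t - t₀) ^ d := by
    intro j d
    by_cases hz : ∀ x : ℤ, |x - j| < d → w t₀ x = 0
    swap
    · exact Eventually.of_forall fun t _ h => absurd h hz
    obtain ⟨α, β, hα, hβ, hlim⟩ := exists_leading_coeff hI ha hb hc hpos hsol ht₀ d j hz
    set L := α * w t₀ (j - d) + β * w t₀ (j + d) with hL
    have hyL : ∀ y : ℝ, 0 ≤ y * w t₀ (j - d) → 0 ≤ y * w t₀ (j + d) →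
        (0 < y * w t₀ (j - d) ∨ 0 < y * w t₀ (j + d)) → 0 < y * L := by
      intro y h1 h2 h3
      have : y * L = α * (y * w t₀ (j - d)) + β * (y * w t₀ (j + d)) := by rw [hL]; ring
      rw [this]
      rcases h3 with h3 | h3 <;> positivity
    by_cases hL0 : L = 0
    · exact Eventually.of_forall fun t _ _ y h1 h2 h3 => by
        have := hyL y h1 h2 h3
        simp [hL0] at this
    filter_upwards [eventually_pos_mul_pow hL0 hlim] with t ht htne _ y h1 h2 h3
    have h4 := ht (pow_ne_zero d (sub_ne_zero.mpr htne))
    have h5 := mul_pos h4 (hyL y h1 h2 h3)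
    have h6 : w t j * L * (t - t₀) ^ d * (y * L) = y * w t j * (t - t₀) ^ d * (L * L) := by ring
    rw [h6] at h5
    exact pos_of_mul_pos_left h5 (mul_self_nonneg L)
  have hall : ∀ᶠ t in 𝓝[I] t₀, ∀ j ∈ Finset.Icc m n, ∀ d ∈ Finset.range ((n - m).toNat + 1),
      t ≠ t₀ → (∀ x : ℤ, |x - j| < d → w t₀ x = 0) →
      ∀ y : ℝ, 0 ≤ y * w t₀ (j - d) → 0 ≤ y * w t₀ (j + d) →
      (0 < y * w t₀ (j - d) ∨ 0 < y * w t₀ (j + d)) → 0 < y * w t j * (t - t₀) ^ d := by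
    simp only [Filter.eventually_all_finset]
    exact fun j _ d _ => key j d
  filter_upwards [hall] with t ht htne j hmj hjn d hd
  exact ht j (Finset.mem_Icc.2 ⟨hmj, hjn⟩) d (Finset.mem_range.2 (by omega)) htne

end Expansion

/-- One-sided local monotonicity implies monotonicity on an interval. -/
theorem le_of_eventually_le_Icc {z : ℝ → ℕ} {A B : ℝ}
    (hr : ∀ x ∈ Set.Icc A B, ∀ᶠ t in 𝓝[Set.Icc A B] x, x < t → z t ≤ z x)
    (hl : ∀ x ∈ Set.Icc A B, ∀ᶠ t in 𝓝[Set.Icc A B] x, t < x → z x ≤ z t)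
    {s t : ℝ} (hs : s ∈ Set.Icc A B) (ht : t ∈ Set.Icc A B) (hst : s ≤ t) : z t ≤ z s := by
  set S : Set ℝ := {x | s ≤ x ∧ x ≤ t ∧ ∀ r, s ≤ r → r ≤ x → z r ≤ z s} with hS
  have hsS : s ∈ S := ⟨le_rfl, hst, fun r h1 h2 => by rw [le_antisymm h2 h1]⟩
  have hbdd : BddAbove S := ⟨t, fun x hx => hx.2.1⟩
  set x := sSup S with hx
  have hsx : s ≤ x := le_csSup hbdd hsS
  have hxt : x ≤ t := csSup_le ⟨s, hsS⟩ fun y hy => hy.2.1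
  have hxI : x ∈ Set.Icc A B := ⟨hs.1.trans hsx, hxt.trans ht.2⟩
  have hlt : ∀ r, s ≤ r → r < x → z r ≤ z s := by
    intro r h1 h2
    obtain ⟨y, hy, hry⟩ := exists_lt_of_lt_csSup ⟨s, hsS⟩ h2
    exact hy.2.2 r h1 hry.le
  have hzx : z x ≤ z s := by
    rcases hsx.eq_or_lt with he | hlt'
    · rw [← he]
    · obtain ⟨ε, hε, hball⟩ := Metric.mem_nhdsWithin_iff.1 (hl x hxI)
      have h1 : max s (x - ε / 2) < x := max_lt hlt' (by linarith)
      have h2 : s ≤ max s (x - ε / 2) := le_max_left _ _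
      have h3 : x - ε / 2 ≤ max s (x - ε / 2) := le_max_right _ _
      refine (hball ⟨?_, hs.1.trans h2, h1.le.trans hxI.2⟩ h1).trans (hlt _ h2 h1)
      rw [Metric.mem_ball, Real.dist_eq, abs_lt]
      constructor <;> linarith
  rcases hxt.eq_or_lt with he | hxt'
  · rwa [← he]
  · obtain ⟨ε, hε, hball⟩ := Metric.mem_nhdsWithin_iff.1 (hr x hxI)
    have h1 : x < min t (x + ε / 2) := lt_min hxt' (by linarith)
    have h2 : min t (x + ε / 2) ≤ t := min_le_left _ _
    have h3 : min t (x + ε / 2) ≤ x + ε / 2 := min_le_right _ _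
    have hmem : min t (x + ε / 2) ∈ S := by
      refine ⟨hsx.trans h1.le, h2, fun r hr1 hr2 => ?_⟩
      rcases lt_trichotomy r x with h | h | h
      · exact hlt r hr1 h
      · rw [h]; exact hzx
      · refine (hball ⟨?_, hs.1.trans hr1, (hr2.trans h2).trans ht.2⟩ h).trans hzx
        rw [Metric.mem_ball, Real.dist_eq, abs_lt]
        constructor <;> linarith
    exact absurd (le_csSup hbdd hmem) (not_le.mpr h1)

theorem zCount_strict_decrease_at_singular_zero
    (T₀ T₁ δ : ℝ) (hT : T₀ < T₁) (hδ : 0 < δ)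
    (a b c : ℤ → ℝ → ℝ) (w : ℝ → ℤ → ℝ)
    (hacont : ∀ j : ℤ, ContinuousOn (a j) (Set.Icc T₀ T₁))
    (hbcont : ∀ j : ℤ, ContinuousOn (b j) (Set.Icc T₀ T₁))
    (hccont : ∀ j : ℤ, ContinuousOn (c j) (Set.Icc T₀ T₁))
    (hbound : ∃ C : ℝ, ∀ j : ℤ, ∀ t ∈ Set.Icc T₀ T₁,
      |a j t| ≤ C ∧ |b j t| ≤ C ∧ |c j t| ≤ C)
    (hpos : ∀ j : ℤ, ∀ t ∈ Set.Icc T₀ T₁, δ ≤ a j t ∧ δ ≤ b j t)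
    (hsol : ∀ j : ℤ, ∀ t ∈ Set.Icc T₀ T₁,
      HasDerivWithinAt (fun s => w s j)
        (a j t * w t (j - 1) + b j t * w t (j + 1) + c j t * w t j) (Set.Icc T₀ T₁) t)
    (hsub : ∀ t ∈ Set.Icc T₀ T₁, SubExp (w t))
    (m n : ℤ) (hmn : m < n)
    (hm : ∀ t ∈ Set.Icc T₀ T₁, w t m ≠ 0)
    (hn : ∀ t ∈ Set.Icc T₀ T₁, w t n ≠ 0)
    (t₀ : ℝ) (ht₀ : t₀ ∈ Set.Ioo T₀ T₁)
    (j : ℤ) (hjm : m < j) (hjn : j < n) (hsing : singZeroAt (w t₀) j) :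
    ∀ s ∈ Set.Icc T₀ T₁, ∀ t ∈ Set.Icc T₀ T₁, s < t₀ → t₀ < t →
      zCount (w t) m n < zCount (w s) m n := by
  have hpos' : ∀ j : ℤ, ∀ t ∈ Set.Icc T₀ T₁, 0 < a j t ∧ 0 < b j t := fun j t ht =>
    ⟨hδ.trans_le (hpos j t ht).1, hδ.trans_le (hpos j t ht).2⟩
  have hexp : ∀ x ∈ Set.Icc T₀ T₁, ∀ᶠ t in 𝓝[Set.Icc T₀ T₁] x, t ≠ x →
      SignExpansion (w x) (w t) (t - x) m n := fun x hx =>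
    eventually_signExpansion (convex_Icc T₀ T₁) hacont hbcont hccont hpos' hsol hx m n
  have hmono : ∀ {s t : ℝ}, s ∈ Set.Icc T₀ T₁ → t ∈ Set.Icc T₀ T₁ → s ≤ t →
      zCount (w t) m n ≤ zCount (w s) m n := by
    refine fun {s t} => le_of_eventually_le_Icc (z := fun t => zCount (w t) m n) ?_ ?_
    · intro x hx
      filter_upwards [hexp x hx] with t ht hxt
      exact (ht hxt.ne').zCount_le_forward (sub_pos.mpr hxt) (hn x hx)
    · intro x hx
      filter_upwards [hexp x hx] with t ht hxt
      exact (ht hxt.ne).zCount_le_backward (sub_neg.mpr hxt) (hm x hx) (hn x hx)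
  intro s hs t ht hst₀ ht₀t
  have ht₀I : t₀ ∈ Set.Icc T₀ T₁ := Set.Ioo_subset_Icc_self ht₀
  obtain ⟨ε, hε, hball⟩ := Metric.mem_nhdsWithin_iff.1 (hexp t₀ ht₀I)
  have h1 : t₀ < min t (t₀ + ε / 2) := lt_min ht₀t (by linarith)
  have h2 : min t (t₀ + ε / 2) ≤ t := min_le_left _ _
  have h3 : min t (t₀ + ε / 2) ≤ t₀ + ε / 2 := min_le_right _ _
  have hI : min t (t₀ + ε / 2) ∈ Set.Icc T₀ T₁ := ⟨ht₀I.1.trans h1.le, h2.trans ht.2⟩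
  have hstep : SignExpansion (w t₀) (w (min t (t₀ + ε / 2))) (min t (t₀ + ε / 2) - t₀) m n := by
    refine hball ⟨?_, hI⟩ h1.ne'
    rw [Metric.mem_ball, Real.dist_eq, abs_lt]
    constructor <;> linarith
  calc zCount (w t) m n ≤ zCount (w (min t (t₀ + ε / 2))) m n := hmono hI ht h2
    _ < zCount (w t₀) m n :=
        hstep.zCount_lt_forward (sub_pos.mpr h1) (hn t₀ ht₀I) hjm hjn hsing
    _ ≤ zCount (w s) m n := hmono hs ht₀I hst₀.le
end

section
/- Let w : [T₀,T₁] → ℝ^ℤ be a C¹ solution of the cooperative linear system such that w(t) has sub-exponential growth for every t ∈ [T₀,T₁]. If w_j(T₀) ≥ 0 for all j ∈ ℤ, then w_j(t) ≥ 0 for all j ∈ ℤ and all t ∈ [T₀,T₁]. -/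
open Set Filter Topology

/-- `w` at time `t` is bounded by `K` in the exponentially weighted sup norm. -/
def ExpBound (w : ℝ → ℤ → ℝ) (K t : ℝ) : Prop :=
  ∀ j : ℤ, |w t j| ≤ K * Real.exp |(j : ℝ)|

lemma ExpBound.mono {w : ℝ → ℤ → ℝ} {K L t : ℝ} (h : ExpBound w K t) (hKL : K ≤ L) :
    ExpBound w L t := fun j => (h j).trans (by gcongr)

lemma ExpBound.nonneg {w : ℝ → ℤ → ℝ} {K t : ℝ} (h : ExpBound w K t) : 0 ≤ K := by
  have h1 := (abs_nonneg _).trans (h 0)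
  simpa using h1

lemma exp_abs_le_three_mul {x y : ℝ} (h : |x - y| ≤ 1) : Real.exp |x| ≤ 3 * Real.exp |y| := by
  have h1 : |x| ≤ 1 + |y| := by linarith [abs_sub_abs_le_abs_sub x y]
  calc Real.exp |x| ≤ Real.exp (1 + |y|) := Real.exp_le_exp.2 h1
    _ = Real.exp 1 * Real.exp |y| := Real.exp_add _ _
    _ ≤ 3 * Real.exp |y| := by
      gcongr
      linarith [Real.exp_one_lt_d9]

lemma exp_abs_int_sub_one_le (j : ℤ) :
    Real.exp |((j - 1 : ℤ) : ℝ)| ≤ 3 * Real.exp |(j : ℝ)| :=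
  exp_abs_le_three_mul (by push_cast; simp)

lemma exp_abs_int_add_one_le (j : ℤ) :
    Real.exp |((j + 1 : ℤ) : ℝ)| ≤ 3 * Real.exp |(j : ℝ)| :=
  exp_abs_le_three_mul (by push_cast; simp)

lemma SubExp.exists_nat_expBound {w : ℝ → ℤ → ℝ} {t : ℝ} (h : SubExp (w t)) :
    ∃ K : ℕ, ExpBound w K t := by
  have hfin : {j : ℤ | ¬ Real.log |w t j| ≤ 1 * |(j : ℝ)|}.Finite := h 1 one_pos
  obtain ⟨B, hB⟩ := (hfin.image fun j => |w t j|).bddAbove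
  obtain ⟨K, hK⟩ := exists_nat_ge (max B 1)
  refine ⟨K, fun j => ?_⟩
  have hone : 1 ≤ Real.exp |(j : ℝ)| := Real.one_le_exp (abs_nonneg _)
  by_cases hj : Real.log |w t j| ≤ 1 * |(j : ℝ)|
  · have h1 : |w t j| ≤ Real.exp |(j : ℝ)| := by
      calc |w t j| ≤ Real.exp (Real.log |w t j|) := Real.le_exp_log _
        _ ≤ _ := Real.exp_le_exp.2 (by linarith)
    have hK1 : (1 : ℝ) ≤ K := (le_max_right _ _).trans hK
    nlinarith
  · have h1 : |w t j| ≤ B := hB ⟨j, hj, rfl⟩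
    have h2 : |w t j| ≤ K := h1.trans ((le_max_left _ _).trans hK)
    nlinarith [(Nat.cast_nonneg K : (0 : ℝ) ≤ K)]

lemma isClosed_expBound {w : ℝ → ℤ → ℝ} {I : Set ℝ} (hI : IsClosed I)
    (hw : ∀ j, ContinuousOn (fun s => w s j) I) (K : ℝ) :
    IsClosed {t | t ∈ I ∧ ExpBound w K t} := by
  have : {t | t ∈ I ∧ ExpBound w K t} =
      ⋂ j : ℤ, {t | t ∈ I ∧ |w t j| ≤ K * Real.exp |(j : ℝ)|} := by
    ext t
    simp only [mem_ofPred_eq, mem_iInter, ExpBound]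
    exact ⟨fun h j => ⟨h.1, h.2 j⟩, fun h => ⟨(h 0).1, fun j => (h j).2⟩⟩
  rw [this]
  exact isClosed_iInter fun j => hI.isClosed_le (hw j).abs continuousOn_const

lemma le_of_forall_le_add_div_two_pow {x y K : ℝ} (h : ∀ n : ℕ, x ≤ y + K / 2 ^ n) : x ≤ y := by
  have h1 : Tendsto (fun n : ℕ => y + K / 2 ^ n) atTop (𝓝 (y + 0)) :=
    tendsto_const_nhds.add
      (tendsto_const_nhds.div_atTop (tendsto_pow_atTop_atTop_of_one_lt one_lt_two))
  simpa using ge_of_tendsto' h1 h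

/-- A solution that is bounded on a short interval has norm comparable to its norm
at any single time. -/
lemma ExpBound.two_mul_of_bounded {w w' : ℝ → ℤ → ℝ} {I J : Set ℝ} {M K L s t : ℝ}
    (hderiv : ∀ j, ∀ t ∈ I, HasDerivWithinAt (fun s => w s j) (w' t j) I t)
    (hw' : ∀ t ∈ I, ∀ K, ExpBound w K t → ExpBound w' (M * K) t)
    (hJI : J ⊆ I) (hJ : Convex ℝ J) (hbdd : ∀ u ∈ J, ExpBound w L u)
    (hs : s ∈ J) (hlen : ∀ u ∈ J, |u - s| * M ≤ 1 / 2) (hK : ExpBound w K s) (ht : t ∈ J) :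
    ExpBound w (2 * K) t := by
  have hL : 0 ≤ L := (hbdd s hs).nonneg
  have hK0 := hK.nonneg
  have key : ∀ n : ℕ, ∀ u ∈ J, ExpBound w (2 * K + L / 2 ^ n) u := by
    intro n
    induction n with
    | zero => exact fun u hu => (hbdd u hu).mono (by simp; linarith)
    | succ n ih =>
      intro u hu j
      have h1 := hJ.norm_image_sub_le_of_norm_hasDerivWithin_le
        (fun x hx => (hderiv j x (hJI hx)).mono hJI)
        (fun x hx => hw' x (hJI hx) _ (ih x hx) j) hs hu
      simp only [Real.norm_eq_abs] at h1
      have h2 := abs_sub_abs_le_abs_sub (w u j) (w s j)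
      have h3 : M * (2 * K + L / 2 ^ n) * Real.exp |(j : ℝ)| * |u - s| ≤
          1 / 2 * ((2 * K + L / 2 ^ n) * Real.exp |(j : ℝ)|) := by
        have := mul_le_mul_of_nonneg_right (hlen u hu)
          (show 0 ≤ (2 * K + L / 2 ^ n) * Real.exp |(j : ℝ)| by positivity)
        linarith
      have h4 : (2 * K + L / 2 ^ (n + 1)) * Real.exp |(j : ℝ)| = K * Real.exp |(j : ℝ)| +
          1 / 2 * ((2 * K + L / 2 ^ n) * Real.exp |(j : ℝ)|) := by
        rw [pow_succ]; field_simp; ring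
      linarith [hK j]
  intro j
  refine le_of_forall_le_add_div_two_pow (K := L * Real.exp |(j : ℝ)|) fun n => ?_
  have := key n t ht j
  rwa [add_mul, div_mul_eq_mul_div] at this

/-- `w` is uniformly bounded, in the weighted norm, on a neighbourhood of `t` in `I`. -/
def LocExpBound (w : ℝ → ℤ → ℝ) (I : Set ℝ) (t : ℝ) : Prop :=
  ∃ K : ℝ, ∀ᶠ s in 𝓝[I] t, ExpBound w K s

lemma exists_expBound_of_isCompact {w : ℝ → ℤ → ℝ} {I J : Set ℝ} (hJ : IsCompact J)
    (hJI : J ⊆ I) (h : ∀ t ∈ J, LocExpBound w I t) : ∃ K : ℝ, ∀ t ∈ J, ExpBound w K t := by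
  refine hJ.induction_on (p := fun A => ∃ K : ℝ, ∀ t ∈ A, ExpBound w K t) ⟨0, by simp⟩
    (fun A B hAB ⟨K, hK⟩ => ⟨K, fun t ht => hK t (hAB ht)⟩) ?_ ?_
  · rintro A B ⟨K, hK⟩ ⟨L, hL⟩
    refine ⟨max K L, ?_⟩
    rintro t (ht | ht)
    · exact (hK t ht).mono (le_max_left _ _)
    · exact (hL t ht).mono (le_max_right _ _)
  · intro t ht
    obtain ⟨K, hK⟩ := h t ht
    exact ⟨_, nhdsWithin_mono t hJI hK, K, fun s hs => hs⟩

/-- Norm control is transferred from the endpoint `β` to `t` across a short segment on which `w`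
is locally bounded, except possibly at `β`. -/
lemma ExpBound.two_mul_of_locExpBound {w w' : ℝ → ℤ → ℝ} {I : Set ℝ} {M K t β : ℝ}
    (hM : 0 < M) (hI : IsClosed I)
    (hderiv : ∀ j, ∀ t ∈ I, HasDerivWithinAt (fun s => w s j) (w' t j) I t)
    (hw' : ∀ t ∈ I, ∀ K, ExpBound w K t → ExpBound w' (M * K) t)
    (hseg : uIcc t β ⊆ I) (hlen : |t - β| * M ≤ 1 / 2) (hne : t ≠ β)
    (hloc : ∀ s ∈ uIcc t β, s ≠ β → LocExpBound w I s)
    (ht : ∃ L, ExpBound w L t) (hβ : ExpBound w K β) :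
    ExpBound w (2 * K) t := by
  obtain ⟨L, hL⟩ := ht
  have hbd : ∀ s ∈ uIcc t β, s ≠ β → ExpBound w (2 * L) s := by
    intro s hs hsβ
    have hsub : uIcc t s ⊆ uIcc t β := uIcc_subset_uIcc_left hs
    have hβs : β ∉ uIcc t s := by
      intro h
      rcases mem_uIcc.1 h with h | h <;> rcases mem_uIcc.1 hs with h' | h' <;>
        exact hsβ (by linarith)
    obtain ⟨B, hB⟩ := exists_expBound_of_isCompact isCompact_uIcc (hsub.trans hseg)
      fun u hu => hloc u (hsub hu) (fun h => hβs (h ▸ hu))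
    refine ExpBound.two_mul_of_bounded hderiv hw' (hsub.trans hseg) (convex_uIcc t s) hB
      left_mem_uIcc (fun u hu => ?_) hL right_mem_uIcc
    refine (mul_le_mul_of_nonneg_right ?_ hM.le).trans hlen
    rw [abs_sub_comm t β]
    exact abs_sub_left_of_mem_uIcc (hsub hu)
  have hcl : IsClosed {s | s ∈ I ∧ ExpBound w (2 * L) s} :=
    isClosed_expBound hI (fun j s hs => (hderiv j s hs).continuousWithinAt) _
  have hmem : β ∈ closure (uIoo t β) := by
    rw [closure_uIoo hne]
    exact right_mem_uIcc
  have hβL : ExpBound w (2 * L) β := by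
    refine (closure_minimal (fun s hs => ?_) hcl hmem).2
    have hs' : s ∈ uIcc t β := uIoo_subset_uIcc_self hs
    refine ⟨hseg hs', hbd s hs' ?_⟩
    rintro rfl
    obtain ⟨h1, h2⟩ := hs
    rcases lt_sup_iff.1 h2 with h | h <;> rcases inf_lt_iff.1 h1 with h' | h' <;> linarith
  refine ExpBound.two_mul_of_bounded hderiv hw' hseg (convex_uIcc t β) (L := 2 * L)
    (fun u hu => ?_) right_mem_uIcc (fun u hu => ?_) hβ left_mem_uIcc
  · by_cases h : u = β
    · exact h ▸ hβL
    · exact hbd u hu h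
  · refine (mul_le_mul_of_nonneg_right ?_ hM.le).trans hlen
    rw [abs_sub_comm u β, abs_sub_comm t β]
    exact abs_sub_right_of_mem_uIcc hu

lemma isClosed_not_locExpBound {w : ℝ → ℤ → ℝ} {I : Set ℝ} (hI : IsClosed I) :
    IsClosed {t | t ∈ I ∧ ¬ LocExpBound w I t} := by
  rw [← isOpen_compl_iff, isOpen_iff_mem_nhds]
  intro t ht
  by_cases htI : t ∈ I
  · have : LocExpBound w I t := by
      by_contra h
      exact ht ⟨htI, h⟩
    obtain ⟨K, hK⟩ := this
    filter_upwards [eventually_eventually_nhdsWithin.2 hK |> eventually_nhdsWithin_iff.1] with s hs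
    rintro ⟨hsI, hsn⟩
    exact hsn ⟨K, hs hsI⟩
  · filter_upwards [hI.isOpen_compl.mem_nhds htI] with s hs h
    exact hs h.1

/-- Pointwise bounds on a solution improve to locally uniform bounds: by Baire's theorem the set of
bad times, if nonempty, carries a uniform bound on a portion, which then propagates across gaps. -/
lemma locExpBound_of_forall_exists_expBound {w w' : ℝ → ℤ → ℝ} {I : Set ℝ} {M : ℝ}
    (hM : 0 < M) (hI : IsClosed I) (hconv : OrdConnected I)
    (hderiv : ∀ j, ∀ t ∈ I, HasDerivWithinAt (fun s => w s j) (w' t j) I t)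
    (hw' : ∀ t ∈ I, ∀ K, ExpBound w K t → ExpBound w' (M * K) t)
    (hpt : ∀ t ∈ I, ∃ K : ℕ, ExpBound w K t) :
    ∀ t ∈ I, LocExpBound w I t := by
  by_contra! hbad
  set F : Set ℝ := {t | t ∈ I ∧ ¬ LocExpBound w I t} with hF
  have hFcl : IsClosed F := isClosed_not_locExpBound hI
  have : Nonempty F := by
    obtain ⟨t, ht⟩ := hbad
    exact ⟨⟨t, ht⟩⟩
  have : CompleteSpace F := hFcl.completeSpace_coe
  have hcl : ∀ K : ℕ, IsClosed {x : F | (x : ℝ) ∈ {t | t ∈ I ∧ ExpBound w K t}} := fun K =>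
    (isClosed_expBound hI (fun j s hs => (hderiv j s hs).continuousWithinAt) _).preimage
      continuous_subtype_val
  obtain ⟨K, t₀, ht₀⟩ := nonempty_interior_of_iUnion_of_closed hcl (by
    refine eq_univ_of_forall fun x => mem_iUnion.2 ?_
    obtain ⟨K, hK⟩ := hpt x x.2.1
    exact ⟨K, x.2.1, hK⟩)
  obtain ⟨r, hr, hball⟩ := Metric.mem_nhds_iff.1 (mem_interior_iff_mem_nhds.1 ht₀)
  refine t₀.2.2 ⟨2 * K, ?_⟩
  have hρ : 0 < min r (1 / (2 * M)) := by positivity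
  filter_upwards [self_mem_nhdsWithin, nhdsWithin_le_nhds (Metric.ball_mem_nhds (t₀ : ℝ) hρ)]
    with t htI ht
  have hdist : |t - t₀| < min r (1 / (2 * M)) := by simpa [Real.dist_eq] using ht
  have hFK : ∀ s ∈ F, |s - t₀| < r → ExpBound w K s := fun s hs hsr =>
    (hball (show (⟨s, hs⟩ : F) ∈ Metric.ball t₀ r by
      simpa [Subtype.dist_eq, Real.dist_eq] using hsr)).2
  by_cases htF : t ∈ F
  · exact (hFK t htF (hdist.trans_le (min_le_left _ _))).mono
      (by linarith [(Nat.cast_nonneg K : (0 : ℝ) ≤ K)])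
  obtain ⟨β, ⟨hβseg, hβF⟩, hβmin⟩ := (isCompact_uIcc.inter_right hFcl).exists_isMinOn
    (f := fun s => |s - t|) ⟨(t₀ : ℝ), right_mem_uIcc (a := t), t₀.2⟩ (by fun_prop)
  have hsub : uIcc t β ⊆ uIcc t t₀ := uIcc_subset_uIcc_left hβseg
  have hβr : |β - t₀| < r := by
    have := abs_sub_right_of_mem_uIcc hβseg
    rw [abs_sub_comm, abs_sub_comm (t₀ : ℝ) t] at this
    exact this.trans_lt (hdist.trans_le (min_le_left _ _))
  refine ExpBound.two_mul_of_locExpBound hM hI hderiv hw' (hconv.uIcc_subset htI hβF.1) ?_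
    (fun h => htF (h ▸ hβF)) (fun s hs hsβ => ?_) ((hpt t htI).imp' _ fun _ h => h)
    (hFK β hβF hβr)
  · have h1 := abs_sub_left_of_mem_uIcc hβseg
    rw [abs_sub_comm, abs_sub_comm (t₀ : ℝ) t] at h1
    have h2 : |t - β| ≤ 1 / (2 * M) := h1.trans (hdist.le.trans (min_le_right _ _))
    calc |t - β| * M ≤ 1 / (2 * M) * M := by gcongr
      _ = 1 / 2 := by field_simp
  · by_contra hns
    have hsF : s ∈ F := ⟨hconv.uIcc_subset htI hβF.1 hs, hns⟩
    have h1 : |β - t| ≤ |s - t| := hβmin ⟨hsub hs, hsF⟩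
    rcases mem_uIcc.1 hs with h | h
    · rw [abs_of_nonneg (by linarith), abs_of_nonneg (by linarith)] at h1
      exact hsβ (by linarith)
    · rw [abs_of_nonpos (by linarith), abs_of_nonpos (by linarith)] at h1
      exact hsβ (by linarith)

/-- Short-time comparison principle for solutions bounded in the weighted norm. -/
lemma nonneg_of_expBound_of_short {w w' : ℝ → ℤ → ℝ} {s t M L : ℝ}
    (hM : 0 < M)
    (hderiv : ∀ j, ∀ u ∈ Icc s t, HasDerivWithinAt (fun s => w s j) (w' u j) (Icc s t) u)
    (hw' : ∀ u ∈ Icc s t, ∀ K, (∀ i : ℤ, -(K * Real.exp |(i : ℝ)|) ≤ w u i) →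
      ∀ j, w u j ≤ 0 → -(M * K * Real.exp |(j : ℝ)|) ≤ w' u j)
    (hbdd : ∀ u ∈ Icc s t, ExpBound w L u) (hlen : (t - s) * (2 * M) ≤ 1 / 2)
    (h0 : ∀ j, 0 ≤ w s j) :
    ∀ u ∈ Icc s t, ∀ j, 0 ≤ w u j := by
  rcases lt_or_ge t s with hts | hst
  · intro u hu
    exact absurd (hu.1.trans hu.2) hts.not_ge
  have hL : 0 ≤ L := (hbdd s (left_mem_Icc.2 hst)).nonneg
  have key : ∀ n : ℕ, ∀ u ∈ Icc s t, ∀ j : ℤ,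
      -((L + 1) / 2 ^ n * Real.exp |(j : ℝ)|) ≤ w u j := by
    intro n
    induction n with
    | zero =>
      intro u hu j
      have h1 := (abs_le.1 (hbdd u hu j)).1
      have h2 := Real.exp_pos |(j : ℝ)|
      simp only [pow_zero, div_one]
      linarith
    | succ n ih =>
      intro u hu j
      set P : ℝ := (L + 1) / 2 ^ n * Real.exp |(j : ℝ)| with hP
      have hPpos : 0 < P := by positivity
      have h1 : -w u j ≤ 2 * M * P * (u - s) := by
        refine image_le_of_deriv_right_lt_deriv_boundary (f := fun x => -w x j)
          (f' := fun x => -w' x j) (a := s) (b := t)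
          (B := fun x => 2 * M * P * (x - s)) (B' := fun _ => 2 * M * P)
          (fun x hx => (hderiv j x hx).continuousWithinAt.neg) (fun x hx => ?_)
          (by simpa using h0 j) (fun x => ?_) (fun x hx hxB => ?_) hu
        · exact ((hderiv j x (Ico_subset_Icc_self hx)).mono_of_mem_nhdsWithin
            (Icc_mem_nhdsGE_of_mem hx)).neg
        · simpa using ((hasDerivAt_id x).sub_const s).const_mul (2 * M * P)
        · have hx0 : 0 ≤ 2 * M * P * (x - s) :=
            mul_nonneg (by positivity) (sub_nonneg.2 hx.1)
          have h2 := hw' x (Ico_subset_Icc_self hx) _ (ih x (Ico_subset_Icc_self hx)) j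
            (by linarith)
          have h3 : M * ((L + 1) / 2 ^ n) * Real.exp |(j : ℝ)| = M * P := by rw [hP]; ring
          rw [h3] at h2
          have : 0 < M * P := by positivity
          linarith
      have h2 : 2 * M * P * (u - s) ≤ 1 / 2 * P := by
        have : (u - s) * (2 * M) ≤ 1 / 2 := by
          refine le_trans ?_ hlen
          gcongr
          exact hu.2
        nlinarith
      have h3 : (L + 1) / 2 ^ (n + 1) * Real.exp |(j : ℝ)| = 1 / 2 * P := by
        rw [hP, pow_succ]; field_simp
      linarith
  intro u hu j
  have := le_of_forall_le_add_div_two_pow (x := -w u j) (y := 0)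
    (K := (L + 1) * Real.exp |(j : ℝ)|) fun n => by
      have := key n u hu j
      rw [div_mul_eq_mul_div] at this
      linarith
  linarith

/-- Comparison principle for solutions locally bounded in the weighted norm. -/
lemma nonneg_of_locExpBound {w w' : ℝ → ℤ → ℝ} {T₀ T₁ M : ℝ}
    (hM : 0 < M)
    (hderiv : ∀ j, ∀ u ∈ Icc T₀ T₁, HasDerivWithinAt (fun s => w s j) (w' u j) (Icc T₀ T₁) u)
    (hw' : ∀ u ∈ Icc T₀ T₁, ∀ K, (∀ i : ℤ, -(K * Real.exp |(i : ℝ)|) ≤ w u i) →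
      ∀ j, w u j ≤ 0 → -(M * K * Real.exp |(j : ℝ)|) ≤ w' u j)
    (hloc : ∀ u ∈ Icc T₀ T₁, LocExpBound w (Icc T₀ T₁) u)
    (h0 : ∀ j, 0 ≤ w T₀ j) :
    ∀ t ∈ Icc T₀ T₁, ∀ j, 0 ≤ w t j := by
  rcases lt_or_ge T₁ T₀ with hT | hT
  · intro u hu
    exact absurd (hu.1.trans hu.2) hT.not_ge
  have hcl : IsClosed ({t | ∀ j, 0 ≤ w t j} ∩ Icc T₀ T₁) := by
    have : {t | ∀ j, 0 ≤ w t j} ∩ Icc T₀ T₁ =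
        ⋂ j : ℤ, {t | t ∈ Icc T₀ T₁ ∧ 0 ≤ w t j} := by
      ext t
      simp only [mem_inter_iff, mem_ofPred_eq, mem_iInter]
      exact ⟨fun h j => ⟨h.2, h.1 j⟩, fun h => ⟨fun j => (h j).2, (h 0).1⟩⟩
    rw [this]
    exact isClosed_iInter fun j => isClosed_Icc.isClosed_le continuousOn_const
      fun s hs => (hderiv j s hs).continuousWithinAt
  refine hcl.Icc_subset_of_forall_mem_nhdsWithin h0 fun s hs => ?_
  obtain ⟨hs0, hsI⟩ := hs
  obtain ⟨L, hL⟩ := hloc s (Ico_subset_Icc_self hsI)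
  obtain ⟨r, hr, hball⟩ := Metric.mem_nhdsWithin_iff.1 hL
  have hρ : 0 < min r (1 / (4 * M)) := by positivity
  filter_upwards [Ioo_mem_nhdsGT hsI.2, Ioo_mem_nhdsGT (lt_add_of_pos_right s hρ)] with t ht ht'
  have hsub : Icc s t ⊆ Icc T₀ T₁ := Icc_subset_Icc hsI.1 ht.2.le
  have htr : t - s < min r (1 / (4 * M)) := by linarith [ht'.2]
  refine nonneg_of_expBound_of_short hM (fun j u hu => (hderiv j u (hsub hu)).mono hsub)
    (fun u hu => hw' u (hsub hu)) (L := L) (fun u hu => hball ⟨?_, hsub hu⟩) ?_ hs0 t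
    (right_mem_Icc.2 ht.1.le)
  · rw [Metric.mem_ball, Real.dist_eq, abs_of_nonneg (by linarith [hu.1])]
    linarith [hu.2, min_le_left r (1 / (4 * M))]
  · calc (t - s) * (2 * M) ≤ 1 / (4 * M) * (2 * M) := by
          gcongr
          exact htr.le.trans (min_le_right _ _)
      _ = 1 / 2 := by field_simp; norm_num

theorem coop_monotone_nonneg
    (T₀ T₁ δ : ℝ) (hT : T₀ < T₁) (hδ : 0 < δ)
    (a b c : ℤ → ℝ → ℝ) (w : ℝ → ℤ → ℝ)
    (hacont : ∀ j : ℤ, ContinuousOn (a j) (Set.Icc T₀ T₁))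
    (hbcont : ∀ j : ℤ, ContinuousOn (b j) (Set.Icc T₀ T₁))
    (hccont : ∀ j : ℤ, ContinuousOn (c j) (Set.Icc T₀ T₁))
    (hbound : ∃ C : ℝ, ∀ j : ℤ, ∀ t ∈ Set.Icc T₀ T₁,
      |a j t| ≤ C ∧ |b j t| ≤ C ∧ |c j t| ≤ C)
    (hpos : ∀ j : ℤ, ∀ t ∈ Set.Icc T₀ T₁, δ ≤ a j t ∧ δ ≤ b j t)
    (hsol : ∀ j : ℤ, ∀ t ∈ Set.Icc T₀ T₁,
      HasDerivWithinAt (fun s => w s j)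
        (a j t * w t (j - 1) + b j t * w t (j + 1) + c j t * w t j) (Set.Icc T₀ T₁) t)
    (hsub : ∀ t ∈ Set.Icc T₀ T₁, SubExp (w t))
    (h0 : ∀ j : ℤ, 0 ≤ w T₀ j) :
    ∀ t ∈ Set.Icc T₀ T₁, ∀ j : ℤ, 0 ≤ w t j := by
  obtain ⟨C, hC⟩ := hbound
  have hC0 : 0 ≤ C := (abs_nonneg _).trans (hC 0 T₀ (left_mem_Icc.2 hT.le)).1
  set w' : ℝ → ℤ → ℝ := fun t j =>
    a j t * w t (j - 1) + b j t * w t (j + 1) + c j t * w t j with hw'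
  have hM : 0 < 7 * C + 1 := by positivity
  have hbd : ∀ t ∈ Icc T₀ T₁, ∀ K, ExpBound w K t → ExpBound w' ((7 * C + 1) * K) t := by
    intro t ht K hK j
    obtain ⟨h1, h2, h3⟩ := hC j t ht
    have hK0 := hK.nonneg
    have e1 : |w t (j - 1)| ≤ K * (3 * Real.exp |(j : ℝ)|) :=
      (hK (j - 1)).trans (by gcongr; exact exp_abs_int_sub_one_le j)
    have e2 : |w t (j + 1)| ≤ K * (3 * Real.exp |(j : ℝ)|) :=
      (hK (j + 1)).trans (by gcongr; exact exp_abs_int_add_one_le j)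
    have hKe : 0 ≤ K * Real.exp |(j : ℝ)| := by positivity
    calc |w' t j| ≤ |a j t| * |w t (j - 1)| + |b j t| * |w t (j + 1)| + |c j t| * |w t j| := by
          rw [← abs_mul, ← abs_mul, ← abs_mul]
          exact abs_add_three _ _ _
      _ ≤ C * (K * (3 * Real.exp |(j : ℝ)|)) + C * (K * (3 * Real.exp |(j : ℝ)|)) +
          C * (K * Real.exp |(j : ℝ)|) := by
          gcongr
          exact hK j
      _ ≤ (7 * C + 1) * K * Real.exp |(j : ℝ)| := by linarith
  refine nonneg_of_locExpBound hM hsol ?_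
    (locExpBound_of_forall_exists_expBound hM isClosed_Icc ordConnected_Icc hsol hbd
      fun t ht => (hsub t ht).exists_nat_expBound) h0
  intro t ht K hK j hj
  obtain ⟨h1, h2, h3⟩ := hC j t ht
  obtain ⟨ha, hb⟩ := hpos j t ht
  have hKe : 0 ≤ K * Real.exp |(j : ℝ)| := by linarith [hK j]
  have hK0 : 0 ≤ K := nonneg_of_mul_nonneg_left hKe (Real.exp_pos _)
  have e1 : -w t (j - 1) ≤ K * (3 * Real.exp |(j : ℝ)|) :=
    (neg_le.1 (hK (j - 1))).trans (by gcongr; exact exp_abs_int_sub_one_le j)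
  have e2 : -w t (j + 1) ≤ K * (3 * Real.exp |(j : ℝ)|) :=
    (neg_le.1 (hK (j + 1))).trans (by gcongr; exact exp_abs_int_add_one_le j)
  have f1 : a j t * -w t (j - 1) ≤ C * (K * (3 * Real.exp |(j : ℝ)|)) :=
    mul_le_mul_of_nonneg (le_of_abs_le h1) e1 (hδ.le.trans ha) (by positivity)
  have f2 : b j t * -w t (j + 1) ≤ C * (K * (3 * Real.exp |(j : ℝ)|)) :=
    mul_le_mul_of_nonneg (le_of_abs_le h2) e2 (hδ.le.trans hb) (by positivity)
  have f3 : c j t * -w t j ≤ C * (K * Real.exp |(j : ℝ)|) :=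
    mul_le_mul (le_of_abs_le h3) (neg_le.1 (hK j)) (by linarith) hC0
  linarith
end

section
/- Let μ¹ and μ² be Borel probability measures on K_n (with the product topology), each invariant under the shift T. For u, v ∈ K_n set z₀(u,v) = Σ_{r ∈ ℤ} χ(u − v + r has a zero at position 0), where χ is the indicator (this sum is finite, at most 2n+1), and for Borel probability measures ν¹, ν² on K_n define Z(ν¹,ν²) = ∫∫ z₀(u,v) dν¹(u) dν²(v). Then the function t ↦ Z((φ(t,·))_*μ¹, (φ(t,·))_*μ²) is non-increasing on [0,∞). -/
open MeasureTheory Set Filter Topology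

/-- First partial derivative `∂₁V`. -/
noncomputable def V1 (V : ℝ → ℝ → ℝ) (x y : ℝ) : ℝ := deriv (fun s => V s y) x

/-- Second partial derivative `∂₂V`. -/
noncomputable def V2 (V : ℝ → ℝ → ℝ) (x y : ℝ) : ℝ := deriv (fun s => V x s) y

/-- Mixed partial derivative `∂₁∂₂V`. -/
noncomputable def V12 (V : ℝ → ℝ → ℝ) (x y : ℝ) : ℝ := deriv (fun s => V2 V s y) x

/-- The set of configurations with spacing bounded by `n`, with the product topology. -/
def Kn (n : ℕ) : Set (ℤ → ℝ) := {u | ∀ i : ℤ, |u (i + 1) - u i| ≤ (n : ℝ)}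

/-- The shift `(Tu)_i = u_{i-1}` on configurations. -/
def shift (u : ℤ → ℝ) : ℤ → ℝ := fun i => u (i - 1)

/-- The shift `T`, as a self-map of `Kn n`. -/
def shiftK (n : ℕ) (u : Kn n) : Kn n :=
  ⟨shift u.val, by
    intro i
    have h := u.2 (i - 1)
    have h1 : i - 1 + 1 = i := by ring
    rw [h1] at h
    simpa [shift] using h⟩

/-- The average number of intersections `z₀(u,v)`: the number of `r : ℤ` such that
`u - v + r` has a zero at position `0`. -/
noncomputable def z0 (u v : ℤ → ℝ) : ℕ :=
  Set.ncard {r : ℤ | zeroAt (fun i => u i - v i + (r : ℝ)) 0}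

/-- The intersection-counting function on pairs of measures on `Kn n`. -/
noncomputable def Zfun (n : ℕ) (ν₁ ν₂ : Measure (Kn n)) : ℝ :=
  ∫ u, ∫ v, (z0 u.val v.val : ℝ) ∂ν₂ ∂ν₁


/-- The linear interpolation of `x` vanishes somewhere on `[j, j + 1)`. -/
def Crosses (x : ℤ → ℝ) (j : ℤ) : Prop := x j = 0 ∨ x j * x (j + 1) < 0

/-- A crossing which is a genuine sign change, or any cell if `x` vanishes identically. -/
def StrictlyCrosses (x : ℤ → ℝ) (j : ℤ) : Prop :=
  x j * x (j + 1) < 0 ∨ (x j = 0 ∧ x (j - 1) * x (j + 1) < 0) ∨ ∀ i, x i = 0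

/-- `σ` sends nonzero sites of `y` monotonically to sites of `x` of the same sign, at distance at
most `k`. -/
structure Traces (y x : ℤ → ℝ) (σ : ℤ → ℤ) (k : ℕ) : Prop where
  sign : ∀ j, y j ≠ 0 → 0 < y j * x (σ j)
  dist : ∀ j, j - k ≤ σ j ∧ σ j ≤ j + k
  mono : ∀ i j, i ≤ j → y i ≠ 0 → y j ≠ 0 → σ i ≤ σ j

lemma Traces.refl (x : ℤ → ℝ) : Traces x x id 0 where
  sign j hj := mul_self_pos.mpr hj
  dist j := by simp
  mono i j h _ _ := h

lemma Traces.comp {z y x : ℤ → ℝ} {σ ρ : ℤ → ℤ} {k l : ℕ} (h₁ : Traces z y σ k)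
    (h₂ : Traces y x ρ l) : Traces z x (ρ ∘ σ) (k + l) where
  sign j hj := by
    have h := h₁.sign j hj
    have hy : y (σ j) ≠ 0 := by
      intro h0; simp [h0] at h
    have h' := h₂.sign _ hy
    have h3 := mul_pos h h'
    have h4 : 0 < y (σ j) ^ 2 := by positivity
    have : z j * y (σ j) * (y (σ j) * x (ρ (σ j))) = y (σ j) ^ 2 * (z j * x (ρ (σ j))) := by ring
    rw [this] at h3
    exact (mul_pos_iff_of_pos_left h4).mp h3
  dist j := by
    have := h₁.dist j
    have := h₂.dist (σ j)
    simp only [Function.comp, Nat.cast_add]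
    omega
  mono i j hij hi hj := by
    have a := h₁.sign i hi
    have b := h₁.sign j hj
    apply h₂.mono _ _ (h₁.mono i j hij hi hj)
    · intro h0; simp [h0] at a
    · intro h0; simp [h0] at b

/-- A diagonally dominant nonnegative tridiagonal map is variation diminishing. -/
lemma exists_traces_of_tridiagonal {x y q p c : ℤ → ℝ}
    (hy : ∀ j, y j = q j * x (j - 1) + p j * x j + c j * x (j + 1))
    (hp : ∀ j, 3 / 4 ≤ p j) (hq : ∀ j, 0 ≤ q j ∧ q j ≤ 1 / 4) (hc : ∀ j, 0 ≤ c j ∧ c j ≤ 1 / 4) :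
    ∃ σ, Traces y x σ 1 := by
  classical
  set σ : ℤ → ℤ := fun j => if 0 < y j * x j then j else
    if q j * (y j * x (j - 1)) ≤ c j * (y j * x (j + 1)) then j + 1 else j - 1 with hσ
  have sq : ∀ j, y j * y j =
      q j * (y j * x (j - 1)) + p j * (y j * x j) + c j * (y j * x (j + 1)) := by
    intro j
    nth_rewrite 2 [hy j]
    ring
  have sgn : ∀ j, y j ≠ 0 → 0 < y j * x (σ j) := by
    intro j hj
    have h0 : 0 < y j * y j := mul_self_pos.mpr hj
    rw [sq j] at h0
    simp only [hσ]
    split_ifs with h1 h2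
    · exact h1
    · have : p j * (y j * x j) ≤ 0 :=
        mul_nonpos_of_nonneg_of_nonpos (by linarith [hp j]) (not_lt.mp h1)
      have h3 : 0 < c j * (y j * x (j + 1)) := by linarith
      exact pos_of_mul_pos_right h3 (hc j).1
    · have : p j * (y j * x j) ≤ 0 :=
        mul_nonpos_of_nonneg_of_nonpos (by linarith [hp j]) (not_lt.mp h1)
      have h3 : 0 < q j * (y j * x (j - 1)) := by linarith
      exact pos_of_mul_pos_right h3 (hq j).1
  have dst : ∀ j, j - 1 ≤ σ j ∧ σ j ≤ j + 1 := by
    intro j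
    simp only [hσ]
    split_ifs <;> omega
  have dom : ∀ (P Q a b d : ℝ), 3 / 4 ≤ P → 0 ≤ Q → Q ≤ 1 / 4 → a * b ≤ 0 →
      0 < P * (a * b) + 2 * (Q * (a * d)) → |b| < |d| := by
    intro P Q a b d hP hQ hQ' hab h
    have ha : a ≠ 0 := by rintro rfl; simp at h
    have h1 : a * b = -(|a| * |b|) := by rw [← abs_mul, abs_of_nonpos hab]; ring
    have h2 : a * d ≤ |a| * |d| := by rw [← abs_mul]; exact le_abs_self _
    have ha' : 0 < |a| := by positivity
    have h3 : Q * (a * d) ≤ Q * (|a| * |d|) := mul_le_mul_of_nonneg_left h2 hQ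
    have h4 : Q * (|a| * |d|) ≤ 1 / 4 * (|a| * |d|) :=
      mul_le_mul_of_nonneg_right hQ' (by positivity)
    have h5 : 3 / 4 * (|a| * |b|) ≤ P * (|a| * |b|) :=
      mul_le_mul_of_nonneg_right hP (by positivity)
    rw [h1] at h
    have h6 : 0 ≤ |a| * |b| := by positivity
    have h7 : |a| * |b| < |a| * |d| := by nlinarith
    exact lt_of_mul_lt_mul_left h7 ha'.le
  refine ⟨σ, sgn, by simpa using dst, ?_⟩
  intro i j hij hi hj
  rcases hij.eq_or_lt with rfl | hij
  · exact le_rfl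
  by_contra! hlt
  have hd1 := dst i
  have hd2 := dst j
  obtain rfl : j = i + 1 := by omega
  have e1 : σ i = i + 1 := by
    by_contra hne
    have h1 : σ (i + 1) = i ∨ σ (i + 1) = i + 1 ∨ σ (i + 1) = i + 1 + 1 := by omega
    have h2 : σ i = i - 1 ∨ σ i = i := by omega
    omega
  have e2 : σ (i + 1) = i := by omega
  have a1 : ¬ 0 < y i * x i := by
    intro h; simp only [hσ, h, if_true] at e1; omega
  have a2 : ¬ 0 < y (i + 1) * x (i + 1) := by
    intro h; simp only [hσ, h, if_true] at e2; omega
  have b1 : q i * (y i * x (i - 1)) ≤ c i * (y i * x (i + 1)) := by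
    by_contra h; simp only [hσ, a1, h, if_false] at e1; omega
  have b2 : ¬ q (i + 1) * (y (i + 1) * x (i + 1 - 1)) ≤
      c (i + 1) * (y (i + 1) * x (i + 1 + 1)) := by
    intro h; simp only [hσ, a2, h, if_false, if_true] at e2; omega
  have s1 := sq i
  have s2 := sq (i + 1)
  have p1 : 0 < y i * y i := mul_self_pos.mpr hi
  have p2 : 0 < y (i + 1) * y (i + 1) := mul_self_pos.mpr hj
  rw [add_sub_cancel_right] at b2 s2
  have r1 := dom _ _ _ _ (x (i + 1)) (hp i) (hc i).1 (hc i).2 (not_lt.mp a1) (by linarith)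
  have r2 := dom _ _ _ _ (x i) (hp (i + 1)) (hq (i + 1)).1 (hq (i + 1)).2 (not_lt.mp a2)
    (by linarith)
  linarith

lemma exists_crosses_of_mul_neg {x : ℤ → ℝ} {a b : ℤ} (hab : a ≤ b) (h : x a * x b < 0) :
    ∃ m, a ≤ m ∧ m < b ∧ Crosses x m := by
  by_contra! H
  have key : ∀ m, a ≤ m → m ≤ b → 0 < x a * x m := by
    intro m hm
    induction m, hm using Int.leInduction with
    | base =>
      intro _
      exact mul_self_pos.mpr (by intro h0; simp [h0] at h)
    | succ m hm ih =>
      intro hb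
      have h1 := ih (by omega)
      have h2 := H m hm (by omega)
      simp only [Crosses, not_or, not_lt] at h2
      by_contra! h3
      have hxa : x a ≠ 0 := by intro h0; simp [h0] at h
      have h4 : x m * x (m + 1) ≤ 0 := by
        have : x a ^ 2 * (x m * x (m + 1)) ≤ 0 := by
          have := mul_nonpos_of_nonneg_of_nonpos h1.le h3
          linarith
        exact nonpos_of_mul_nonpos_right this (by positivity)
      have h5 : x m * x (m + 1) = 0 := le_antisymm h4 h2.2
      rcases mul_eq_zero.mp h5 with h6 | h6
      · exact h2.1 h6
      · by_cases hb' : m + 1 < b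
        · exact H (m + 1) (by omega) hb' (Or.inl h6)
        · obtain rfl : m + 1 = b := by omega
          simp [h6] at h
  have := key b hab le_rfl
  linarith

lemma mul_neg_of_near {a b a' b' η : ℝ} (h : a * b < 0) (ha : η < |a|) (hb : η < |b|)
    (ha' : |a' - a| ≤ η) (hb' : |b' - b| ≤ η) : a' * b' < 0 := by
  rw [abs_le] at ha' hb'
  rcases mul_neg_iff.mp h with ⟨h1, h2⟩ | ⟨h1, h2⟩
  · rw [abs_of_pos h1] at ha
    rw [abs_of_neg h2] at hb
    exact mul_neg_of_pos_of_neg (by linarith) (by linarith)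
  · rw [abs_of_neg h1] at ha
    rw [abs_of_pos h2] at hb
    exact mul_neg_of_neg_of_pos (by linarith) (by linarith)

open Classical in
/-- Strict crossings of `x` are controlled by the crossings of `w`, if a perturbation of `x` by at
most `η` traces back to `w`, up to the sites where `x` is nonzero and at most `η`. -/
lemma card_strictlyCrosses_le {x y w : ℤ → ℝ} {σ : ℤ → ℤ} {k : ℕ} {η : ℝ} (hσ : Traces y w σ k)
    (hη : ∀ j, |y j - x j| ≤ η) (hx : ¬ ∀ i, x i = 0) (N : ℕ) :
    ((Finset.Ico (0 : ℤ) N).filter (StrictlyCrosses x)).card ≤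
      ((Finset.Ico (-(k + 1) : ℤ) (N + k + 1)).filter (Crosses w)).card +
        3 * ((Finset.Icc (-1 : ℤ) N).filter (fun j => 0 < |x j| ∧ |x j| ≤ η)).card := by
  set bad : ℤ → Prop := fun j => 0 < |x j| ∧ |x j| ≤ η with hbad
  set B := (Finset.Icc (-1 : ℤ) N).filter bad
  set S := (Finset.Ico (0 : ℤ) N).filter (StrictlyCrosses x)
  set G := S.filter (fun j => ¬ bad (j - 1) ∧ ¬ bad j ∧ ¬ bad (j + 1)) with hG
  have hS : S ⊆ ((G ∪ B) ∪ B.image (fun j => j - 1)) ∪ B.image (fun j => j + 1) := by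
    intro j hj
    have hj' := (Finset.mem_Ico.mp (Finset.mem_filter.mp hj).1)
    by_cases h1 : bad (j - 1)
    · refine Finset.mem_union_right _ (Finset.mem_image.mpr ⟨j - 1, ?_, by ring⟩)
      exact Finset.mem_filter.mpr ⟨Finset.mem_Icc.mpr ⟨by omega, by omega⟩, h1⟩
    by_cases h2 : bad (j + 1)
    · refine Finset.mem_union_left _ (Finset.mem_union_right _
        (Finset.mem_image.mpr ⟨j + 1, ?_, by ring⟩))
      exact Finset.mem_filter.mpr ⟨Finset.mem_Icc.mpr ⟨by omega, by omega⟩, h2⟩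
    refine Finset.mem_union_left _ (Finset.mem_union_left _ ?_)
    by_cases h3 : bad j
    · refine Finset.mem_union_right _ ?_
      exact Finset.mem_filter.mpr ⟨Finset.mem_Icc.mpr ⟨by omega, by omega⟩, h3⟩
    · exact Finset.mem_union_left _ (Finset.mem_filter.mpr ⟨hj, h1, h3, h2⟩)
  have hcard : S.card ≤ G.card + 3 * B.card := by
    refine (Finset.card_le_card hS).trans ?_
    have a1 := Finset.card_union_le ((G ∪ B) ∪ B.image (fun j => j - 1)) (B.image (fun j => j + 1))
    have a2 := Finset.card_union_le (G ∪ B) (B.image (fun j => j - 1))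
    have a3 := Finset.card_union_le G B
    have a4 : (B.image (fun j => j - 1)).card ≤ B.card := Finset.card_image_le
    have a5 : (B.image (fun j => j + 1)).card ≤ B.card := Finset.card_image_le
    omega
  refine hcard.trans (Nat.add_le_add_right ?_ _)
  set lo : ℤ → ℤ := fun j => if x j = 0 then j - 1 else j with hlo
  have big : ∀ j, x j ≠ 0 → ¬ bad j → η < |x j| := by
    intro j hj hb
    by_contra! h
    exact hb ⟨abs_pos.mpr hj, h⟩
  have hneg : ∀ j ∈ G, x (lo j) * x (j + 1) < 0 ∧ lo j ≤ j + 1 ∧ ¬ bad (lo j) ∧ ¬ bad (j + 1) := by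
    intro j hj
    obtain ⟨hjS, g1, g2, g3⟩ := Finset.mem_filter.mp hj
    rcases (Finset.mem_filter.mp hjS).2 with h | h | h
    · have h0 : x j ≠ 0 := by intro h0; simp [h0] at h
      simp only [hlo, h0, if_false]
      exact ⟨h, by omega, g2, g3⟩
    · simp only [hlo, h.1, if_true]
      exact ⟨h.2, by omega, g1, g3⟩
    · exact absurd h hx
  have hyn : ∀ j ∈ G, y (lo j) * y (j + 1) < 0 := by
    intro j hj
    obtain ⟨h1, h2, h3, h4⟩ := hneg j hj
    have n1 : x (lo j) ≠ 0 := by intro h0; simp [h0] at h1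
    have n2 : x (j + 1) ≠ 0 := by intro h0; simp [h0] at h1
    exact mul_neg_of_near h1 (big _ n1 h3) (big _ n2 h4) (hη _) (hη _)
  have hm : ∀ j ∈ G, ∃ m, σ (lo j) ≤ m ∧ m < σ (j + 1) ∧ Crosses w m := by
    intro j hj
    have h1 := hyn j hj
    have n1 : y (lo j) ≠ 0 := by intro h0; simp [h0] at h1
    have n2 : y (j + 1) ≠ 0 := by intro h0; simp [h0] at h1
    apply exists_crosses_of_mul_neg (hσ.mono _ _ (hneg j hj).2.1 n1 n2)
    have s1 := hσ.sign _ n1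
    have s2 := hσ.sign _ n2
    have := mul_pos s1 s2
    have e : y (lo j) * w (σ (lo j)) * (y (j + 1) * w (σ (j + 1))) =
      (y (lo j) * y (j + 1)) * (w (σ (lo j)) * w (σ (j + 1))) := by ring
    rw [e] at this
    rcases mul_pos_iff.mp this with ⟨h2, _⟩ | ⟨_, h2⟩
    · linarith
    · exact h2
  choose! m hm using hm
  apply Finset.card_le_card_of_injOn m
  · intro j hj
    obtain ⟨h1, h2, h3⟩ := hm j hj
    have hj' := (Finset.mem_Ico.mp (Finset.mem_filter.mp (Finset.mem_filter.mp hj).1).1)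
    have d1 := hσ.dist (lo j)
    have d2 := hσ.dist (j + 1)
    have d3 : j - 1 ≤ lo j := by simp only [hlo]; split_ifs <;> omega
    exact Finset.mem_coe.mpr (Finset.mem_filter.mpr ⟨Finset.mem_Ico.mpr ⟨by omega, by omega⟩, h3⟩)
  · have key : ∀ i ∈ G, ∀ j ∈ G, i < j → m i < m j := by
      intro i hi j hj hij
      have a := hyn i hi
      have b := hyn j hj
      have hle : i + 1 ≤ lo j := by
        simp only [hlo]
        split_ifs with h0
        · have : j ≠ i + 1 := by
            rintro rfl
            have := (hneg i hi).1
            simp [h0] at this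
          omega
        · omega
      have := hσ.mono _ _ hle (by intro h0; simp [h0] at a) (by intro h0; simp [h0] at b)
      have := (hm i hi).2.1
      have := (hm j hj).1
      omega
    intro i hi j hj hij
    rcases lt_trichotomy i j with h | h | h
    · exact absurd hij (key i hi j hj h).ne
    · exact h
    · exact absurd hij (key j hj i hi h).ne'

/-- On `[0, T]`, `w` solves a cooperative tridiagonal linear system with coefficients bounded by `C`
and off-diagonal coefficients at least `δ`; its velocity `w'` is bounded and Lipschitz. -/
structure CooperativeSolution (w w' : ℝ → ℤ → ℝ) (δ C T : ℝ) : Prop where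
  hasDeriv : ∀ j, ∀ τ ∈ Icc 0 T, HasDerivWithinAt (fun s => w s j) (w' τ j) (Icc 0 T) τ
  linear : ∀ τ ∈ Icc 0 T, ∀ j, ∃ q p c : ℝ, (δ ≤ q ∧ q ≤ C) ∧ |p| ≤ C ∧ (δ ≤ c ∧ c ≤ C) ∧
    w' τ j = q * w τ (j - 1) + p * w τ j + c * w τ (j + 1)
  lipschitz : ∀ τ ∈ Icc 0 T, ∀ τ' ∈ Icc 0 T, ∀ j, |w' τ j - w' τ' j| ≤ C * |τ - τ'|
  bounded : ∀ τ ∈ Icc 0 T, ∀ j, |w' τ j| ≤ C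

namespace CooperativeSolution

variable {w w' : ℝ → ℤ → ℝ} {δ C T : ℝ}

lemma abs_sub_le (H : CooperativeSolution w w' δ C T) {τ τ' : ℝ} (hτ : τ ∈ Icc 0 T)
    (hτ' : τ' ∈ Icc 0 T) (j : ℤ) : |w τ' j - w τ j| ≤ C * |τ' - τ| := by
  have := (convex_Icc (0 : ℝ) T).norm_image_sub_le_of_norm_hasDerivWithin_le (C := C)
    (f := fun s => w s j) (fun x hx => H.hasDeriv j x hx) (fun x hx => H.bounded x hx j) hτ hτ'
  simpa using this

lemma abs_sub_sub_le (H : CooperativeSolution w w' δ C T) {τ h : ℝ} (hτ : 0 ≤ τ) (hh : 0 ≤ h)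
    (hT : τ + h ≤ T) (j : ℤ) : |w (τ + h) j - w τ j - h * w' τ j| ≤ C * h ^ 2 := by
  have hC : 0 ≤ C := (abs_nonneg _).trans (H.bounded τ ⟨hτ, by linarith⟩ 0)
  have hsub : Icc τ (τ + h) ⊆ Icc 0 T := Icc_subset_Icc hτ hT
  have := (convex_Icc τ (τ + h)).norm_image_sub_le_of_norm_hasDerivWithin_le (C := C * h)
    (f := fun s => w s j - s * w' τ j) (f' := fun s => w' s j - 1 * w' τ j)
    (fun x hx => ((H.hasDeriv j x (hsub hx)).mono hsub).sub
      ((hasDerivWithinAt_id x _).mul_const _))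
    (fun x hx => by
      have h1 := H.lipschitz x (hsub hx) τ ⟨hτ, by linarith⟩ j
      rw [one_mul]
      refine h1.trans (mul_le_mul_of_nonneg_left ?_ hC)
      rw [abs_le]
      exact ⟨by linarith [hx.1], by linarith [hx.2]⟩)
    (left_mem_Icc.mpr (by linarith)) (right_mem_Icc.mpr (by linarith))
  rw [Real.norm_eq_abs, Real.norm_eq_abs, add_sub_cancel_left, abs_of_nonneg hh] at this
  refine (le_of_eq ?_).trans (this.trans (le_of_eq (by ring)))
  congr 1
  ring

/-- The explicit Euler scheme approximates `w` uniformly and diminishes variation. -/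
lemma exists_traces_euler (H : CooperativeSolution w w' δ C T) (hδ : 0 < δ) {s h : ℝ} (hs : 0 ≤ s)
    (hh : 0 ≤ h) (hC : C * h ≤ 1 / 4) (k : ℕ) (hk : s + k * h ≤ T) :
    ∃ (X : ℤ → ℝ) (σ : ℤ → ℤ), Traces X (w s) σ k ∧
      ∀ j, |X j - w (s + k * h) j| ≤ C * h ^ 2 * k * (1 + 3 * C * h) ^ k := by
  induction k with
  | zero => exact ⟨w s, id, Traces.refl _, by simp⟩
  | succ k ih =>
    push_cast at hk
    have hk' : s + k * h ≤ T := by linarith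
    obtain ⟨X, σ, hσ, hX⟩ := ih hk'
    have hkh : 0 ≤ (k : ℝ) * h := by positivity
    set τ := s + k * h with hτ
    have hτ0 : 0 ≤ τ := by linarith
    have hC0 : 0 ≤ C := (abs_nonneg _).trans (H.bounded τ ⟨hτ0, hk'⟩ 0)
    choose q p c hq hp hc hlin using H.linear τ ⟨hτ0, hk'⟩
    set X' : ℤ → ℝ := fun j => h * q j * X (j - 1) + (1 + h * p j) * X j + h * c j * X (j + 1)
      with hX'
    have bq : ∀ j, 0 ≤ h * q j ∧ h * q j ≤ C * h := fun j =>
      ⟨mul_nonneg hh (by linarith [hq j]), by nlinarith [hq j]⟩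
    have bc : ∀ j, 0 ≤ h * c j ∧ h * c j ≤ C * h := fun j =>
      ⟨mul_nonneg hh (by linarith [hc j]), by nlinarith [hc j]⟩
    have bp : ∀ j, |h * p j| ≤ C * h := fun j => by
      rw [abs_mul, abs_of_nonneg hh, mul_comm]
      exact mul_le_mul_of_nonneg_right (hp j) hh
    obtain ⟨ρ, hρ⟩ := exists_traces_of_tridiagonal (x := X) (y := X')
      (q := fun j => h * q j) (p := fun j => 1 + h * p j) (c := fun j => h * c j) (fun j => rfl)
      (fun j => by linarith [(abs_le.mp (bp j)).1])
      (fun j => ⟨(bq j).1, (bq j).2.trans hC⟩) (fun j => ⟨(bc j).1, (bc j).2.trans hC⟩)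
    refine ⟨X', σ ∘ ρ, ?_, ?_⟩
    · have := hρ.comp hσ
      rwa [add_comm] at this
    · intro j
      set E := C * h ^ 2 * k * (1 + 3 * C * h) ^ k with hE
      have hCh : 0 ≤ C * h := mul_nonneg hC0 hh
      have hE0 : 0 ≤ E := by positivity
      have e1 := H.abs_sub_sub_le hτ0 hh (by linarith : τ + h ≤ T) j
      have eτ : s + ((k + 1 : ℕ) : ℝ) * h = τ + h := by push_cast; ring
      rw [eτ]
      have key : X' j - w (τ + h) j = h * q j * (X (j - 1) - w τ (j - 1)) +
          (1 + h * p j) * (X j - w τ j) + h * c j * (X (j + 1) - w τ (j + 1)) -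
          (w (τ + h) j - w τ j - h * w' τ j) := by
        rw [hlin j, hX']; ring
      have m : ∀ a b A : ℝ, |a| ≤ A → |b| ≤ E → |a * b| ≤ A * E := by
        intro a b A ha hb
        rw [abs_mul]
        exact mul_le_mul ha hb (abs_nonneg _) ((abs_nonneg _).trans ha)
      have m1 := m (h * q j) _ (C * h) (by rw [abs_of_nonneg (bq j).1]; exact (bq j).2) (hX (j - 1))
      have m2 := m (1 + h * p j) _ (1 + C * h)
        ((abs_add_le _ _).trans (by rw [abs_one]; linarith [bp j])) (hX j)
      have m3 := m (h * c j) _ (C * h) (by rw [abs_of_nonneg (bc j).1]; exact (bc j).2) (hX (j + 1))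
      have total : |X' j - w (τ + h) j| ≤ (1 + 3 * C * h) * E + C * h ^ 2 := by
        rw [key]
        rw [abs_le] at *
        constructor <;> nlinarith
      refine total.trans ?_
      have h1 : 1 ≤ (1 + 3 * C * h) ^ (k + 1) := one_le_pow₀ (by linarith)
      have h2 : C * h ^ 2 ≤ C * h ^ 2 * (1 + 3 * C * h) ^ (k + 1) :=
        le_mul_of_one_le_right (by positivity) h1
      have h3 : C * h ^ 2 * ((k + 1 : ℕ) : ℝ) * (1 + 3 * C * h) ^ (k + 1) =
          (1 + 3 * C * h) * E + C * h ^ 2 * (1 + 3 * C * h) ^ (k + 1) := by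
        rw [hE]; push_cast; ring
      linarith

end CooperativeSolution

lemma le_of_pow_le_deriv {g g' : ℝ → ℝ} {a c : ℝ} {d : ℕ}
    (hg : ∀ ε ∈ Icc 0 a, HasDerivWithinAt g (g' ε) (Icc 0 a) ε) (h0 : 0 ≤ g 0)
    (hle : ∀ ε ∈ Ioo 0 a, c * ε ^ d ≤ g' ε) :
    ∀ ε ∈ Icc 0 a, c / (d + 1) * ε ^ (d + 1) ≤ g ε := by
  intro ε hε
  have hmono : MonotoneOn (fun x => g x - c / (d + 1) * x ^ (d + 1)) (Icc 0 a) := by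
    have hd : ∀ x ∈ Icc 0 a, HasDerivWithinAt (fun x => g x - c / (d + 1) * x ^ (d + 1))
        (g' x - c / (d + 1) * (((d + 1 : ℕ) : ℝ) * x ^ d)) (Icc 0 a) x := fun x hx =>
      (hg x hx).sub ((hasDerivAt_pow (d + 1) x).hasDerivWithinAt.const_mul _)
    refine monotoneOn_of_hasDerivWithinAt_nonneg (convex_Icc 0 a)
      (fun x hx => (hd x hx).continuousWithinAt)
      (fun x hx => (hd x (interior_subset hx)).mono interior_subset) ?_
    intro x hx
    have := hle x (by rwa [interior_Icc] at hx)
    have e : c / (d + 1) * (((d + 1 : ℕ) : ℝ) * x ^ d) = c * x ^ d := by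
      push_cast
      field_simp
    rw [e]
    linarith
  have := hmono ⟨le_rfl, hε.1.trans hε.2⟩ hε hε.1
  simp only [ne_eq, Nat.add_eq_zero_iff, one_ne_zero, and_false, not_false_eq_true, zero_pow,
    mul_zero, sub_zero] at this
  linarith

namespace CooperativeSolution

variable {w w' : ℝ → ℤ → ℝ} {δ C T : ℝ}

lemma hasDeriv_reverse (H : CooperativeSolution w w' δ C T) {t a : ℝ} (ht : t ≤ T) (ha : a ≤ t)
    (j : ℤ) : ∀ ε ∈ Icc 0 a,
      HasDerivWithinAt (fun ε => w (t - ε) j) (-w' (t - ε) j) (Icc 0 a) ε := by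
  intro ε hε
  have h1 := H.hasDeriv j (t - ε) ⟨by linarith [hε.2], by linarith [hε.1]⟩
  have h2 : HasDerivWithinAt (fun ε : ℝ => t - ε) (-1) (Icc 0 a) ε :=
    ((hasDerivAt_id ε).const_sub t).hasDerivWithinAt
  have h3 := HasDerivWithinAt.comp ε h1 h2
    (fun x hx => ⟨by linarith [hx.2], by linarith [hx.1]⟩)
  simpa [Function.comp_def] using h3

lemma abs_deriv_le (H : CooperativeSolution w w' δ C T) (hδ : 0 < δ) {τ B : ℝ} (hτ : τ ∈ Icc 0 T)
    (j : ℤ) (h₁ : |w τ (j - 1)| ≤ B) (h₂ : |w τ j| ≤ B) (h₃ : |w τ (j + 1)| ≤ B) :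
    |w' τ j| ≤ 3 * C * B := by
  obtain ⟨q, p, c, hq, hp, hc, e⟩ := H.linear τ hτ j
  have m : ∀ a b : ℝ, |a| ≤ C → |b| ≤ B → |a * b| ≤ C * B := by
    intro a b ha hb
    rw [abs_mul]
    exact mul_le_mul ha hb (abs_nonneg _) ((abs_nonneg _).trans ha)
  have m1 := m q _ (by rw [abs_of_nonneg (by linarith)]; exact hq.2) h₁
  have m2 := m p _ hp h₂
  have m3 := m c _ (by rw [abs_of_nonneg (by linarith)]; exact hc.2) h₃
  rw [e]
  rw [abs_le] at *
  constructor <;> linarith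

lemma abs_le_pow_of_vanish (H : CooperativeSolution w w' δ C T) (hδ : 0 < δ) {t B : ℝ} (ht : t ≤ T)
    (d : ℕ) (i : ℤ) (hB : ∀ ε ∈ Icc 0 t, ∀ j, |j - i| ≤ d → |w (t - ε) j| ≤ B)
    (h0 : ∀ j, |j - i| < d → w t j = 0) :
    ∀ ε ∈ Icc 0 t, |w (t - ε) i| ≤ B * (3 * C * ε) ^ d / d.factorial := by
  induction d generalizing i with
  | zero => intro ε hε; simpa using hB ε hε i (by simp)
  | succ d ih =>
    intro ε hε
    have hi : w t i = 0 := h0 i (by simp)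
    have IH : ∀ k : ℤ, |k - i| ≤ 1 → ∀ ε ∈ Icc 0 t,
        |w (t - ε) k| ≤ B * (3 * C * ε) ^ d / d.factorial := by
      intro k hk
      rw [abs_le] at hk
      apply ih
      · intro ε hε j hj
        apply hB ε hε j
        rw [abs_le] at *
        push_cast
        omega
      · intro j hj
        apply h0 j
        rw [abs_lt] at *
        push_cast
        omega
    have hder : ∀ ε ∈ Icc 0 t, |w' (t - ε) i| ≤ B * (3 * C) ^ (d + 1) / d.factorial * ε ^ d := by
      intro ε hε
      have := H.abs_deriv_le hδ (τ := t - ε) ⟨by linarith [hε.2], by linarith [hε.1]⟩ i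
        (IH (i - 1) (by simp) ε hε) (IH i (by simp) ε hε) (IH (i + 1) (by simp) ε hε)
      refine this.trans (le_of_eq ?_)
      rw [mul_pow]; ring
    have hd := H.hasDeriv_reverse ht le_rfl i
    have a1 := le_of_pow_le_deriv (c := -(B * (3 * C) ^ (d + 1) / d.factorial)) (d := d) hd
      (by simp [hi]) (fun ε hε => by
        have := (abs_le.mp (hder ε ⟨hε.1.le, hε.2.le⟩)).2
        linarith) ε hε
    have a2 := le_of_pow_le_deriv (c := -(B * (3 * C) ^ (d + 1) / d.factorial)) (d := d)
      (fun ε hε => (hd ε hε).neg)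
      (by simp [hi]) (fun ε hε => by
        have := (abs_le.mp (hder ε ⟨hε.1.le, hε.2.le⟩)).1
        linarith) ε hε
    have e : B * (3 * C * ε) ^ (d + 1) / ((d + 1).factorial : ℝ) =
        B * (3 * C) ^ (d + 1) / d.factorial / (d + 1) * ε ^ (d + 1) := by
      rw [Nat.factorial_succ, mul_pow]
      push_cast
      field_simp
    rw [e, abs_le]
    simp only [Pi.neg_apply, neg_div, neg_mul] at a1 a2 ⊢
    constructor <;> linarith

/-- Backward uniqueness. -/
lemma eq_zero_of_eq_zero (H : CooperativeSolution w w' δ C T) (hδ : 0 < δ) {t s : ℝ} (ht : t ≤ T)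
    (hs : 0 ≤ s) (hst : s ≤ t) (h0 : ∀ i, w t i = 0) (i : ℤ) : w s i = 0 := by
  have ht0 : 0 ≤ t := hs.trans hst
  have hC0 : 0 ≤ C := (abs_nonneg _).trans (H.bounded t ⟨ht0, ht⟩ 0)
  have hb : ∀ d : ℕ, |w s i| ≤ C * t * ((3 * C * (t - s)) ^ d / d.factorial) := by
    intro d
    have := H.abs_le_pow_of_vanish hδ (B := C * t) ht d i (fun ε hε j _ => by
      have := H.abs_sub_le (τ := t) (τ' := t - ε) ⟨ht0, ht⟩
        ⟨by linarith [hε.2], by linarith [hε.1]⟩ j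
      rw [h0 j, sub_zero] at this
      refine this.trans (mul_le_mul_of_nonneg_left ?_ hC0)
      rw [abs_le]
      exact ⟨by linarith [hε.2], by linarith [hε.1]⟩) (fun j _ => h0 j) (t - s)
        ⟨by linarith, by linarith⟩
    rw [sub_sub_cancel] at this
    rwa [← mul_div_assoc]
  have hlim : Tendsto (fun d : ℕ => C * t * ((3 * C * (t - s)) ^ d / d.factorial)) atTop (𝓝 0) := by
    simpa using (FloorSemiring.tendsto_pow_div_factorial_atTop (3 * C * (t - s))).const_mul (C * t)
  have := ge_of_tendsto' hlim hb
  exact abs_nonpos_iff.mp this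

end CooperativeSolution

namespace CooperativeSolution

variable {w w' : ℝ → ℤ → ℝ} {δ C T : ℝ}

open Classical in
lemma card_strictlyCrosses_le (H : CooperativeSolution w w' δ C T) (hδ : 0 < δ) {s t : ℝ}
    (hs : 0 ≤ s) (hst : s ≤ t) (ht : t ≤ T) {K : ℕ} (hK : 0 < K)
    (hCK : C * ((t - s) / K) ≤ 1 / 4) (N : ℕ) :
    ((Finset.Ico (0 : ℤ) N).filter (StrictlyCrosses (w t))).card ≤
      ((Finset.Ico (-(K + 1) : ℤ) (N + K + 1)).filter (Crosses (w s))).card +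
        3 * ((Finset.Icc (-1 : ℤ) N).filter (fun j => 0 < |w t j| ∧
          |w t j| ≤ C * (t - s) ^ 2 * Real.exp (3 * C * (t - s)) / K)).card := by
  have hK' : (0 : ℝ) < K := by exact_mod_cast hK
  have hC0 : 0 ≤ C := (abs_nonneg _).trans (H.bounded t ⟨hs.trans hst, ht⟩ 0)
  by_cases hx : ∀ i, w t i = 0
  · have h0 := H.eq_zero_of_eq_zero hδ ht hs hst hx
    refine le_add_right (Finset.card_le_card ?_)
    intro j hj
    have := Finset.mem_Ico.mp (Finset.mem_filter.mp hj).1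
    exact Finset.mem_filter.mpr ⟨Finset.mem_Ico.mpr ⟨by omega, by omega⟩, Or.inl (h0 j)⟩
  · have hh : 0 ≤ (t - s) / K := div_nonneg (by linarith) hK'.le
    have e : s + K * ((t - s) / K) = t := by field_simp; ring
    obtain ⟨X, σ, hσ, hX⟩ := H.exists_traces_euler hδ hs hh hCK K (by rw [e]; exact ht)
    rw [e] at hX
    refine _root_.card_strictlyCrosses_le hσ (fun j => (hX j).trans ?_) hx N
    have h1 : (1 + 3 * C * ((t - s) / K)) ^ K ≤ Real.exp (3 * C * (t - s)) := by
      have h2 : 1 + 3 * C * ((t - s) / K) ≤ Real.exp (3 * C * ((t - s) / K)) := by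
        rw [add_comm]; exact Real.add_one_le_exp _
      refine (pow_le_pow_left₀ (by positivity) h2 K).trans (le_of_eq ?_)
      rw [← Real.exp_nat_mul]
      congr 1
      field_simp
    have h3 : C * ((t - s) / K) ^ 2 * K = C * (t - s) ^ 2 / K := by field_simp
    rw [h3]
    refine (mul_le_mul_of_nonneg_left h1 (by positivity)).trans (le_of_eq (by ring))

lemma reflect (H : CooperativeSolution w w' δ C T) :
    CooperativeSolution (fun τ j => w τ (-j)) (fun τ j => w' τ (-j)) δ C T where
  hasDeriv j τ hτ := H.hasDeriv (-j) τ hτ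
  linear τ hτ j := by
    obtain ⟨q, p, c, hq, hp, hc, e⟩ := H.linear τ hτ (-j)
    refine ⟨c, p, q, hc, hp, hq, ?_⟩
    have e1 : -(j - 1) = -j + 1 := by ring
    have e2 : -(j + 1) = -j - 1 := by ring
    rw [e1, e2, e]
    ring
  lipschitz τ hτ τ' hτ' j := H.lipschitz τ hτ τ' hτ' (-j)
  bounded τ hτ j := H.bounded τ hτ (-j)

lemma exists_abs_le_pow (H : CooperativeSolution w w' δ C T) (hδ : 0 < δ) {t : ℝ} (ht0 : 0 < t)
    (ht : t ≤ T) (d : ℕ) (i : ℤ) (h0 : ∀ j, |j - i| < d → w t j = 0) :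
    ∃ B, 0 ≤ B ∧ ∀ᶠ ε in 𝓝[>] (0 : ℝ), |w (t - ε) i| ≤ B * ε ^ d := by
  have hC0 : 0 ≤ C := (abs_nonneg _).trans (H.bounded t ⟨ht0.le, ht⟩ 0)
  set B₀ := ∑ j ∈ Finset.Icc (i - d) (i + d), |w t j| + C * t
  have hB₀ : 0 ≤ B₀ := add_nonneg (Finset.sum_nonneg fun _ _ => abs_nonneg _)
    (mul_nonneg hC0 ht0.le)
  refine ⟨B₀ * (3 * C) ^ d / d.factorial, by positivity, ?_⟩
  filter_upwards [Ioo_mem_nhdsGT ht0] with ε hε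
  have := H.abs_le_pow_of_vanish hδ ht d i (B := B₀) ?_ h0 ε ⟨hε.1.le, hε.2.le⟩
  · refine this.trans (le_of_eq ?_)
    rw [mul_pow]; ring
  · intro ε hε j hj
    have h1 := H.abs_sub_le (τ := t) (τ' := t - ε) ⟨ht0.le, ht⟩
        ⟨by linarith [hε.2], by linarith [hε.1]⟩ j
    have h2 : |t - ε - t| ≤ t := by
      rw [abs_le]
      exact ⟨by linarith [hε.2], by linarith [hε.1]⟩
    have h3 : |w t j| ≤ ∑ j ∈ Finset.Icc (i - d) (i + d), |w t j| := by
      refine Finset.single_le_sum (f := fun j => |w t j|) (fun _ _ => abs_nonneg _) ?_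
      rw [abs_le] at hj
      exact Finset.mem_Icc.mpr ⟨by omega, by omega⟩
    have h4 : |w (t - ε) j| ≤ |w t j| + |w (t - ε) j - w t j| := by
      have := abs_add_le (w t j) (w (t - ε) j - w t j)
      rwa [add_sub_cancel] at this
    have h5 := mul_le_mul_of_nonneg_left h2 hC0
    linarith

lemma exists_pow_le_neg (H : CooperativeSolution w w' δ C T) (hδ : 0 < δ) {t : ℝ} (ht0 : 0 < t)
    (ht : t ≤ T) {j : ℤ} {σ c B B' : ℝ} {m : ℕ} (hσ : |σ| = 1) (hj : w t j = 0) (hc : 0 < c)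
    (hB' : 0 ≤ B')
    (h₁ : ∀ᶠ ε in 𝓝[>] (0 : ℝ), c * ε ^ m ≤ σ * w (t - ε) (j - 1))
    (h₂ : ∀ᶠ ε in 𝓝[>] (0 : ℝ), |w (t - ε) j| ≤ B * ε ^ (m + 1))
    (h₃ : ∀ᶠ ε in 𝓝[>] (0 : ℝ), -(B' * ε ^ (m + 1)) ≤ σ * w (t - ε) (j + 1)) :
    ∃ c', 0 < c' ∧ ∀ᶠ ε in 𝓝[>] (0 : ℝ), c' * ε ^ (m + 1) ≤ -σ * w (t - ε) j := by
  have hC0 : 0 ≤ C := (abs_nonneg _).trans (H.bounded t ⟨ht0.le, ht⟩ 0)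
  have h₄ : ∀ᶠ ε in 𝓝[>] (0 : ℝ), C * (B + B') * ε < δ * c / 2 := by
    have : Tendsto (fun ε : ℝ => C * (B + B') * ε) (𝓝[>] 0) (𝓝 (C * (B + B') * 0)) :=
      (tendsto_id.const_mul _).mono_left nhdsWithin_le_nhds
    rw [mul_zero] at this
    exact this.eventually_lt_const (by positivity)
  obtain ⟨a, ha, hsub⟩ := mem_nhdsGT_iff_exists_Ioo_subset.mp
    (h₁.and (h₂.and (h₃.and (h₄.and (Ioo_mem_nhdsGT ht0)))))
  replace ha : 0 < a := ha
  have hat : a ≤ t := by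
    by_contra! h
    have := (hsub (show t ∈ Ioo 0 a from ⟨ht0, h⟩)).2.2.2.2.2
    exact lt_irrefl _ this
  refine ⟨δ * c / 2 / (m + 1), by positivity, ?_⟩
  filter_upwards [Ioo_mem_nhdsGT ha] with ε hε
  refine le_of_pow_le_deriv (g := fun ε => -σ * w (t - ε) j) (a := a) (c := δ * c / 2) (d := m)
    (fun ε hε => (H.hasDeriv_reverse ht hat j ε hε).const_mul (-σ)) (by simp [hj]) ?_ ε
    ⟨hε.1.le, hε.2.le⟩
  intro ε hε
  obtain ⟨a1, a2, a3, a4, -⟩ := hsub hε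
  obtain ⟨q, p, r, hq, hp, hr, e⟩ := H.linear (t - ε) ⟨by linarith [hε.2], by linarith [hε.1]⟩ j
  have e' : -σ * -w' (t - ε) j = q * (σ * w (t - ε) (j - 1)) + p * (σ * w (t - ε) j) +
      r * (σ * w (t - ε) (j + 1)) := by rw [e]; ring
  rw [e']
  have hεm : 0 < ε ^ m := pow_pos hε.1 m
  have b1 : δ * (c * ε ^ m) ≤ q * (σ * w (t - ε) (j - 1)) :=
    mul_le_mul hq.1 a1 (by positivity) (by linarith)
  have b2 : -(C * (B * ε ^ (m + 1))) ≤ p * (σ * w (t - ε) j) := by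
    refine (abs_le.mp ?_).1
    rw [abs_mul, abs_mul, hσ, one_mul]
    exact mul_le_mul hp a2 (abs_nonneg _) hC0
  have b3 : -(C * (B' * ε ^ (m + 1))) ≤ r * (σ * w (t - ε) (j + 1)) := by
    have hε1 : 0 ≤ B' * ε ^ (m + 1) := mul_nonneg hB' (pow_pos hε.1 _).le
    have c1 : r * (-(B' * ε ^ (m + 1))) ≤ r * (σ * w (t - ε) (j + 1)) :=
      mul_le_mul_of_nonneg_left a3 (by linarith)
    have c2 : r * (B' * ε ^ (m + 1)) ≤ C * (B' * ε ^ (m + 1)) :=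
      mul_le_mul_of_nonneg_right hr.2 hε1
    linarith
  have b4 := mul_le_mul_of_nonneg_right a4.le hεm.le
  have b5 : C * (B + B') * ε * ε ^ m = C * (B * ε ^ (m + 1)) + C * (B' * ε ^ (m + 1)) := by
    rw [pow_succ]; ring
  linarith

/-- A zero run to the right of a nonzero site was alternating just before. -/
lemma exists_pow_le_right (H : CooperativeSolution w w' δ C T) (hδ : 0 < δ) {t : ℝ} (ht0 : 0 < t)
    (ht : t ≤ T) {b : ℤ} {σ : ℝ} (hσ : |σ| = 1) (hb : 0 < σ * w t b) (d : ℕ)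
    (h0 : ∀ i, b < i → i ≤ b + 2 * d → w t i = 0) :
    ∃ c, 0 < c ∧ ∀ᶠ ε in 𝓝[>] (0 : ℝ), c * ε ^ d ≤ (-1) ^ d * σ * w (t - ε) (b + d) := by
  have hC0 : 0 ≤ C := (abs_nonneg _).trans (H.bounded t ⟨ht0.le, ht⟩ 0)
  induction d with
  | zero =>
    refine ⟨σ * w t b / 2, by positivity, ?_⟩
    have : Tendsto (fun ε : ℝ => C * ε) (𝓝[>] 0) (𝓝 (C * 0)) :=
      (tendsto_id.const_mul _).mono_left nhdsWithin_le_nhds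
    rw [mul_zero] at this
    filter_upwards [Ioo_mem_nhdsGT ht0,
      this.eventually_lt_const (show 0 < σ * w t b / 2 by positivity)] with ε hε hε'
    have h1 := H.abs_sub_le (τ := t) (τ' := t - ε) ⟨ht0.le, ht⟩
        ⟨by linarith [hε.2], by linarith [hε.1]⟩ b
    have h2 : |t - ε - t| = ε := by
      rw [sub_sub_cancel_left, abs_neg, abs_of_pos hε.1]
    rw [h2] at h1
    have h3 : |σ * (w (t - ε) b - w t b)| ≤ C * ε := by rwa [abs_mul, hσ, one_mul]
    have h4 := (abs_le.mp h3).1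
    simp only [pow_zero, mul_one, one_mul, Nat.cast_zero, add_zero]
    linarith
  | succ d ih =>
    obtain ⟨c, hc, h1⟩ := ih (fun i h h' => h0 i h (by push_cast; omega))
    obtain ⟨B, -, h2⟩ := H.exists_abs_le_pow hδ ht0 ht (d + 1) (b + d + 1) (fun j hj => by
      rw [abs_lt] at hj
      exact h0 j (by push_cast at hj; omega) (by push_cast at hj ⊢; omega))
    obtain ⟨B', hB', h3⟩ := H.exists_abs_le_pow hδ ht0 ht (d + 1) (b + d + 1 + 1) (fun j hj => by
      rw [abs_lt] at hj
      exact h0 j (by push_cast at hj; omega) (by push_cast at hj ⊢; omega))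
    have hσ' : |(-1) ^ d * σ| = 1 := by simp [abs_mul, hσ]
    obtain ⟨c', hc', h4⟩ := H.exists_pow_le_neg hδ ht0 ht (j := b + d + 1) hσ'
      (h0 _ (by omega) (by push_cast; omega)) hc hB' (by simpa using h1) h2
      (h3.mono fun ε hε => by
        refine (abs_le.mp ?_).1
        rwa [abs_mul, hσ', one_mul])
    refine ⟨c', hc', h4.mono fun ε hε => hε.trans (le_of_eq ?_)⟩
    rw [pow_succ]
    push_cast
    rw [add_assoc]
    ring

lemma exists_pow_le_left (H : CooperativeSolution w w' δ C T) (hδ : 0 < δ) {t : ℝ} (ht0 : 0 < t)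
    (ht : t ≤ T) {b : ℤ} {σ : ℝ} (hσ : |σ| = 1) (hb : 0 < σ * w t b) (d : ℕ)
    (h0 : ∀ i, b - 2 * d ≤ i → i < b → w t i = 0) :
    ∃ c, 0 < c ∧ ∀ᶠ ε in 𝓝[>] (0 : ℝ), c * ε ^ d ≤ (-1) ^ d * σ * w (t - ε) (b - d) := by
  have := H.reflect.exists_pow_le_right hδ ht0 ht (b := -b) hσ (by simpa using hb) d
    (fun i h h' => h0 (-i) (by omega) (by omega))
  simpa [sub_eq_neg_add] using this

lemma eventually_pos_middle (H : CooperativeSolution w w' δ C T) (hδ : 0 < δ) {t : ℝ}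
    (ht0 : 0 < t) (ht : t ≤ T) {j : ℤ} {σ : ℝ} (hσ : |σ| = 1) (d : ℕ)
    (hl : 0 < σ * w t (j - (d + 1))) (hr : 0 < σ * w t (j + (d + 1)))
    (h0 : ∀ i, |i - j| < d + 1 → w t i = 0) :
    ∀ᶠ ε in 𝓝[>] (0 : ℝ), 0 < -((-1) ^ d * σ) * w (t - ε) j := by
  obtain ⟨c, hc, h1⟩ := H.exists_pow_le_right hδ ht0 ht hσ hl d
    (fun i h h' => h0 i (by rw [abs_lt]; omega))
  obtain ⟨c', hc', h2⟩ := H.exists_pow_le_left hδ ht0 ht hσ hr d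
    (fun i h h' => h0 i (by rw [abs_lt]; omega))
  obtain ⟨B, -, h3⟩ := H.exists_abs_le_pow hδ ht0 ht (d + 1) j (fun i hi => h0 i (by simpa using hi))
  have hσ' : |(-1) ^ d * σ| = 1 := by simp [abs_mul, hσ]
  have e1 : j - (d + 1) + d = j - 1 := by ring
  have e2 : j + (d + 1) - d = j + 1 := by ring
  rw [e1] at h1
  rw [e2] at h2
  obtain ⟨c'', hc'', h4⟩ := H.exists_pow_le_neg hδ ht0 ht (j := j) hσ'
    (h0 j (by simp)) hc le_rfl h1 h3 (by
      filter_upwards [h2, self_mem_nhdsWithin] with ε hε hε'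
      have : 0 ≤ c' * ε ^ d := mul_nonneg hc'.le (pow_pos hε' _).le
      simpa using this.trans hε)
  filter_upwards [h4, self_mem_nhdsWithin] with ε hε hε'
  exact (mul_pos hc'' (pow_pos hε' _)).trans_le hε

end CooperativeSolution

/-- A nonzero site of `x` nearest to `j` lies at or to the left of `j`. -/
def NearestLeft (x : ℤ → ℝ) (j : ℤ) : Prop := ∃ d : ℕ, x (j - d) ≠ 0 ∧ ∀ i, |i - j| < d → x i = 0

/-- A nonzero site of `x` nearest to `j` lies at or to the right of `j`. -/
def NearestRight (x : ℤ → ℝ) (j : ℤ) : Prop := ∃ d : ℕ, x (j + d) ≠ 0 ∧ ∀ i, |i - j| < d → x i = 0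

lemma not_nearestLeft_succ {x : ℤ → ℝ} {j : ℤ} (h : NearestRight x j) (h0 : x j = 0)
    (h1 : x (j + 1) = 0) : ¬ NearestLeft x (j + 1) := by
  obtain ⟨d, hd, hz⟩ := h
  rintro ⟨e, he, hz'⟩
  have d0 : d ≠ 0 := by rintro rfl; simp [h0] at hd
  have d1 : d ≠ 1 := by rintro rfl; simp [h1] at hd
  have a : ¬ |j + (d : ℤ) - (j + 1)| < e := fun h => hd (hz' _ h)
  have b : ¬ |j + 1 - (e : ℤ) - j| < d := fun h => he (hz _ h)
  rw [abs_lt] at a b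
  omega

lemma exists_abs_eq_one_mul_pos {a : ℝ} (ha : a ≠ 0) : ∃ σ : ℝ, |σ| = 1 ∧ 0 < σ * a := by
  rcases ha.lt_or_gt with h | h
  · exact ⟨-1, by simp, by linarith⟩
  · exact ⟨1, by simp, by linarith⟩

namespace CooperativeSolution

variable {w w' : ℝ → ℤ → ℝ} {δ C T : ℝ}

lemma tendsto_left (H : CooperativeSolution w w' δ C T) {t : ℝ} (ht0 : 0 < t)
    (ht : t ≤ T) (j : ℤ) : Tendsto (fun ε => w (t - ε) j) (𝓝[>] 0) (𝓝 (w t j)) := by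
  have := (H.hasDeriv_reverse ht le_rfl j 0 ⟨le_rfl, ht0.le⟩).continuousWithinAt
  have h2 := this.tendsto
  simp only [sub_zero] at h2
  exact h2.mono_left (nhdsWithin_le_of_mem (Icc_mem_nhdsGT ht0))

lemma eventually_mul_neg_left (H : CooperativeSolution w w' δ C T) (hδ : 0 < δ) {t : ℝ}
    (ht0 : 0 < t) (ht : t ≤ T) {j : ℤ} (d : ℕ) (hl : w t (j - (d + 1)) ≠ 0)
    (hr : w t (j + (d + 1)) = 0) (h0 : ∀ i, |i - j| < d + 1 → w t i = 0) :
    ∀ᶠ ε in 𝓝[>] (0 : ℝ), w (t - ε) (j - 1) * w (t - ε) j < 0 := by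
  obtain ⟨σ, hσ, hl⟩ := exists_abs_eq_one_mul_pos hl
  have hz : ∀ i, j - (d + 1) < i → i ≤ j - (d + 1) + 2 * (d + 1) → w t i = 0 := by
    intro i h h'
    by_cases hi : i = j + (d + 1)
    · rwa [hi]
    · exact h0 i (by rw [abs_lt]; omega)
  obtain ⟨c, hc, h1⟩ := H.exists_pow_le_right hδ ht0 ht hσ hl d
    (fun i h h' => hz i h (by omega))
  obtain ⟨c', hc', h2⟩ := H.exists_pow_le_right hδ ht0 ht hσ hl (d + 1)
    (fun i h h' => hz i h (by push_cast at h'; omega))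
  have e1 : j - (d + 1) + d = j - 1 := by ring
  have e2 : j - (d + 1) + (d + 1 : ℕ) = j := by push_cast; ring
  rw [e1] at h1
  rw [e2] at h2
  filter_upwards [h1, h2, self_mem_nhdsWithin] with ε a b hε
  have a' := (mul_pos hc (pow_pos hε d)).trans_le a
  have b' := (mul_pos hc' (pow_pos hε (d + 1))).trans_le b
  have := mul_pos a' b'
  have s2 : ((-1 : ℝ) ^ d * σ) ^ 2 = 1 := by rw [← sq_abs]; simp [abs_mul, hσ]
  have e : (-1) ^ d * σ * w (t - ε) (j - 1) * ((-1) ^ (d + 1) * σ * w (t - ε) j) =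
      -(((-1 : ℝ) ^ d * σ) ^ 2 * (w (t - ε) (j - 1) * w (t - ε) j)) := by
    rw [pow_succ (-1 : ℝ) d]; ring
  rw [e, s2] at this
  linarith

lemma eventually_mul_neg_right (H : CooperativeSolution w w' δ C T) (hδ : 0 < δ) {t : ℝ}
    (ht0 : 0 < t) (ht : t ≤ T) {j : ℤ} (d : ℕ) (hl : w t (j - (d + 1)) = 0)
    (hr : w t (j + (d + 1)) ≠ 0) (h0 : ∀ i, |i - j| < d + 1 → w t i = 0) :
    ∀ᶠ ε in 𝓝[>] (0 : ℝ), w (t - ε) j * w (t - ε) (j + 1) < 0 := by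
  have := H.reflect.eventually_mul_neg_left hδ ht0 ht (j := -j) d
    (by convert hr using 2; ring) (by convert hl using 2; ring)
    (fun i hi => h0 (-i) (by rw [abs_lt] at *; omega))
  filter_upwards [this] with ε hε
  have e1 : -(-j - 1) = j + 1 := by ring
  rw [e1, neg_neg] at hε
  linarith

lemma eventually_of_both (H : CooperativeSolution w w' δ C T) (hδ : 0 < δ) {t : ℝ}
    (ht0 : 0 < t) (ht : t ≤ T) {j : ℤ} (d : ℕ) (hl : w t (j - (d + 1)) ≠ 0)
    (hr : w t (j + (d + 1)) ≠ 0) (h0 : ∀ i, |i - j| < d + 1 → w t i = 0) :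
    ∀ᶠ ε in 𝓝[>] (0 : ℝ), w (t - ε) (j - 1) * w (t - ε) j < 0 ∨
      StrictlyCrosses (w (t - ε)) j := by
  obtain ⟨σ, hσ, hl⟩ := exists_abs_eq_one_mul_pos hl
  obtain ⟨ρ, hρ, hr⟩ := exists_abs_eq_one_mul_pos hr
  obtain ⟨c, hc, h1⟩ := H.exists_pow_le_right hδ ht0 ht hσ hl d
    (fun i h h' => h0 i (by rw [abs_lt]; omega))
  obtain ⟨c', hc', h2⟩ := H.exists_pow_le_left hδ ht0 ht hρ hr d
    (fun i h h' => h0 i (by rw [abs_lt]; omega))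
  have e1 : j - (d + 1) + d = j - 1 := by ring
  have e2 : j + (d + 1) - d = j + 1 := by ring
  rw [e1] at h1
  rw [e2] at h2
  have s2 : ((-1 : ℝ) ^ d * σ) ^ 2 = 1 := by rw [← sq_abs]; simp [abs_mul, hσ]
  rcases abs_eq_abs.mp (hρ.trans hσ.symm) with rfl | rfl
  · filter_upwards [h1, H.eventually_pos_middle hδ ht0 ht hρ d hl hr h0, self_mem_nhdsWithin]
      with ε a b hε
    left
    have := mul_pos ((mul_pos hc (pow_pos hε d)).trans_le a) b
    have e : (-1) ^ d * ρ * w (t - ε) (j - 1) * (-((-1) ^ d * ρ) * w (t - ε) j) =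
        -(((-1 : ℝ) ^ d * ρ) ^ 2 * (w (t - ε) (j - 1) * w (t - ε) j)) := by ring
    rw [e, s2] at this
    linarith
  · filter_upwards [h1, h2, self_mem_nhdsWithin] with ε a b hε
    have := mul_pos ((mul_pos hc (pow_pos hε d)).trans_le a)
      ((mul_pos hc' (pow_pos hε d)).trans_le b)
    have e : (-1) ^ d * σ * w (t - ε) (j - 1) * ((-1) ^ d * -σ * w (t - ε) (j + 1)) =
        -(((-1 : ℝ) ^ d * σ) ^ 2 * (w (t - ε) (j - 1) * w (t - ε) (j + 1))) := by ring
    rw [e, s2] at this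
    have hlr : w (t - ε) (j - 1) * w (t - ε) (j + 1) < 0 := by linarith
    by_cases hj : w (t - ε) j = 0
    · exact Or.inr (Or.inr (Or.inl ⟨hj, hlr⟩))
    · by_contra! h
      have h2 : ¬ w (t - ε) j * w (t - ε) (j + 1) < 0 := fun h' => h.2 (Or.inl h')
      have h3 := mul_nonneg h.1 (not_lt.mp h2)
      have h4 : 0 < w (t - ε) j ^ 2 := by positivity
      have := mul_neg_of_pos_of_neg h4 hlr
      linarith

lemma eventually_of_eq_zero (H : CooperativeSolution w w' δ C T) (hδ : 0 < δ) {t : ℝ}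
    (ht0 : 0 < t) (ht : t ≤ T) (hne : ¬ ∀ i, w t i = 0) {j : ℤ} (hj : w t j = 0) :
    ∀ᶠ ε in 𝓝[>] (0 : ℝ), (NearestLeft (w t) j ∧ w (t - ε) (j - 1) * w (t - ε) j < 0) ∨
      (NearestRight (w t) j ∧ StrictlyCrosses (w (t - ε)) j) := by
  classical
  have hex : ∃ d : ℕ, w t (j - d) ≠ 0 ∨ w t (j + d) ≠ 0 := by
    push Not at hne
    obtain ⟨i, hi⟩ := hne
    refine ⟨(i - j).natAbs, ?_⟩
    rcases le_total i j with h | h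
    · left
      rwa [show j - ((i - j).natAbs : ℤ) = i by omega]
    · right
      rwa [show j + ((i - j).natAbs : ℤ) = i by omega]
  have hspec := Nat.find_spec hex
  have hmin : ∀ i, |i - j| < Nat.find hex → w t i = 0 := by
    intro i hi
    have := Nat.find_min hex (m := (i - j).natAbs) (by rw [abs_lt] at hi; omega)
    push Not at this
    rcases le_total i j with h | h
    · rw [← this.1, show j - ((i - j).natAbs : ℤ) = i by omega]
    · rw [← this.2, show j + ((i - j).natAbs : ℤ) = i by omega]
  generalize Nat.find hex = d at hspec hmin
  obtain _ | d := d
  · simp [hj] at hspec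
  have hmin' : ∀ i, |i - j| < (d : ℤ) + 1 → w t i = 0 := fun i hi => hmin i (by simpa using hi)
  push_cast at hspec
  by_cases hl : w t (j - (d + 1)) = 0
  · have hr : w t (j + (d + 1)) ≠ 0 := hspec.resolve_left (not_not.mpr hl)
    filter_upwards [H.eventually_mul_neg_right hδ ht0 ht d hl hr hmin'] with ε hε
    exact Or.inr ⟨⟨d + 1, by simpa using hr, hmin⟩, Or.inl hε⟩
  by_cases hr : w t (j + (d + 1)) = 0
  · filter_upwards [H.eventually_mul_neg_left hδ ht0 ht d hl hr hmin'] with ε hε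
    exact Or.inl ⟨⟨d + 1, by simpa using hl, hmin⟩, hε⟩
  · filter_upwards [H.eventually_of_both hδ ht0 ht d hl hr hmin'] with ε hε
    exact hε.imp (fun h => ⟨⟨d + 1, by simpa using hl, hmin⟩, h⟩)
      (fun h => ⟨⟨d + 1, by simpa using hr, hmin⟩, h⟩)

open Classical in
/-- Lower semicontinuity from the left: crossings persist, as strict ones, just before `t`. -/
lemma eventually_card_crosses_le (H : CooperativeSolution w w' δ C T) (hδ : 0 < δ) {t : ℝ}
    (ht0 : 0 < t) (ht : t ≤ T) (N : ℕ) :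
    ∀ᶠ ε in 𝓝[>] (0 : ℝ), ((Finset.Ico (0 : ℤ) N).filter (Crosses (w t))).card ≤
      ((Finset.Ico (-1 : ℤ) N).filter (StrictlyCrosses (w (t - ε)))).card := by
  by_cases hne : ∀ i, w t i = 0
  · filter_upwards [Ioo_mem_nhdsGT ht0] with ε hε
    refine Finset.card_le_card ?_
    intro j hj
    have := Finset.mem_Ico.mp (Finset.mem_filter.mp hj).1
    refine Finset.mem_filter.mpr ⟨Finset.mem_Ico.mpr ⟨by omega, by omega⟩, Or.inr (Or.inr ?_)⟩
    exact H.eq_zero_of_eq_zero hδ ht (by linarith [hε.2]) (by linarith [hε.1]) hne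
  have hsite : ∀ j ∈ (Finset.Ico (0 : ℤ) N).filter (Crosses (w t)), ∀ᶠ ε in 𝓝[>] (0 : ℝ),
      (w t (j + 1) ≠ 0 ∧ StrictlyCrosses (w (t - ε)) j) ∨
      (w t j = 0 ∧ NearestLeft (w t) j ∧ StrictlyCrosses (w (t - ε)) (j - 1)) ∨
      (w t j = 0 ∧ NearestRight (w t) j ∧ StrictlyCrosses (w (t - ε)) j) := by
    intro j hj
    rcases (Finset.mem_filter.mp hj).2 with h | h
    · filter_upwards [H.eventually_of_eq_zero hδ ht0 ht hne h] with ε hε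
      right
      refine hε.imp (fun h' => ⟨h, h'.1, Or.inl ?_⟩) (fun h' => ⟨h, h'⟩)
      rw [sub_add_cancel]
      exact h'.2
    · filter_upwards [((H.tendsto_left ht0 ht j).mul
        (H.tendsto_left ht0 ht (j + 1))).eventually_lt_const h] with ε hε
      exact Or.inl ⟨by intro h0; simp [h0] at h, Or.inl hε⟩
  filter_upwards [(Filter.eventually_all_finset _).mpr hsite] with ε hε
  set L : ℤ → Prop := fun j =>
    w t j = 0 ∧ NearestLeft (w t) j ∧ StrictlyCrosses (w (t - ε)) (j - 1)
  set f : ℤ → ℤ := fun j => if L j then j - 1 else j with hf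
  have hf1 : ∀ j, j - 1 ≤ f j ∧ f j ≤ j := by
    intro j
    simp only [hf]
    split_ifs <;> omega
  apply Finset.card_le_card_of_injOn f
  · intro j hj
    have hj' := Finset.mem_Ico.mp (Finset.mem_filter.mp hj).1
    have := hf1 j
    refine Finset.mem_coe.mpr (Finset.mem_filter.mpr ⟨Finset.mem_Ico.mpr ⟨by omega, by omega⟩, ?_⟩)
    simp only [hf]
    split_ifs with hL
    · exact hL.2.2
    · rcases hε j hj with h | h | h
      · exact h.2
      · exact absurd h hL
      · exact h.2.2
  · have key : ∀ i ∈ (Finset.Ico (0 : ℤ) N).filter (Crosses (w t)), ∀ j, i < j → f i ≠ f j := by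
      intro i hi j hij heq
      have h1 := hf1 i
      have h2 := hf1 j
      obtain rfl : j = i + 1 := by omega
      have hLi : ¬ L i := by
        intro h; simp only [hf, h, if_true] at h1 heq; omega
      have hLj : L (i + 1) := by
        by_contra h; simp only [hf, h, if_false] at h2 heq; split_ifs at heq; omega
      rcases hε i hi with h | h | h
      · exact h.1 hLj.1
      · exact hLi h
      · exact not_nearestLeft_succ h.2.1 h.1 hLj.1 hLj.2.1
    intro i hi j hj hij
    rcases lt_trichotomy i j with h | h | h
    · exact absurd hij (key i hi j h)
    · exact h
    · exact absurd hij.symm (key j hj i h)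

end CooperativeSolution

section Potential

variable {V : ℝ → ℝ → ℝ} {δ : ℝ}

lemma add_intCast_of_add_one (hper : ∀ x y : ℝ, V (x + 1) (y + 1) = V x y) (x y : ℝ) (r : ℤ) :
    V (x + r) (y + r) = V x y := by
  have h : Function.Periodic (fun s => V (x + s) (y + s)) 1 := by
    intro s
    simpa [add_assoc] using hper (x + s) (y + s)
  simpa using h.int_mul r 0

lemma V1_add_intCast (hper : ∀ x y : ℝ, V (x + 1) (y + 1) = V x y) (x y : ℝ) (r : ℤ) :
    V1 V (x + r) (y + r) = V1 V x y := by
  unfold V1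
  rw [← deriv_comp_add_const]
  simp_rw [add_intCast_of_add_one hper]

lemma V2_add_intCast (hper : ∀ x y : ℝ, V (x + 1) (y + 1) = V x y) (x y : ℝ) (r : ℤ) :
    V2 V (x + r) (y + r) = V2 V x y := by
  unfold V2
  rw [← deriv_comp_add_const]
  simp_rw [add_intCast_of_add_one hper]

lemma V1_eq_fderiv (hV : ContDiff ℝ 2 (Function.uncurry V)) (p : ℝ × ℝ) :
    V1 V p.1 p.2 = fderiv ℝ (Function.uncurry V) p (1, 0) := by
  have h := (hV.differentiable (by norm_num) p).hasFDerivAt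
  have h1 : HasDerivAt (fun s : ℝ => (s, p.2)) (1, 0) p.1 :=
    (hasDerivAt_id _).prodMk (hasDerivAt_const _ _)
  exact (h.comp_hasDerivAt (f := fun s : ℝ => (s, p.2)) p.1 h1).deriv

lemma V2_eq_fderiv (hV : ContDiff ℝ 2 (Function.uncurry V)) (p : ℝ × ℝ) :
    V2 V p.1 p.2 = fderiv ℝ (Function.uncurry V) p (0, 1) := by
  have h := (hV.differentiable (by norm_num) p).hasFDerivAt
  have h1 : HasDerivAt (fun s : ℝ => (p.1, s)) (0, 1) p.2 :=
    (hasDerivAt_const _ _).prodMk (hasDerivAt_id _)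
  exact (h.comp_hasDerivAt (f := fun s : ℝ => (p.1, s)) p.2 h1).deriv

lemma V12_eq_fderiv_fderiv (hV : ContDiff ℝ 2 (Function.uncurry V)) (p : ℝ × ℝ) :
    V12 V p.1 p.2 = fderiv ℝ (fderiv ℝ (Function.uncurry V)) p (1, 0) (0, 1) := by
  have hA : ContDiff ℝ 1 (fderiv ℝ (Function.uncurry V)) := hV.fderiv_right (by norm_num)
  have h := ((hA.differentiable (by norm_num) p).hasFDerivAt).clm_apply
    (hasFDerivAt_const ((0, 1) : ℝ × ℝ) p)
  have h1 : HasDerivAt (fun s : ℝ => (s, p.2)) (1, 0) p.1 :=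
    (hasDerivAt_id _).prodMk (hasDerivAt_const _ _)
  have h2 := (h.comp_hasDerivAt (f := fun s : ℝ => (s, p.2)) p.1 h1).deriv
  simp only [V12]
  have h3 : (fun s => V2 V s p.2) = (fun q => fderiv ℝ (Function.uncurry V) q (0, 1)) ∘
      fun s : ℝ => (s, p.2) := by
    funext s
    exact V2_eq_fderiv hV (s, p.2)
  rw [h3]
  refine h2.trans ?_
  simp

/-- The pairs of reals at distance at most `n`. -/
def strip (n : ℕ) : Set (ℝ × ℝ) := {p | |p.2 - p.1| ≤ n}

lemma convex_strip (n : ℕ) : Convex ℝ (strip n) := by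
  intro p hp q hq a b ha hb hab
  simp only [strip, mem_ofPred_eq, Prod.snd_add, Prod.fst_add, Prod.smul_fst, Prod.smul_snd,
    smul_eq_mul] at *
  rw [abs_le] at *
  constructor <;> nlinarith

lemma exists_norm_le_on_strip {E : Type*} [NormedAddCommGroup E] {g : ℝ × ℝ → E}
    (hg : Continuous g) (hper : ∀ p, g (p + (1, 1)) = g p) (n : ℕ) :
    ∃ C, ∀ p ∈ strip n, ‖g p‖ ≤ C := by
  obtain ⟨C, hC⟩ := ((isCompact_Icc (a := (0 : ℝ)) (b := 1)).prod
    (isCompact_Icc (a := -(n : ℝ)) (b := n + 1))).exists_bound_of_continuousOn hg.continuousOn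
  refine ⟨C, fun p hp => ?_⟩
  have h : Function.Periodic (fun s : ℝ => g (p + (s, s))) 1 := by
    intro s
    have := hper (p + (s, s))
    simpa [add_assoc] using this
  have h2 : g (p + (-(⌊p.1⌋ : ℝ), -(⌊p.1⌋ : ℝ))) = g p := by
    have h3 : g (p + (0, 0)) = g p := by rw [Prod.mk_zero_zero, add_zero]
    have h4 := h.int_mul (-⌊p.1⌋) 0
    simp only [Int.cast_neg, mul_one, zero_add, h3] at h4
    exact h4
  rw [← h2]
  apply hC
  simp only [strip, mem_ofPred_eq, abs_le] at hp
  have a := Int.floor_le p.1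
  have b := Int.lt_floor_add_one p.1
  refine ⟨⟨?_, ?_⟩, ?_, ?_⟩ <;> simp <;> linarith

lemma fderiv_add_one_one {E : Type*} [NormedAddCommGroup E] [NormedSpace ℝ E] {g : ℝ × ℝ → E}
    (hper : ∀ p, g (p + (1, 1)) = g p) (p : ℝ × ℝ) : fderiv ℝ g (p + (1, 1)) = fderiv ℝ g p := by
  rw [← fderiv_comp_add_right]
  simp_rw [hper]

/-- Bounds on the first derivatives of `V` and their increments over the strip, the mixed
coefficients of the increments being at most `-δ`. -/
structure IncrementBounds (V : ℝ → ℝ → ℝ) (n : ℕ) (δ C : ℝ) : Prop where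
  abs_V1 : ∀ p ∈ strip n, |V1 V p.1 p.2| ≤ C
  abs_V2 : ∀ p ∈ strip n, |V2 V p.1 p.2| ≤ C
  sub_V1 : ∀ p ∈ strip n, ∀ q ∈ strip n, ∃ a b, |a| ≤ C ∧ (-C ≤ b ∧ b ≤ -δ) ∧
    V1 V p.1 p.2 - V1 V q.1 q.2 = a * (p.1 - q.1) + b * (p.2 - q.2)
  sub_V2 : ∀ p ∈ strip n, ∀ q ∈ strip n, ∃ a b, (-C ≤ a ∧ a ≤ -δ) ∧ |b| ≤ C ∧
    V2 V p.1 p.2 - V2 V q.1 q.2 = a * (p.1 - q.1) + b * (p.2 - q.2)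

lemma exists_incrementBounds (hV : ContDiff ℝ 2 (Function.uncurry V))
    (hper : ∀ x y : ℝ, V (x + 1) (y + 1) = V x y) (htwist : ∀ x y : ℝ, V12 V x y ≤ -δ) (n : ℕ) :
    ∃ C, IncrementBounds V n δ C := by
  set f := Function.uncurry V with hf
  have hA : ContDiff ℝ 1 (fderiv ℝ f) := hV.fderiv_right (by norm_num)
  have hfper : ∀ p, f (p + (1, 1)) = f p := fun p => hper p.1 p.2
  have hAper := fderiv_add_one_one hfper
  obtain ⟨C₁, h₁⟩ := exists_norm_le_on_strip hA.continuous hAper n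
  obtain ⟨C₂, h₂⟩ := exists_norm_le_on_strip (hA.continuous_fderiv (by norm_num))
    (fderiv_add_one_one hAper) n
  set C := max C₁ C₂
  have hle : ∀ (L : ℝ × ℝ →L[ℝ] ℝ) (v : ℝ × ℝ), ‖v‖ ≤ 1 → |L v| ≤ ‖L‖ := fun L v hv =>
    (L.le_opNorm v).trans (mul_le_of_le_one_right (norm_nonneg _) hv)
  have e₁ : ‖((1, 0) : ℝ × ℝ)‖ ≤ 1 := by simp
  have e₂ : ‖((0, 1) : ℝ × ℝ)‖ ≤ 1 := by simp
  have hH : ∀ p ∈ strip n, ∀ v w : ℝ × ℝ, ‖v‖ ≤ 1 → ‖w‖ ≤ 1 →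
      |fderiv ℝ (fderiv ℝ f) p v w| ≤ C := fun p hp v w hv hw => by
    refine (hle _ w hw).trans ?_
    refine ((ContinuousLinearMap.le_opNorm _ v).trans
      (mul_le_of_le_one_right (norm_nonneg _) hv)).trans ?_
    exact (h₂ p hp).trans (le_max_right _ _)
  have hmean : ∀ e : ℝ × ℝ, ∀ p ∈ strip n, ∀ q ∈ strip n, ∃ ξ ∈ strip n,
      fderiv ℝ f p e - fderiv ℝ f q e = fderiv ℝ (fderiv ℝ f) ξ (1, 0) e * (p.1 - q.1) +
        fderiv ℝ (fderiv ℝ f) ξ (0, 1) e * (p.2 - q.2) := by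
    intro e p hp q hq
    have hd : ∀ x ∈ strip n, HasFDerivWithinAt (fun z => fderiv ℝ f z e)
        ((fderiv ℝ (fderiv ℝ f) x).flip e) (strip n) x := fun x _ => by
      have := ((hA.differentiable (by norm_num) x).hasFDerivAt).clm_apply (hasFDerivAt_const e x)
      simpa using this.hasFDerivWithinAt
    obtain ⟨ξ, hξ, h⟩ := domain_mvt hd (convex_strip n) hq hp
    refine ⟨ξ, (convex_strip n).segment_subset hq hp hξ, ?_⟩
    rw [h]
    have : p - q = (p.1 - q.1) • ((1, 0) : ℝ × ℝ) + (p.2 - q.2) • ((0, 1) : ℝ × ℝ) := by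
      ext <;> simp
    rw [this, map_add, map_smul, map_smul]
    simp [mul_comm]
  have hsymm : ∀ p, fderiv ℝ (fderiv ℝ f) p (0, 1) (1, 0) =
      fderiv ℝ (fderiv ℝ f) p (1, 0) (0, 1) := fun p =>
    (hV.contDiffAt.isSymmSndFDerivAt (by simp)) _ _
  refine ⟨C, ⟨fun p hp => ?_, fun p hp => ?_, fun p hp q hq => ?_, fun p hp q hq => ?_⟩⟩
  · rw [V1_eq_fderiv hV]
    exact (hle _ _ e₁).trans ((h₁ p hp).trans (le_max_left _ _))
  · rw [V2_eq_fderiv hV]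
    exact (hle _ _ e₂).trans ((h₁ p hp).trans (le_max_left _ _))
  · obtain ⟨ξ, hξ, h⟩ := hmean (1, 0) p hp q hq
    refine ⟨_, _, hH ξ hξ _ _ e₁ e₁, ⟨(abs_le.mp (hH ξ hξ _ _ e₂ e₁)).1, ?_⟩, ?_⟩
    · rw [hsymm, ← V12_eq_fderiv_fderiv hV]
      exact htwist _ _
    · rw [V1_eq_fderiv hV, V1_eq_fderiv hV]
      exact h
  · obtain ⟨ξ, hξ, h⟩ := hmean (0, 1) p hp q hq
    refine ⟨_, _, ⟨(abs_le.mp (hH ξ hξ _ _ e₁ e₂)).1, ?_⟩, hH ξ hξ _ _ e₂ e₂, ?_⟩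
    · rw [← V12_eq_fderiv_fderiv hV]
      exact htwist _ _
    · rw [V2_eq_fderiv hV, V2_eq_fderiv hV]
      exact h

end Potential

/-- The right-hand side of the undriven Frenkel–Kontorova equation. -/
noncomputable def fkForce (V : ℝ → ℝ → ℝ) (u : ℤ → ℝ) (j : ℤ) : ℝ :=
  -(V2 V (u (j - 1)) (u j)) - V1 V (u j) (u (j + 1))

lemma mem_strip_of_Kn {n : ℕ} (u : Kn n) (j : ℤ) : (u.val j, u.val (j + 1)) ∈ strip n := u.2 j

lemma mem_strip_of_Kn' {n : ℕ} (u : Kn n) (j : ℤ) : (u.val (j - 1), u.val j) ∈ strip n := by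
  have := mem_strip_of_Kn u (j - 1)
  rwa [sub_add_cancel] at this

lemma mem_strip_of_Kn_add {n : ℕ} (u : Kn n) (j : ℤ) (r : ℝ) :
    (u.val j + r, u.val (j + 1) + r) ∈ strip n := by
  simpa [strip] using u.2 j

lemma mem_strip_of_Kn_add' {n : ℕ} (u : Kn n) (j : ℤ) (r : ℝ) :
    (u.val (j - 1) + r, u.val j + r) ∈ strip n := by
  simpa using mem_strip_of_Kn_add u (j - 1) r

lemma exists_cooperativeSolution {δ : ℝ} {V : ℝ → ℝ → ℝ} {F : ℝ → ℝ}
    (hδ : 0 < δ) (hV : ContDiff ℝ 2 (Function.uncurry V))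
    (hper : ∀ x y : ℝ, V (x + 1) (y + 1) = V x y)
    (htwist : ∀ x y : ℝ, V12 V x y ≤ -δ) (hF : Continuous F) {n : ℕ} {φ : ℝ → Kn n → Kn n}
    (hφsol : ∀ u : Kn n, ∀ j : ℤ, ∀ t : ℝ, 0 ≤ t →
      HasDerivWithinAt (fun s => (φ s u).val j)
        (-(V2 V ((φ t u).val (j - 1)) ((φ t u).val j)) -
          V1 V ((φ t u).val j) ((φ t u).val (j + 1)) + F t)
        (Set.Ici (0 : ℝ)) t) (T : ℝ) :
    ∃ C, ∀ (u v : Kn n) (r : ℤ), CooperativeSolution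
      (fun τ j => (φ τ u).val j - (φ τ v).val j + r)
      (fun τ j => fkForce V (φ τ u).val j - fkForce V (φ τ v).val j) δ C T := by
  obtain ⟨C, hC⟩ := exists_incrementBounds hV hper htwist n
  obtain ⟨M, hM⟩ := (isCompact_Icc (a := (0 : ℝ)) (b := T)).exists_bound_of_continuousOn
    hF.continuousOn
  have hC0 : 0 < C := by
    obtain ⟨a, b, -, h, -⟩ := hC.sub_V1 (0, 0) (by simp [strip]) (0, 0) (by simp [strip])
    linarith
  have hforce : ∀ (u : Kn n) (j : ℤ), |fkForce V u.val j| ≤ 2 * C := fun u j => by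
    have a := abs_le.mp (hC.abs_V2 _ (mem_strip_of_Kn' u j))
    have b := abs_le.mp (hC.abs_V1 _ (mem_strip_of_Kn u j))
    simp only at a b
    rw [abs_le, fkForce]
    constructor <;> linarith [a.1, a.2, b.1, b.2]
  set L := 2 * C + |M|
  have hL : 0 ≤ L := by positivity
  have hlip : ∀ (u : Kn n) (j : ℤ), ∀ τ ∈ Icc 0 T, ∀ τ' ∈ Icc 0 T,
      |(φ τ u).val j - (φ τ' u).val j| ≤ L * |τ - τ'| := fun u j τ hτ τ' hτ' => by
    have := (convex_Icc (0 : ℝ) T).norm_image_sub_le_of_norm_hasDerivWithin_le (C := L)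
      (f := fun s => (φ s u).val j)
      (fun x hx => (hφsol u j x hx.1).mono (fun y hy => hy.1))
      (fun x hx => by
        refine (norm_add_le _ _).trans (add_le_add ?_ ((hM x hx).trans (le_abs_self M)))
        exact hforce (φ x u) j) hτ' hτ
    simpa using this
  have hforcelip : ∀ (u : Kn n) (j : ℤ), ∀ τ ∈ Icc 0 T, ∀ τ' ∈ Icc 0 T,
      |fkForce V (φ τ u).val j - fkForce V (φ τ' u).val j| ≤ 4 * C * L * |τ - τ'| := by
    intro u j τ hτ τ' hτ'
    have key : ∀ a x, |a| ≤ C → |x| ≤ L * |τ - τ'| → |a * x| ≤ C * (L * |τ - τ'|) :=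
      fun a x ha hx => by
        rw [abs_mul]
        exact mul_le_mul ha hx (abs_nonneg _) hC0.le
    obtain ⟨a, b, ha, hb, h⟩ := hC.sub_V2 _ (mem_strip_of_Kn' (φ τ u) j) _
      (mem_strip_of_Kn' (φ τ' u) j)
    obtain ⟨a', b', ha', hb', h'⟩ := hC.sub_V1 _ (mem_strip_of_Kn (φ τ u) j) _
      (mem_strip_of_Kn (φ τ' u) j)
    have k1 := abs_le.mp (key a _ (abs_le.mpr ⟨ha.1, by linarith⟩) (hlip u (j - 1) τ hτ τ' hτ'))
    have k2 := abs_le.mp (key b _ hb (hlip u j τ hτ τ' hτ'))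
    have k3 := abs_le.mp (key a' _ ha' (hlip u j τ hτ τ' hτ'))
    have k4 := abs_le.mp (key b' _ (abs_le.mpr ⟨hb'.1, by linarith⟩)
      (hlip u (j + 1) τ hτ τ' hτ'))
    simp only at h h'
    rw [abs_le]
    unfold fkForce
    constructor <;> linarith [k1.1, k1.2, k2.1, k2.2, k3.1, k3.2, k4.1, k4.2]
  have hCL : 0 ≤ 8 * C * L := by positivity
  refine ⟨4 * C + 8 * C * L, fun u v r => ⟨?_, ?_, ?_, ?_⟩⟩
  · intro j τ hτ
    have hu := (hφsol u j τ hτ.1).mono (s := Icc 0 T) (fun y hy => hy.1)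
    have hv := (hφsol v j τ hτ.1).mono (s := Icc 0 T) (fun y hy => hy.1)
    refine ((hu.sub hv).add_const (r : ℝ)).congr_deriv ?_
    unfold fkForce
    ring
  · intro τ _ j
    obtain ⟨a, b, ha, hb, h⟩ := hC.sub_V2 _ (mem_strip_of_Kn_add' (φ τ u) j r) _
      (mem_strip_of_Kn' (φ τ v) j)
    obtain ⟨a', b', ha', hb', h'⟩ := hC.sub_V1 _ (mem_strip_of_Kn_add (φ τ u) j r) _
      (mem_strip_of_Kn (φ τ v) j)
    simp only [V1_add_intCast hper, V2_add_intCast hper] at h h'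
    refine ⟨-a, -(b + a'), -b', ⟨by linarith, by linarith⟩, ?_, ⟨by linarith, by linarith⟩, ?_⟩
    · rw [abs_neg]
      exact (abs_add_le _ _).trans (by linarith)
    · simp only [fkForce]
      linear_combination -h - h'
  · intro τ hτ τ' hτ' j
    have h1 := abs_le.mp (hforcelip u j τ hτ τ' hτ')
    have h2 := abs_le.mp (hforcelip v j τ hτ τ' hτ')
    have h3 : 0 ≤ 4 * C * |τ - τ'| := by positivity
    rw [abs_le]
    constructor <;> linarith [h1.1, h1.2, h2.1, h2.2]
  · intro τ _ j
    have h1 := abs_le.mp (hforce (φ τ u) j)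
    have h2 := abs_le.mp (hforce (φ τ v) j)
    rw [abs_le]
    constructor <;> linarith [h1.1, h1.2, h2.1, h2.2]

section Stationary

open scoped ENNReal

variable {Ω : Type*} [MeasurableSpace Ω] {Q : Measure Ω}

lemma measurableSet_crosses (j : ℤ) : MeasurableSet {x : ℤ → ℝ | Crosses x j} := by
  have h (i : ℤ) : Measurable fun x : ℤ → ℝ => x i := measurable_pi_apply i
  exact (measurableSet_eq_fun (h j) measurable_const).union
    (measurableSet_lt ((h j).mul (h (j + 1))) measurable_const)

lemma measurableSet_strictlyCrosses (j : ℤ) :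
    MeasurableSet {x : ℤ → ℝ | StrictlyCrosses x j} := by
  have h (i : ℤ) : Measurable fun x : ℤ → ℝ => x i := measurable_pi_apply i
  refine (measurableSet_lt ((h j).mul (h (j + 1))) measurable_const).union
    (((measurableSet_eq_fun (h j) measurable_const).inter
      (measurableSet_lt ((h (j - 1)).mul (h (j + 1))) measurable_const)).union ?_)
  have : {x : ℤ → ℝ | ∀ i, x i = 0} = ⋂ i, {x | x i = 0} := by ext; simp
  change MeasurableSet {x : ℤ → ℝ | ∀ i, x i = 0}
  rw [this]
  exact MeasurableSet.iInter fun i => measurableSet_eq_fun (h i) measurable_const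

/-- The value of `x` at `j` is nonzero but at most `η`. -/
def NearlyVanishes (η : ℝ) (x : ℤ → ℝ) (j : ℤ) : Prop := 0 < |x j| ∧ |x j| ≤ η

lemma measurableSet_nearlyVanishes (η : ℝ) (j : ℤ) :
    MeasurableSet {x : ℤ → ℝ | NearlyVanishes η x j} := by
  have h : Measurable fun x : ℤ → ℝ => |x j| := (measurable_pi_apply j).abs
  exact (measurableSet_lt measurable_const h).inter (measurableSet_le h measurable_const)

lemma measure_eq_of_shift {X : Ω → ℤ → ℝ} (hX : Measurable X) {S : Ω → Ω}
    (hS : MeasurePreserving S Q Q) (hXS : ∀ ω, X (S ω) = shift (X ω)) {p : (ℤ → ℝ) → ℤ → Prop}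
    (hp : ∀ j, MeasurableSet {x | p x j}) (hpS : ∀ x j, p (shift x) j ↔ p x (j - 1)) (j : ℤ) :
    Q {ω | p (X ω) j} = Q {ω | p (X ω) 0} := by
  have step (j : ℤ) : Q {ω | p (X ω) (j - 1)} = Q {ω | p (X ω) j} := by
    refine Eq.trans ?_ (hS.measure_preimage (hX (hp j)).nullMeasurableSet)
    congr 1
    ext ω
    simp [hXS, hpS]
  induction j using Int.induction_on with
  | zero => rfl
  | succ k ih => rw [← ih, ← step, add_sub_cancel_right]
  | pred k ih => rw [step, ih]

open Classical in
lemma lintegral_card_filter {X : Ω → ℤ → ℝ} (hX : Measurable X) {p : (ℤ → ℝ) → ℤ → Prop}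
    (hp : ∀ j, MeasurableSet {x | p x j}) (s : Finset ℤ) :
    Measurable (fun ω => ((s.filter (p (X ω))).card : ℝ≥0∞)) ∧
      ∫⁻ ω, ((s.filter (p (X ω))).card : ℝ≥0∞) ∂Q = ∑ j ∈ s, Q {ω | p (X ω) j} := by
  have h : (fun ω => ((s.filter (p (X ω))).card : ℝ≥0∞)) =
      fun ω => ∑ j ∈ s, {ω | p (X ω) j}.indicator 1 ω := by
    funext ω
    rw [Finset.card_filter]
    push_cast
    exact Finset.sum_congr rfl fun j _ => by simp [indicator_apply]
  have hm (j : ℤ) : Measurable ({ω | p (X ω) j}.indicator (1 : Ω → ℝ≥0∞)) :=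
    measurable_one.indicator (hX (hp j))
  rw [h]
  refine ⟨Finset.measurable_fun_sum _ fun j _ => hm j, ?_⟩
  rw [lintegral_finsetSum _ fun j _ => hm j]
  exact Finset.sum_congr rfl fun j _ => lintegral_indicator_one (hX (hp j))

open Classical in
lemma lintegral_card_filter_of_shift {X : Ω → ℤ → ℝ} (hX : Measurable X) {S : Ω → Ω}
    (hS : MeasurePreserving S Q Q) (hXS : ∀ ω, X (S ω) = shift (X ω)) {p : (ℤ → ℝ) → ℤ → Prop}
    (hp : ∀ j, MeasurableSet {x | p x j}) (hpS : ∀ x j, p (shift x) j ↔ p x (j - 1))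
    (s : Finset ℤ) :
    ∫⁻ ω, ((s.filter (p (X ω))).card : ℝ≥0∞) ∂Q = s.card * Q {ω | p (X ω) 0} := by
  rw [(lintegral_card_filter hX hp s).2,
    Finset.sum_congr rfl fun j _ => measure_eq_of_shift hX hS hXS hp hpS j]
  simp

lemma crosses_shift (x : ℤ → ℝ) (j : ℤ) : Crosses (shift x) j ↔ Crosses x (j - 1) := by
  simp [Crosses, shift]

lemma strictlyCrosses_shift (x : ℤ → ℝ) (j : ℤ) :
    StrictlyCrosses (shift x) j ↔ StrictlyCrosses x (j - 1) := by
  have : (∀ i, x (i - 1) = 0) ↔ ∀ i, x i = 0 :=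
    ⟨fun h i => by simpa using h (i + 1), fun h i => h _⟩
  simp [StrictlyCrosses, shift, this]

lemma nearlyVanishes_shift (η : ℝ) (x : ℤ → ℝ) (j : ℤ) :
    NearlyVanishes η (shift x) j ↔ NearlyVanishes η x (j - 1) := Iff.rfl

lemma ENNReal.le_of_forall_nat_mul_le_add {a b d : ℝ≥0∞} (hd : d ≠ ⊤)
    (h : ∀ N : ℕ, N * a ≤ N * b + d) : a ≤ b := by
  rcases eq_or_ne b ⊤ with rfl | hb
  · exact le_top
  have ha : a ≠ ⊤ := ne_top_of_le_ne_top (ENNReal.add_ne_top.mpr ⟨hb, hd⟩)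
    (by simpa only [Nat.cast_one, one_mul] using h 1)
  lift a to NNReal using ha
  lift b to NNReal using hb
  lift d to NNReal using hd
  norm_cast at h ⊢
  by_contra! hlt
  have hpos : (0 : ℝ) < a - b := sub_pos.mpr (by exact_mod_cast hlt)
  obtain ⟨N, hN⟩ := exists_nat_gt ((d : ℝ) / (a - b))
  have h1 : (N : ℝ) * a ≤ N * b + d := by exact_mod_cast h N
  rw [div_lt_iff₀ hpos] at hN
  linarith

variable {W W' : ℝ → Ω → ℤ → ℝ} {δ C T : ℝ}

lemma measure_strictlyCrosses_le (hδ : 0 < δ) (hW : ∀ t ∈ Icc 0 T, Measurable (W t))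
    {S : Ω → Ω} (hS : MeasurePreserving S Q Q)
    (hWS : ∀ t ∈ Icc 0 T, ∀ ω, W t (S ω) = shift (W t ω))
    (hcoop : ∀ ω, CooperativeSolution (fun τ => W τ ω) (fun τ => W' τ ω) δ C T)
    (hfin : ∀ t ∈ Icc 0 T, Q {ω | Crosses (W t ω) 0} ≠ ⊤)
    (hfin' : ∀ t ∈ Icc 0 T, Q {ω | |W t ω 0| ≤ 1} ≠ ⊤)
    {s t : ℝ} (hs : 0 ≤ s) (hst : s ≤ t) (ht : t ≤ T) :
    Q {ω | StrictlyCrosses (W t ω) 0} ≤ Q {ω | Crosses (W s ω) 0} := by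
  classical
  have hsI : s ∈ Icc 0 T := ⟨hs, hst.trans ht⟩
  have htI : t ∈ Icc 0 T := ⟨hs.trans hst, ht⟩
  set B : ℝ → Set Ω := fun η => {ω | NearlyVanishes η (W t ω) 0}
  have hB1 : Q (B 1) ≠ ⊤ := ne_top_of_le_ne_top (hfin' t htI) (measure_mono fun ω h => h.2)
  have hBlim : Tendsto (Q ∘ B) (𝓝[>] 0) (𝓝 0) := by
    have h := tendsto_measure_biInter_gt (μ := Q) (s := B) (a := 0)
      (fun r _ => (hW t htI (measurableSet_nearlyVanishes r 0)).nullMeasurableSet)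
      (fun i j _ hij ω hω => ⟨hω.1, hω.2.trans hij⟩) ⟨1, one_pos, hB1⟩
    have hempty : (⋂ r > (0 : ℝ), B r) = ∅ := by
      refine eq_empty_of_forall_notMem fun ω hω => ?_
      rw [mem_iInter₂] at hω
      have h1 := (hω 1 one_pos).1
      exact absurd (hω _ (half_pos h1)).2 (not_le.mpr (half_lt_self h1))
    rwa [hempty, measure_empty] at h
  set E : ℝ := |C * (t - s) ^ 2 * Real.exp (3 * C * (t - s))| + 1
  have hE : 0 < E := by positivity
  have hElim : Tendsto (fun K : ℕ => E / K) atTop (𝓝 0) := tendsto_const_div_atTop_nhds_zero_nat E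
  have hElim' : Tendsto (fun K : ℕ => E / K) atTop (𝓝[>] 0) :=
    tendsto_nhdsWithin_iff.mpr ⟨hElim, (eventually_gt_atTop 0).mono fun K hK =>
      div_pos hE (Nat.cast_pos.mpr hK)⟩
  have hCK : ∀ᶠ K : ℕ in atTop, C * ((t - s) / K) ≤ 1 / 4 := by
    have h : Tendsto (fun K : ℕ => C * ((t - s) / K)) atTop (𝓝 (C * 0)) :=
      (tendsto_const_div_atTop_nhds_zero_nat _).const_mul C
    rw [mul_zero] at h
    exact (h.eventually_lt_const (by norm_num)).mono fun _ => le_of_lt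
  have key : ∀ᶠ K : ℕ in atTop, Q {ω | StrictlyCrosses (W t ω) 0} ≤
      Q {ω | Crosses (W s ω) 0} + 3 * Q (B (E / K)) := by
    filter_upwards [hCK, eventually_gt_atTop 0,
      hElim'.eventually (eventually_nhdsWithin_of_eventually_nhds (eventually_le_nhds one_pos))]
      with K hCK hK hK1
    have hBK : Q (B (E / K)) ≠ ⊤ :=
      ne_top_of_le_ne_top hB1 (measure_mono fun ω h => ⟨h.1, h.2.trans hK1⟩)
    have hA := hfin s hsI
    refine ENNReal.le_of_forall_nat_mul_le_add
      (d := (2 * K + 2) * Q {ω | Crosses (W s ω) 0} + 6 * Q (B (E / K))) (by finiteness)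
      fun N => ?_
    have h1 : ∫⁻ ω, (((Finset.Ico (0 : ℤ) N).filter (StrictlyCrosses (W t ω))).card : ℝ≥0∞) ∂Q ≤
        ∫⁻ ω, ((((Finset.Ico (-(K + 1) : ℤ) (N + K + 1)).filter (Crosses (W s ω))).card : ℝ≥0∞) +
          3 * (((Finset.Icc (-1 : ℤ) N).filter
            (NearlyVanishes (E / K) (W t ω))).card : ℝ≥0∞)) ∂Q := by
      refine lintegral_mono fun ω => ?_
      have h := (hcoop ω).card_strictlyCrosses_le hδ hs hst ht hK hCK N
      have h2 : ((Finset.Icc (-1 : ℤ) N).filter (fun j => 0 < |W t ω j| ∧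
          |W t ω j| ≤ C * (t - s) ^ 2 * Real.exp (3 * C * (t - s)) / K)).card ≤
          ((Finset.Icc (-1 : ℤ) N).filter (NearlyVanishes (E / K) (W t ω))).card := by
        refine Finset.card_le_card (Finset.monotone_filter_right _ fun j _ hj => ⟨hj.1, ?_⟩)
        refine hj.2.trans (div_le_div_of_nonneg_right ?_ (Nat.cast_nonneg K))
        exact (le_abs_self _).trans (by simp [E])
      refine (Nat.cast_le.mpr (h.trans (Nat.add_le_add_left (Nat.mul_le_mul_left 3 h2) _))).trans_eq
        ?_
      rw [Nat.cast_add, Nat.cast_mul, Nat.cast_ofNat]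
    rw [lintegral_card_filter_of_shift (hW t htI) hS (hWS t htI) measurableSet_strictlyCrosses
        strictlyCrosses_shift,
      lintegral_add_left (lintegral_card_filter (Q := Q) (hW s hsI) measurableSet_crosses _).1,
      lintegral_const_mul _ (lintegral_card_filter (Q := Q) (hW t htI)
        (measurableSet_nearlyVanishes (E / K)) _).1,
      lintegral_card_filter_of_shift (hW s hsI) hS (hWS s hsI) measurableSet_crosses
        crosses_shift,
      lintegral_card_filter_of_shift (hW t htI) hS (hWS t htI)
        (measurableSet_nearlyVanishes _) (nearlyVanishes_shift _), Int.card_Ico, Int.card_Ico, Int.card_Icc] at h1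
    have c1 : ((N : ℤ) - 0).toNat = N := by omega
    have c2 : ((N : ℤ) + K + 1 - -(K + 1)).toNat = N + 2 * K + 2 := by omega
    have c3 : ((N : ℤ) + 1 - -1).toNat = N + 2 := by omega
    rw [c1, c2, c3] at h1
    refine h1.trans (le_of_eq ?_)
    simp only [B]
    push_cast
    ring
  have hlim : Tendsto (fun K : ℕ => Q {ω | Crosses (W s ω) 0} + 3 * Q (B (E / K))) atTop
      (𝓝 (Q {ω | Crosses (W s ω) 0} + 3 * 0)) :=
    (ENNReal.Tendsto.const_mul (hBlim.comp hElim') (Or.inr (by simp))).const_add _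
  rw [mul_zero, add_zero] at hlim
  exact ge_of_tendsto hlim key

lemma measure_crosses_le (hδ : 0 < δ) (hW : ∀ t ∈ Icc 0 T, Measurable (W t))
    {S : Ω → Ω} (hS : MeasurePreserving S Q Q)
    (hWS : ∀ t ∈ Icc 0 T, ∀ ω, W t (S ω) = shift (W t ω))
    (hcoop : ∀ ω, CooperativeSolution (fun τ => W τ ω) (fun τ => W' τ ω) δ C T)
    (hfin : ∀ t ∈ Icc 0 T, Q {ω | Crosses (W t ω) 0} ≠ ⊤)
    (hfin' : ∀ t ∈ Icc 0 T, Q {ω | |W t ω 0| ≤ 1} ≠ ⊤)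
    {s t : ℝ} (hs : 0 ≤ s) (hst : s < t) (ht : t ≤ T) :
    Q {ω | Crosses (W t ω) 0} ≤ Q {ω | Crosses (W s ω) 0} := by
  classical
  have htI : t ∈ Icc 0 T := ⟨hs.trans hst.le, ht⟩
  refine ENNReal.le_of_forall_nat_mul_le_add (hfin s ⟨hs, hst.le.trans ht⟩) fun N => ?_
  have hε : Tendsto (fun m : ℕ => (1 : ℝ) / (m + 1)) atTop (𝓝[>] 0) :=
    tendsto_nhdsWithin_iff.mpr ⟨tendsto_one_div_add_atTop_nhds_zero_nat,
      Eventually.of_forall fun m => by simp only [mem_Ioi]; positivity⟩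
  obtain ⟨m₀, hm₀⟩ : ∃ m₀ : ℕ, ∀ m ≥ m₀, (1 : ℝ) / (m + 1) ≤ t - s :=
    eventually_atTop.mp (hε.eventually (eventually_nhdsWithin_of_eventually_nhds
      (eventually_le_nhds (sub_pos.mpr hst))))
  set τ : ℕ → ℝ := fun m => t - 1 / ((m + m₀ : ℕ) + 1)
  have hτ : ∀ m, s ≤ τ m ∧ τ m ≤ T := fun m => by
    have h1 := hm₀ (m + m₀) (by omega)
    have h2 : (0 : ℝ) < 1 / ((m + m₀ : ℕ) + 1) := by positivity
    constructor <;> simp only [τ] <;> linarith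
  have hτI : ∀ m, τ m ∈ Icc 0 T := fun m => ⟨hs.trans (hτ m).1, (hτ m).2⟩
  have hε' := hε.comp (tendsto_add_atTop_nat m₀)
  set f : ℕ → Ω → ℝ≥0∞ := fun m ω =>
    (((Finset.Ico (-1 : ℤ) N).filter (StrictlyCrosses (W (τ m) ω))).card : ℝ≥0∞)
  have hf (m : ℕ) : ∫⁻ ω, f m ω ∂Q ≤ N * Q {ω | Crosses (W s ω) 0} +
      Q {ω | Crosses (W s ω) 0} := by
    have h := measure_strictlyCrosses_le hδ hW hS hWS hcoop hfin hfin' hs (hτ m).1 (hτ m).2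
    simp only [f]
    rw [lintegral_card_filter_of_shift (hW _ (hτI m)) hS (hWS _ (hτI m))
      measurableSet_strictlyCrosses strictlyCrosses_shift, Int.card_Ico]
    have c : ((N : ℤ) - -1).toNat = N + 1 := by omega
    rw [c, Nat.cast_add_one, add_mul, one_mul]
    gcongr
  calc (N : ℝ≥0∞) * Q {ω | Crosses (W t ω) 0}
      = ∫⁻ ω, (((Finset.Ico (0 : ℤ) N).filter (Crosses (W t ω))).card : ℝ≥0∞) ∂Q := by
        rw [lintegral_card_filter_of_shift (hW t htI) hS (hWS t htI) measurableSet_crosses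
          crosses_shift, Int.card_Ico]
        simp
    _ ≤ ∫⁻ ω, liminf (fun m => f m ω) atTop ∂Q := by
        refine lintegral_mono fun ω => le_liminf_of_le (by isBoundedDefault) ?_
        have h := hε'.eventually
          ((hcoop ω).eventually_card_crosses_le hδ (hs.trans_lt hst) ht N)
        filter_upwards [h] with m hm
        simp only [Function.comp_apply] at hm
        exact Nat.cast_le.mpr hm
    _ ≤ liminf (fun m => ∫⁻ ω, f m ω ∂Q) atTop := lintegral_liminf_le fun m =>
        (lintegral_card_filter (Q := Q) (hW _ (hτI m)) measurableSet_strictlyCrosses _).1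
    _ ≤ _ := liminf_le_of_frequently_le' (Frequently.of_forall hf)

end Stationary

section Lift

variable {n : ℕ}

lemma zeroAt_iff_crosses (w : ℤ → ℝ) (j : ℤ) : zeroAt w j ↔ Crosses w j := by
  constructor
  · rintro ⟨x, hx0, hx1, h⟩
    by_cases hw : w j = 0
    · exact Or.inl hw
    · refine Or.inr ?_
      have h1 : x * (w j * w (j + 1)) = -(1 - x) * w j ^ 2 := by linear_combination w j * h
      have h2 : 0 < (1 - x) * w j ^ 2 := mul_pos (by linarith) (by positivity)
      by_contra! h3
      linarith [mul_nonneg hx0 h3]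
  · rintro (h | h)
    · exact ⟨0, le_rfl, one_pos, by simp [h]⟩
    · have hd : w j - w (j + 1) ≠ 0 := by
        intro h0
        rw [sub_eq_zero.mp h0] at h
        nlinarith
      have key : w j / (w j - w (j + 1)) * (w j - w (j + 1)) ^ 2 = w j ^ 2 - w j * w (j + 1) := by
        field_simp
      have hd2 : 0 < (w j - w (j + 1)) ^ 2 := by positivity
      refine ⟨w j / (w j - w (j + 1)), ?_, ?_, ?_⟩
      · by_contra! h0
        nlinarith [sq_nonneg (w j)]
      · by_contra! h0
        nlinarith [sq_nonneg (w (j + 1))]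
      · field_simp
        ring

lemma Crosses.abs_le {w : ℤ → ℝ} {j : ℤ} (h : Crosses w j) : |w j| ≤ |w (j + 1) - w j| := by
  rcases h with h | h
  · simp [h]
  · rw [← sq_le_sq]
    nlinarith [sq_nonneg (w (j + 1))]

/-- The difference of two configurations, lifted by an integer. -/
def liftedDiff (ω : (Kn n × Kn n) × ℤ) (j : ℤ) : ℝ := ω.1.1.val j - ω.1.2.val j + ω.2

lemma measurable_liftedDiff : Measurable (liftedDiff (n := n)) := by
  refine measurable_pi_lambda _ fun j => ?_
  have h : Measurable fun u : Kn n => u.val j := (measurable_pi_apply j).comp measurable_subtype_coe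
  exact ((h.comp (measurable_fst.comp measurable_fst)).sub
    (h.comp (measurable_snd.comp measurable_fst))).add
      ((measurable_of_countable (fun r : ℤ => (r : ℝ))).comp measurable_snd)

lemma count_abs_add_intCast_le (D R : ℝ) :
    Measure.count {r : ℤ | |D + r| ≤ R} ≤ ⌈2 * R + 1⌉.toNat := by
  have hsub : {r : ℤ | |D + r| ≤ R} ⊆ (Finset.Icc ⌈-R - D⌉ ⌊R - D⌋ : Finset ℤ) := by
    intro r hr
    rw [mem_ofPred_eq, abs_le] at hr
    rw [Finset.mem_coe, Finset.mem_Icc, Int.ceil_le, Int.le_floor]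
    constructor <;> linarith [hr.1, hr.2]
  refine (measure_mono hsub).trans ?_
  rw [Measure.count_apply_finset, Int.card_Icc]
  refine Nat.cast_le.mpr (Int.toNat_le_toNat ?_)
  rw [Int.le_ceil_iff]
  push_cast
  linarith [Int.floor_le (R - D), Int.le_ceil (-R - D)]

lemma crosses_liftedDiff_subset (u v : Kn n) :
    {r : ℤ | Crosses (liftedDiff ((u, v), r)) 0} ⊆
      {r : ℤ | |u.val 0 - v.val 0 + r| ≤ 2 * n} := by
  intro r hr
  refine (Crosses.abs_le hr).trans ?_
  have hu := abs_le.mp (u.2 0)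
  have hv := abs_le.mp (v.2 0)
  rw [abs_le]
  simp only [liftedDiff]
  constructor <;> linarith [hu.1, hu.2, hv.1, hv.2]

lemma count_crosses_le (p : Kn n × Kn n) :
    Measure.count {r : ℤ | Crosses (liftedDiff (p, r)) 0} ≤ ⌈2 * (2 * (n : ℝ)) + 1⌉.toNat :=
  (measure_mono (crosses_liftedDiff_subset p.1 p.2)).trans (count_abs_add_intCast_le _ _)

lemma z0_eq_toReal_count (u v : Kn n) :
    (z0 u.val v.val : ℝ) =
      (Measure.count {r : ℤ | Crosses (liftedDiff ((u, v), r)) 0}).toReal := by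
  have hset : {r : ℤ | zeroAt (fun i => u.val i - v.val i + (r : ℝ)) 0} =
      {r : ℤ | Crosses (liftedDiff ((u, v), r)) 0} := by
    ext r
    exact zeroAt_iff_crosses (fun i => u.val i - v.val i + (r : ℝ)) 0
  have hfin : {r : ℤ | Crosses (liftedDiff ((u, v), r)) 0}.Finite :=
    Measure.count_apply_lt_top.mp ((count_crosses_le (u, v)).trans_lt (by finiteness))
  rw [z0, hset, Measure.count_apply_finite _ hfin, ncard_eq_toFinset_card _ hfin]
  simp

lemma measurable_count_crosses :
    Measurable fun p : Kn n × Kn n => Measure.count {r : ℤ | Crosses (liftedDiff (p, r)) 0} :=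
  measurable_measure_prodMk_left (measurable_liftedDiff (measurableSet_crosses 0))

lemma measure_abs_liftedDiff_ne_top (μ : Measure (Kn n × Kn n)) [IsFiniteMeasure μ]
    {ψ : Kn n → Kn n} (hψ : Measurable ψ) (R : ℝ) :
    (μ.prod Measure.count) {ω | |liftedDiff ((ψ ω.1.1, ψ ω.1.2), ω.2) 0| ≤ R} ≠ ⊤ := by
  have hm : Measurable fun ω : (Kn n × Kn n) × ℤ =>
      liftedDiff ((ψ ω.1.1, ψ ω.1.2), ω.2) :=
    measurable_liftedDiff.comp ((hψ.prodMap hψ).prodMap measurable_id)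
  have h0 : Measurable fun ω : (Kn n × Kn n) × ℤ => |liftedDiff ((ψ ω.1.1, ψ ω.1.2), ω.2) 0| :=
    ((measurable_pi_apply 0).comp hm).abs
  rw [Measure.prod_apply (measurableSet_le h0 measurable_const)]
  refine ne_top_of_le_ne_top ?_ (lintegral_mono fun p =>
    count_abs_add_intCast_le ((ψ p.1).val 0 - (ψ p.2).val 0) R)
  rw [lintegral_const]
  finiteness

lemma measure_crosses_liftedDiff_ne_top (μ : Measure (Kn n × Kn n)) [IsFiniteMeasure μ]
    {ψ : Kn n → Kn n} (hψ : Measurable ψ) :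
    (μ.prod Measure.count) {ω | Crosses (liftedDiff ((ψ ω.1.1, ψ ω.1.2), ω.2)) 0} ≠ ⊤ :=
  ne_top_of_le_ne_top (measure_abs_liftedDiff_ne_top μ hψ (2 * n))
    (measure_mono fun ω hω => crosses_liftedDiff_subset (ψ ω.1.1) (ψ ω.1.2) hω)

lemma Zfun_map_eq (μ₁ μ₂ : Measure (Kn n)) [IsProbabilityMeasure μ₁] [IsProbabilityMeasure μ₂]
    {ψ : Kn n → Kn n} (hψ : Measurable ψ) :
    Zfun n (μ₁.map ψ) (μ₂.map ψ) = (((μ₁.prod μ₂).prod Measure.count)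
      {ω | Crosses (liftedDiff ((ψ ω.1.1, ψ ω.1.2), ω.2)) 0}).toReal := by
  have : IsProbabilityMeasure (μ₁.map ψ) := Measure.isProbabilityMeasure_map hψ.aemeasurable
  have : IsProbabilityMeasure (μ₂.map ψ) := Measure.isProbabilityMeasure_map hψ.aemeasurable
  have hm : Measurable fun ω : (Kn n × Kn n) × ℤ =>
      liftedDiff ((ψ ω.1.1, ψ ω.1.2), ω.2) :=
    measurable_liftedDiff.comp ((hψ.prodMap hψ).prodMap measurable_id)
  have hA : MeasurableSet {ω : (Kn n × Kn n) × ℤ |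
      Crosses (liftedDiff ((ψ ω.1.1, ψ ω.1.2), ω.2)) 0} := hm (measurableSet_crosses 0)
  have hg := measurable_count_crosses (n := n)
  have hint : Integrable (fun p : Kn n × Kn n =>
      (Measure.count {r : ℤ | Crosses (liftedDiff (p, r)) 0}).toReal)
      ((μ₁.map ψ).prod (μ₂.map ψ)) := by
    refine integrable_toReal_of_lintegral_ne_top hg.aemeasurable ?_
    refine ne_top_of_le_ne_top ?_ (lintegral_mono count_crosses_le)
    rw [lintegral_const]
    finiteness
  simp only [Zfun, z0_eq_toReal_count]
  rw [← integral_prod _ hint, Measure.map_prod_map _ _ hψ hψ,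
    integral_map (hψ.prodMap hψ).aemeasurable hg.ennreal_toReal.aestronglyMeasurable,
    integral_toReal (f := fun p => Measure.count
      {r : ℤ | Crosses (liftedDiff (Prod.map ψ ψ p, r)) 0}) (hg.comp (hψ.prodMap hψ)).aemeasurable
      (ae_of_all _ fun p => (count_crosses_le _).trans_lt (by finiteness)),
    Measure.prod_apply hA]
  rfl

lemma measurable_shiftK (n : ℕ) : Measurable (shiftK n) :=
  (measurable_pi_lambda (fun u : Kn n => shift u.val) fun j =>
    (measurable_pi_apply (j - 1)).comp measurable_subtype_coe).subtype_mk

end Lift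

theorem Z_nonincreasing
    (δ : ℝ) (hδ : 0 < δ) (V : ℝ → ℝ → ℝ) (F : ℝ → ℝ)
    (hV : ContDiff ℝ 2 (Function.uncurry V))
    (hper : ∀ x y : ℝ, V (x + 1) (y + 1) = V x y)
    (htwist : ∀ x y : ℝ, V12 V x y ≤ -δ)
    (hF : Continuous F)
    (n : ℕ) (φ : ℝ → Kn n → Kn n)
    (hφ0 : φ 0 = id)
    (hφadd : ∀ s t : ℝ, 0 ≤ s → 0 ≤ t → φ (s + t) = φ s ∘ φ t)
    (hφcont : ∀ t : ℝ, 0 ≤ t → Continuous (φ t))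
    (hφsol : ∀ u : Kn n, ∀ j : ℤ, ∀ t : ℝ, 0 ≤ t →
      HasDerivWithinAt (fun s => (φ s u).val j)
        (-(V2 V ((φ t u).val (j - 1)) ((φ t u).val j)) -
          V1 V ((φ t u).val j) ((φ t u).val (j + 1)) + F t)
        (Set.Ici (0 : ℝ)) t)
    (hφshift : ∀ t : ℝ, 0 ≤ t → ∀ u : Kn n, φ t (shiftK n u) = shiftK n (φ t u))
    (μ₁ μ₂ : Measure (Kn n)) [IsProbabilityMeasure μ₁] [IsProbabilityMeasure μ₂]
    (hinv₁ : Measure.map (shiftK n) μ₁ = μ₁)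
    (hinv₂ : Measure.map (shiftK n) μ₂ = μ₂) :
    ∀ s t : ℝ, 0 ≤ s → s ≤ t →
      Zfun n (Measure.map (φ t) μ₁) (Measure.map (φ t) μ₂) ≤
        Zfun n (Measure.map (φ s) μ₁) (Measure.map (φ s) μ₂) := by
  intro s t hs hst
  rcases hst.eq_or_lt with rfl | hlt
  · rfl
  obtain ⟨C, hC⟩ := exists_cooperativeSolution hδ hV hper htwist hF hφsol t
  have hφm (τ : ℝ) (hτ : 0 ≤ τ) : Measurable (φ τ) := (hφcont τ hτ).measurable
  rw [Zfun_map_eq μ₁ μ₂ (hφm t (hs.trans hst)), Zfun_map_eq μ₁ μ₂ (hφm s hs)]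
  refine ENNReal.toReal_mono (measure_crosses_liftedDiff_ne_top _ (hφm s hs)) ?_
  have hS : MeasurePreserving (Prod.map (Prod.map (shiftK n) (shiftK n)) (id : ℤ → ℤ))
      ((μ₁.prod μ₂).prod Measure.count) ((μ₁.prod μ₂).prod Measure.count) :=
    (MeasurePreserving.prod ⟨measurable_shiftK n, hinv₁⟩ ⟨measurable_shiftK n, hinv₂⟩).prod
      (MeasurePreserving.id _)
  have hcoop (ω : (Kn n × Kn n) × ℤ) : CooperativeSolution
      (fun τ => liftedDiff ((φ τ ω.1.1, φ τ ω.1.2), ω.2))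
      (fun τ j => fkForce V (φ τ ω.1.1).val j - fkForce V (φ τ ω.1.2).val j) δ C t :=
    hC ω.1.1 ω.1.2 ω.2
  refine measure_crosses_le (T := t)
    (W := fun τ ω => liftedDiff ((φ τ ω.1.1, φ τ ω.1.2), ω.2))
    (W' := fun τ ω j => fkForce V (φ τ ω.1.1).val j - fkForce V (φ τ ω.1.2).val j) hδ
    (fun τ hτ => measurable_liftedDiff.comp
      (((hφm τ hτ.1).prodMap (hφm τ hτ.1)).prodMap measurable_id)) hS
    (fun τ hτ ω => ?_) hcoop
    (fun τ hτ => measure_crosses_liftedDiff_ne_top _ (hφm τ hτ.1))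
    (fun τ hτ => measure_abs_liftedDiff_ne_top _ (hφm τ hτ.1) 1) hs hlt le_rfl
  funext j
  simp only [liftedDiff, Prod.map_fst, Prod.map_snd, hφshift τ hτ.1, id_eq]
  rfl
end

section
/- Let M be a compact metrizable topological space, let φ : [0,∞) × M → M be a jointly continuous semiflow (φ(0,·) = id, φ(s+t,·) = φ(s,·) ∘ φ(t,·) for all s, t ≥ 0), and let T : M → M be a homeomorphism with T ∘ φ(t,·) = φ(t,·) ∘ T for all t ≥ 0. Let 𝒜 ⊆ M be the union of the supports of all Borel probability measures on M that are invariant under T and under φ(t,·) for every t ≥ 0. Then for every Borel probability measure μ on M invariant under T and every open set U with 𝒜 ⊆ U, one has lim_{S→∞} (1/S)·∫₀^S ((φ(t,·))_*μ)(U) dt = 1. -/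
open MeasureTheory Set Filter Topology

section TimeAverage

variable {M : Type*} [TopologicalSpace M] [CompactSpace M] [TopologicalSpace.MetrizableSpace M]
  [MeasurableSpace M] [BorelSpace M]

/-- The average over `t ∈ [0, S]` of the pushforwards of `μ` under `ψ t`, with time rescaled to the
unit interval so that it is a probability measure for every `S`. -/
noncomputable def timeAverage (ψ : ℝ → M → M) (μ : Measure M) (S : ℝ) : Measure M :=
  ((volume.restrict (Ioc (0 : ℝ) 1)).prod μ).map (fun p => ψ (S * p.1) p.2)

variable {ψ : ℝ → M → M} {μ : Measure M} [IsProbabilityMeasure μ]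

lemma measurable_rescaled (hψ : Continuous fun p : ℝ × M => ψ p.1 p.2) (S : ℝ) :
    Measurable fun p : ℝ × M => ψ (S * p.1) p.2 := by
  have : SecondCountableTopology M := by
    let := TopologicalSpace.metrizableSpaceMetric M
    infer_instance
  have h : Continuous fun p : ℝ × M => ψ (S * p.1) p.2 :=
    hψ.comp (f := fun p : ℝ × M => (S * p.1, p.2)) (by fun_prop)
  exact h.measurable

lemma isProbabilityMeasure_timeAverage (hψ : Continuous fun p : ℝ × M => ψ p.1 p.2) (S : ℝ) :
    IsProbabilityMeasure (timeAverage ψ μ S) := by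
  have : IsProbabilityMeasure (volume.restrict (Ioc (0 : ℝ) 1)) := ⟨by simp⟩
  exact Measure.isProbabilityMeasure_map (measurable_rescaled hψ S).aemeasurable

lemma integral_timeAverage (hψ : Continuous fun p : ℝ × M => ψ p.1 p.2) {S : ℝ} (hS : S ≠ 0)
    {f : M → ℝ} (hf : Measurable f) (hfi : Integrable f (timeAverage ψ μ S)) :
    ∫ x, f x ∂(timeAverage ψ μ S) = S⁻¹ * ∫ t in (0 : ℝ)..S, ∫ x, f (ψ t x) ∂μ := by
  have hm := (measurable_rescaled hψ S).aemeasurable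
    (μ := (volume.restrict (Ioc (0 : ℝ) 1)).prod μ)
  have h1 : Integrable (fun p : ℝ × M => f (ψ (S * p.1) p.2))
      ((volume.restrict (Ioc (0 : ℝ) 1)).prod μ) :=
    (integrable_map_measure hf.aestronglyMeasurable hm).1 hfi
  rw [timeAverage, integral_map hm hf.aestronglyMeasurable, integral_prod _ h1]
  have := intervalIntegral.integral_comp_mul_left (a := 0) (b := 1)
    (fun t => ∫ x, f (ψ t x) ∂μ) hS
  rw [mul_zero, mul_one, smul_eq_mul] at this
  rw [← this, intervalIntegral.integral_of_le zero_le_one]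

lemma timeAverage_real_apply (hψ : Continuous fun p : ℝ × M => ψ p.1 p.2) {S : ℝ} (hS : S ≠ 0)
    {U : Set M} (hU : MeasurableSet U) :
    (timeAverage ψ μ S).real U = S⁻¹ * ∫ t in (0 : ℝ)..S, (μ.map (ψ t)).real U := by
  have := isProbabilityMeasure_timeAverage (μ := μ) hψ S
  rw [← integral_indicator_one hU, integral_timeAverage hψ hS (measurable_one.indicator hU)
    ((integrable_const (1 : ℝ)).indicator hU)]
  congr 2 with t
  have ht : Measurable (ψ t) := (hψ.comp (Continuous.prodMk_right t)).measurable
  rw [← integral_indicator_one hU, integral_map ht.aemeasurable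
    (measurable_one.indicator hU).aestronglyMeasurable]

lemma map_timeAverage (hψ : Continuous fun p : ℝ × M => ψ p.1 p.2) {T : M → M}
    (hT : Measurable T) (hcomm : ∀ t, T ∘ ψ t = ψ t ∘ T) (hμ : μ.map T = μ) (S : ℝ) :
    (timeAverage ψ μ S).map T = timeAverage ψ μ S := by
  have h := measurable_rescaled hψ S
  have hp : ((volume.restrict (Ioc (0 : ℝ) 1)).prod μ).map (Prod.map id T) =
      (volume.restrict (Ioc (0 : ℝ) 1)).prod μ := by
    rw [← Measure.map_prod_map _ _ measurable_id hT, hμ, Measure.map_id]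
  rw [timeAverage, Measure.map_map hT h]
  conv_rhs => rw [← hp, Measure.map_map h (measurable_id.prodMap hT)]
  congr 1
  ext p
  exact congrFun (hcomm (S * p.1)) p.2

lemma tendsto_integral_timeAverage_shift (hψ : Continuous fun p : ℝ × M => ψ p.1 p.2)
    (hadd : ∀ s t, 0 ≤ s → 0 ≤ t → ψ (s + t) = ψ s ∘ ψ t) {s : ℝ} (hs : 0 ≤ s) (f : C(M, ℝ)) :
    Tendsto (fun S => ∫ x, f (ψ s x) ∂(timeAverage ψ μ S) - ∫ x, f x ∂(timeAverage ψ μ S))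
      atTop (𝓝 0) := by
  set g : ℝ → ℝ := fun t => ∫ x, f (ψ t x) ∂μ with hg
  have hgb : ∀ t, ‖g t‖ ≤ ‖f‖ := fun t => by
    simpa using norm_integral_le_of_norm_le_const (μ := μ)
      (Eventually.of_forall fun x => f.norm_coe_le_norm (ψ t x))
  have hgc : Continuous g := by
    refine continuous_of_dominated (bound := fun _ => ‖f‖) (fun t => ?_) (fun t => ?_)
      (integrable_const _) (Eventually.of_forall fun x => ?_)
    · exact (f.continuous.comp (hψ.comp (Continuous.prodMk_right t))).aestronglyMeasurable
    · exact Eventually.of_forall fun x => f.norm_coe_le_norm (ψ t x)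
    · exact f.continuous.comp (hψ.comp (Continuous.prodMk_left x))
  have hψs : Continuous (ψ s) := hψ.comp (Continuous.prodMk_right s)
  have hint : ∀ (h : C(M, ℝ)) (S : ℝ), Integrable h (timeAverage ψ μ S) := fun h S => by
    have := isProbabilityMeasure_timeAverage (μ := μ) hψ S
    exact Integrable.of_bound h.continuous.aestronglyMeasurable ‖h‖
      (Eventually.of_forall h.norm_coe_le_norm)
  have hlim : Tendsto (fun S : ℝ => S⁻¹ * (2 * (‖f‖ * s))) atTop (𝓝 0) := by
    simpa using tendsto_inv_atTop_zero.mul_const (2 * (‖f‖ * s))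
  refine squeeze_zero_norm' ?_ hlim
  filter_upwards [eventually_gt_atTop 0] with S hS
  have e1 := integral_timeAverage hψ hS.ne' f.continuous.measurable (hint f S)
  have e2 := integral_timeAverage hψ hS.ne' (f.continuous.comp hψs).measurable
    (hint (f.comp ⟨ψ s, hψs⟩) S)
  have e3 : ∫ t in (0 : ℝ)..S, ∫ x, (f ∘ ψ s) (ψ t x) ∂μ = ∫ t in (0 : ℝ)..S, g (t + s) := by
    refine intervalIntegral.integral_congr fun t ht => ?_
    rw [uIcc_of_le hS.le] at ht
    simp only [hg, add_comm t s, hadd s t hs ht.1, Function.comp_apply]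
  have hi : ∀ a b, IntervalIntegrable g volume a b := fun a b => hgc.intervalIntegrable a b
  have e4 : (∫ t in (0 : ℝ)..S, g (t + s)) - ∫ t in (0 : ℝ)..S, g t =
      (∫ t in S..(S + s), g t) - ∫ t in (0 : ℝ)..s, g t := by
    rw [intervalIntegral.integral_comp_add_right, zero_add]
    have h1 := intervalIntegral.integral_add_adjacent_intervals (hi 0 s) (hi s (S + s))
    have h2 := intervalIntegral.integral_add_adjacent_intervals (hi 0 S) (hi S (S + s))
    linarith
  have b1 : ‖∫ t in S..(S + s), g t‖ ≤ ‖f‖ * s := by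
    simpa [abs_of_nonneg hs] using intervalIntegral.norm_integral_le_of_norm_le_const
      (a := S) (b := S + s) (fun t _ => hgb t)
  have b2 : ‖∫ t in (0 : ℝ)..s, g t‖ ≤ ‖f‖ * s := by
    simpa [abs_of_nonneg hs] using intervalIntegral.norm_integral_le_of_norm_le_const
      (a := 0) (b := s) (fun t _ => hgb t)
  simp only [Function.comp_def] at e2 e3
  rw [e1, e2, e3, ← mul_sub, e4, norm_mul, Real.norm_of_nonneg (inv_nonneg.2 hS.le)]
  gcongr
  exact (norm_sub_le _ _).trans (by linarith)

/-- A weak limit of time averages along any filter of times going to infinity is invariant under the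
semiflow. -/
lemma map_eq_of_tendsto_timeAverage (hψ : Continuous fun p : ℝ × M => ψ p.1 p.2)
    (hadd : ∀ s t, 0 ≤ s → 0 ≤ t → ψ (s + t) = ψ s ∘ ψ t) {l : Filter ℝ} [l.NeBot]
    (hl : l ≤ atTop) {m : ℝ → ProbabilityMeasure M}
    (hm : ∀ S, (m S : Measure M) = timeAverage ψ μ S) {ν : ProbabilityMeasure M}
    (hν : Tendsto m l (𝓝 ν)) {s : ℝ} (hs : 0 ≤ s) :
    (ν : Measure M).map (ψ s) = ν := by
  have hψs : Continuous (ψ s) := hψ.comp (Continuous.prodMk_right s)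
  have := Measure.isProbabilityMeasure_map (μ := (ν : Measure M)) hψs.measurable.aemeasurable
  refine ext_of_forall_integral_eq_of_IsFiniteMeasure fun f => ?_
  rw [integral_map hψs.measurable.aemeasurable f.continuous.aestronglyMeasurable]
  have ht := ProbabilityMeasure.tendsto_iff_forall_integral_tendsto.1 hν
  have h1 := ht f
  have h2 := ht (f.compContinuous ⟨ψ s, hψs⟩)
  have h3 := (tendsto_integral_timeAverage_shift (μ := μ) hψ hadd hs f.toContinuousMap).mono_left hl
  simp only [hm] at h1 h2
  exact sub_eq_zero.1 (tendsto_nhds_unique (h2.sub h1) h3)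

/-- If every probability measure invariant under `T` and the semiflow is supported in the open set
`U`, then the time averages of a `T`-invariant measure asymptotically concentrate on `U`. -/
lemma tendsto_timeAverage_apply_one (hψ : Continuous fun p : ℝ × M => ψ p.1 p.2)
    (hadd : ∀ s t, 0 ≤ s → 0 ≤ t → ψ (s + t) = ψ s ∘ ψ t) {T : M → M} (hT : Continuous T)
    (hcomm : ∀ t, T ∘ ψ t = ψ t ∘ T) (hμ : μ.map T = μ) {U : Set M} (hU : IsOpen U)
    (hinv : ∀ ν : Measure M, IsProbabilityMeasure ν → ν.map T = ν →
      (∀ t, 0 ≤ t → ν.map (ψ t) = ν) → ν U = 1) :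
    Tendsto (fun S => timeAverage ψ μ S U) atTop (𝓝 1) := by
  rw [tendsto_iff_ultrafilter]
  intro l hl
  let m : ℝ → ProbabilityMeasure M :=
    fun S => ⟨timeAverage ψ μ S, isProbabilityMeasure_timeAverage hψ S⟩
  obtain ⟨ν, -, hν⟩ := isCompact_univ.ultrafilter_le_nhds (l.map m) (by simp)
  have hν : Tendsto m l (𝓝 ν) := hν
  have hTν : (ν : Measure M).map T = ν := by
    have h := ProbabilityMeasure.tendsto_map_of_tendsto_of_continuous m ν hν hT
    have he : ∀ S, (m S).map hT.measurable.aemeasurable = m S := fun S =>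
      Subtype.ext (map_timeAverage hψ hT.measurable hcomm hμ S)
    simp only [he] at h
    have h' := tendsto_nhds_unique h hν
    exact congrArg ProbabilityMeasure.toMeasure h'
  have hone := hinv ν inferInstance hTν fun t ht =>
    map_eq_of_tendsto_timeAverage hψ hadd hl (fun _ => rfl) hν ht
  have hle := ProbabilityMeasure.le_liminf_measure_open_of_tendsto hν hU
  rw [hone] at hle
  have hb : ∀ S, timeAverage ψ μ S U ≤ 1 := fun S =>
    have := isProbabilityMeasure_timeAverage (μ := μ) hψ S
    prob_le_one
  exact tendsto_of_le_liminf_of_limsup_le hle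
    (limsup_le_of_le (h := Eventually.of_forall hb))

end TimeAverage

/-- A measure on a compact space gives no mass to a closed set each of whose points has a null
open neighbourhood. -/
lemma measure_compl_eq_zero_of_support_subset {M : Type*} [TopologicalSpace M] [CompactSpace M]
    [MeasurableSpace M] {ν : Measure M} {U : Set M} (hU : IsOpen U)
    (h : ∀ x, (∀ V : Set M, IsOpen V → x ∈ V → 0 < ν V) → x ∈ U) : ν Uᶜ = 0 := by
  refine hU.isClosed_compl.isCompact.measure_zero_of_nhdsWithin fun x hx => ?_
  have hx' : ¬ ∀ V : Set M, IsOpen V → x ∈ V → 0 < ν V := fun hV => hx (h x hV)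
  push Not at hx'
  obtain ⟨V, hV, hxV, h0⟩ := hx'
  exact ⟨V, mem_nhdsWithin_of_mem_nhds (hV.mem_nhds hxV), nonpos_iff_eq_zero.1 h0⟩

theorem spatio_temporal_attractor
    {M : Type*} [TopologicalSpace M] [CompactSpace M] [TopologicalSpace.MetrizableSpace M]
    [MeasurableSpace M] [BorelSpace M]
    (φ : ℝ → M → M)
    (hφ0 : φ 0 = id)
    (hφadd : ∀ s t : ℝ, 0 ≤ s → 0 ≤ t → φ (s + t) = φ s ∘ φ t)
    (hφcont : ContinuousOn (fun p : ℝ × M => φ p.1 p.2) (Set.Ici (0 : ℝ) ×ˢ Set.univ))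
    (T : M ≃ₜ M)
    (hcomm : ∀ t : ℝ, 0 ≤ t → (T : M → M) ∘ φ t = φ t ∘ (T : M → M))
    -- `A` is the union of the supports of all `(φ, T)`-invariant Borel probability
    -- measures on `M`: a point is in `A` iff some invariant measure gives positive
    -- mass to each of its open neighbourhoods.
    (A : Set M)
    (hA : A = {x : M | ∃ ν : Measure M, IsProbabilityMeasure ν ∧
      Measure.map (T : M → M) ν = ν ∧ (∀ t : ℝ, 0 ≤ t → Measure.map (φ t) ν = ν) ∧
      ∀ U : Set M, IsOpen U → x ∈ U → 0 < ν U}) :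
    ∀ μ : Measure M, IsProbabilityMeasure μ → Measure.map (T : M → M) μ = μ →
      ∀ U : Set M, IsOpen U → A ⊆ U →
        Filter.Tendsto (fun S : ℝ => (1 / S) * ∫ t in (0 : ℝ)..S,
          ((Measure.map (φ t) μ) U).toReal) Filter.atTop (nhds 1) := by
  intro μ hμp hμT U hU hAU
  let ψ : ℝ → M → M := fun t => φ (max t 0)
  have hψφ : ∀ t, 0 ≤ t → ψ t = φ t := fun t ht => by simp only [ψ, max_eq_left ht]
  have hψ : Continuous fun p : ℝ × M => ψ p.1 p.2 :=
    hφcont.comp_continuous (f := fun p : ℝ × M => (max p.1 0, p.2)) (by fun_prop)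
      (fun p => ⟨le_max_right p.1 0, mem_univ _⟩)
  have hadd : ∀ s t, 0 ≤ s → 0 ≤ t → ψ (s + t) = ψ s ∘ ψ t := fun s t hs ht => by
    rw [hψφ s hs, hψφ t ht, hψφ _ (add_nonneg hs ht), hφadd s t hs ht]
  have key := tendsto_timeAverage_apply_one (μ := μ) hψ hadd T.continuous
    (fun t => hcomm _ (le_max_right t 0)) hμT hU fun ν hν hνT hνψ => by
      rw [← prob_compl_eq_zero_iff hU.measurableSet]
      refine measure_compl_eq_zero_of_support_subset hU fun x hx => hAU ?_
      rw [hA]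
      exact ⟨ν, hν, hνT, fun t ht => by rw [← hψφ t ht, hνψ t ht], hx⟩
  have key' := (ENNReal.tendsto_toReal ENNReal.one_ne_top).comp key
  rw [ENNReal.toReal_one] at key'
  refine key'.congr' ?_
  filter_upwards [eventually_gt_atTop 0] with S hS
  refine (timeAverage_real_apply hψ hS.ne' hU.measurableSet).trans ?_
  rw [one_div]
  congr 1
  refine intervalIntegral.integral_congr fun t ht => ?_
  rw [uIcc_of_le hS.le] at ht
  simp only [hψφ t ht.1, Measure.real]
end
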